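/- arXiv:1304.3530 — 7 statements merged into one kernel-verified Lean document; each statement's English description precedes it below -/
import Mathlib

section
/- Let D₁ and D₂ be coprime odd positive integers with min(D₁,D₂) > 1. If (X,Y,Z) and (X',Y',Z') are two distinct triples of positive integers with gcd(X,Y) = 1, gcd(X',Y') = 1, D₁·X² + D₂·Y² = 2^(Z+2) and D₁·X'² + D₂·Y'² = 2^(Z'+2), then Z ≠ Z'. Equivalently, for each positive integer Z there is at most one pair of positive integers (X,Y) with gcd(X,Y) = 1 and D₁·X² + D₂·Y² = 2^(Z+2). -/
/-- If `2 ^ (k + 2)` divides a difference of two odd squares `a ^ 2 - b ^ 2`, then `2 ^ (k + 1)`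
divides one of the factors `a - b` and `a + b`. -/
theorem two_pow_dvd_sub_or_add_of_odd {a b : ℤ} (ha : Odd a) (hb : Odd b) {k : ℕ}
    (h : (2 : ℤ) ^ (k + 2) ∣ (a - b) * (a + b)) :
    (2 : ℤ) ^ (k + 1) ∣ a - b ∨ (2 : ℤ) ^ (k + 1) ∣ a + b := by
  obtain ⟨u, hu⟩ : (2 : ℤ) ∣ a - b := (ha.sub_odd hb).two_dvd
  obtain ⟨v, hv⟩ : (2 : ℤ) ∣ a + b := (ha.add_odd hb).two_dvd
  have huv : (2 : ℤ) ^ k ∣ u * v := by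
    rw [hu, hv, show 2 * u * (2 * v) = 4 * (u * v) by ring,
      show (2 : ℤ) ^ (k + 2) = 4 * 2 ^ k by ring] at h
    exact (mul_dvd_mul_iff_left (by norm_num)).mp h
  have coprime_of_odd {m : ℤ} (hm : Odd m) : IsCoprime ((2 : ℤ) ^ k) m :=
    (Int.isCoprime_two_left.mpr hm).pow_left
  rw [hu, hv, pow_succ']
  rcases Int.even_or_odd u with hue | huo
  · have hvo : Odd v := by
      have : v = a - u := by linarith
      exact this ▸ ha.sub_even hue
    exact .inl (mul_dvd_mul_left 2 ((coprime_of_odd hvo).dvd_of_dvd_mul_right huv))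
  · exact .inr (mul_dvd_mul_left 2 ((coprime_of_odd huo).dvd_of_dvd_mul_left huv))

/-- An integer `w` divisible by `m` with `s ^ 2 + d * w ^ 2 = (2 * m) ^ 2` vanishes
as soon as `d > 4`. -/
theorem eq_zero_of_dvd_of_sq_add_mul_sq {m d s w : ℤ} (hm : m ≠ 0) (hd : 4 < d)
    (hdvd : m ∣ w) (h : s ^ 2 + d * w ^ 2 = (2 * m) ^ 2) : w = 0 := by
  obtain ⟨t, rfl⟩ := hdvd
  have hm2 : 0 < m ^ 2 := by positivity
  by_contra hw
  have ht : 1 ≤ t ^ 2 := by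
    have : t ≠ 0 := right_ne_zero_of_mul hw
    have : 0 < t ^ 2 := by positivity
    omega
  nlinarith [sq_nonneg s, mul_le_mul_of_nonneg_left ht (mul_nonneg (by omega : 0 ≤ d) hm2.le)]

/-- Coprime `x, y` with `a * x ^ 2 + b * y ^ 2` even, where `a` and `b` are odd, are both odd. -/
theorem odd_and_odd_of_even_form {a b x y : ℕ} (ha : Odd a) (hb : Odd b)
    (hg : Nat.gcd x y = 1) (h : Even (a * x ^ 2 + b * y ^ 2)) : Odd x ∧ Odd y := by
  have hxy : Even x ↔ Even y := by
    have ha' := Nat.not_even_iff_odd.mpr ha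
    have hb' := Nat.not_even_iff_odd.mpr hb
    simpa [Nat.even_add, Nat.even_mul, Nat.even_pow, ha', hb'] using h
  have hx : Odd x := by
    by_contra hx
    have hx' : Even x := Nat.not_odd_iff_even.mp hx
    have := Nat.dvd_gcd hx'.two_dvd (hxy.mp hx').two_dvd
    omega
  exact ⟨hx, Nat.not_even_iff_odd.mp fun hy => Nat.not_even_iff_odd.mpr hx (hxy.mpr hy)⟩

/-- For coprime odd `D₁, D₂` both `> 1`, two distinct positive coprime
solutions `(X, Y, Z)` and `(X', Y', Z')` of `D₁·X² + D₂·Y² = 2^(Z+2)`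
have distinct exponents `Z ≠ Z'`. -/
theorem stmt_6 (D₁ D₂ : ℕ) (hD₁odd : Odd D₁) (hD₂odd : Odd D₂)
    (hcop : Nat.Coprime D₁ D₂) (hD₁ : 1 < D₁) (hD₂ : 1 < D₂)
    (X Y Z X' Y' Z' : ℕ) (hX : 0 < X) (hY : 0 < Y) (hZ : 0 < Z)
    (hX' : 0 < X') (hY' : 0 < Y') (hZ' : 0 < Z')
    (hg : Nat.gcd X Y = 1) (hg' : Nat.gcd X' Y' = 1)
    (heq : D₁ * X ^ 2 + D₂ * Y ^ 2 = 2 ^ (Z + 2))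
    (heq' : D₁ * X' ^ 2 + D₂ * Y' ^ 2 = 2 ^ (Z' + 2))
    (hne : (X, Y, Z) ≠ (X', Y', Z')) :
    Z ≠ Z' := by
  rintro rfl
  have heven : Even (2 ^ (Z + 2)) := even_two.pow_of_ne_zero (by omega)
  obtain ⟨hXo, hYo⟩ := odd_and_odd_of_even_form hD₁odd hD₂odd hg (heq ▸ heven)
  obtain ⟨hXo', hYo'⟩ := odd_and_odd_of_even_form hD₁odd hD₂odd hg' (heq' ▸ heven)
  have hd : (4 : ℤ) < D₁ * D₂ := by
    obtain ⟨a, rfl⟩ := hD₁odd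
    obtain ⟨b, rfl⟩ := hD₂odd
    have : 3 * 3 ≤ (2 * a + 1) * (2 * b + 1) := Nat.mul_le_mul (by omega) (by omega)
    exact_mod_cast (by omega : 4 < (2 * a + 1) * (2 * b + 1))
  have e : (D₁ : ℤ) * X ^ 2 + D₂ * Y ^ 2 = 2 * 2 ^ (Z + 1) := by
    rw [← pow_succ']; exact_mod_cast heq
  have e' : (D₁ : ℤ) * X' ^ 2 + D₂ * Y' ^ 2 = 2 * 2 ^ (Z + 1) := by
    rw [← pow_succ']; exact_mod_cast heq'
  have hdvd : (2 : ℤ) ^ (Z + 2) ∣ ((X : ℤ) * Y' - X' * Y) * (X * Y' + X' * Y) := by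
    have hco : IsCoprime ((2 : ℤ) ^ (Z + 2)) D₁ :=
      (Int.isCoprime_two_left.mpr (by exact_mod_cast hD₁odd)).pow_left
    refine hco.dvd_of_dvd_mul_left ⟨(Y' : ℤ) ^ 2 - Y ^ 2, ?_⟩
    rw [pow_succ' 2 (Z + 1)]
    linear_combination (Y' : ℤ) ^ 2 * e - (Y : ℤ) ^ 2 * e'
  have hm : (2 : ℤ) ^ (Z + 1) ≠ 0 := by positivity
  rcases two_pow_dvd_sub_or_add_of_odd (by exact_mod_cast hXo.mul hYo')
    (by exact_mod_cast hXo'.mul hYo) hdvd with h | h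
  · have h0 := eq_zero_of_dvd_of_sq_add_mul_sq (s := D₁ * X * X' + D₂ * Y * Y') hm hd h
      (by linear_combination ((D₁ : ℤ) * X' ^ 2 + D₂ * Y' ^ 2) * e + 2 * 2 ^ (Z + 1) * e')
    have hcross : X * Y' = X' * Y := by exact_mod_cast sub_eq_zero.mp h0
    have hXX' : X = X' := Nat.dvd_antisymm
      (Nat.Coprime.dvd_of_dvd_mul_right hg (hcross ▸ Dvd.intro _ rfl))
      (Nat.Coprime.dvd_of_dvd_mul_right hg' (hcross ▸ Dvd.intro _ rfl))
    subst hXX'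
    exact hne (by rw [Nat.eq_of_mul_eq_mul_left hX hcross])
  · have h0 := eq_zero_of_dvd_of_sq_add_mul_sq (s := D₁ * X * X' - D₂ * Y * Y') hm hd h
      (by linear_combination ((D₁ : ℤ) * X' ^ 2 + D₂ * Y' ^ 2) * e + 2 * 2 ^ (Z + 1) * e')
    have : (0 : ℤ) < X * Y' + X' * Y := by positivity
    omega
end

section
/- Let D₁ and D₂ be coprime odd positive integers with min(D₁,D₂) > 1, and let D = D₁·D₂. There is no positive integer Z for which there simultaneously exist integers X, Y with gcd(X,Y) = 1 and D₁·X² + D₂·Y² = 2^(Z+2), and integers X', Y' with gcd(X',Y') = 1 and X'² + D·Y'² = 2^(Z+2). In other words, if D₁·X² + D₂·Y² = 2^(Z+2) has a solution with exponent Z, then X'² + D₁·D₂·Y'² = 2^(Z'+2) has no solution with Z' = Z. -/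
theorem Int.odd_and_odd_of_mul_sq_add_mul_sq {a b x y N : ℤ} (ha : Odd a) (hb : Odd b)
    (hN : Even N) (hxy : Int.gcd x y = 1) (h : a * x ^ 2 + b * y ^ 2 = N) : Odd x ∧ Odd y := by
  have hnot : ¬ (Even x ∧ Even y) := by
    rintro ⟨hx, hy⟩
    have h2 : (2 : ℤ) ∣ (Int.gcd x y : ℤ) := Int.dvd_coe_gcd hx.two_dvd hy.two_dvd
    rw [hxy] at h2
    norm_num at h2
  rw [← h] at hN
  have ha' := Int.not_even_iff_odd.mpr ha
  have hb' := Int.not_even_iff_odd.mpr hb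
  simp only [Int.even_add, Int.even_mul, Int.even_pow, ha', hb', false_or, ne_eq,
    OfNat.ofNat_ne_zero, not_false_eq_true, and_true] at hN
  simp only [← Int.not_even_iff_odd]
  tauto

theorem Int.two_pow_dvd_add_or_sub {s t : ℤ} {n : ℕ} (hs : Odd s) (ht : Odd t)
    (h : 2 ^ (n + 2) ∣ (s + t) * (s - t)) : 2 ^ (n + 1) ∣ s + t ∨ 2 ^ (n + 1) ∣ s - t := by
  obtain ⟨p, hp⟩ := (hs.add_odd ht).two_dvd
  obtain ⟨q, hq⟩ := (hs.sub_odd ht).two_dvd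
  have hpq : (2 : ℤ) ^ n ∣ p * q := by
    rw [hp, hq, pow_add, show 2 * p * (2 * q) = p * q * 2 ^ 2 by ring] at h
    exact Int.dvd_of_mul_dvd_mul_right (by norm_num) h
  have hs' : s = p + q := by linarith
  rw [hp, hq, pow_succ']
  rcases Int.even_or_odd p with he | ho
  · have hqo : Odd q := by
      rw [hs'] at hs
      exact (Int.odd_add'.mp hs).mpr he
    left
    have hc : IsCoprime ((2 : ℤ) ^ n) q := (Int.isCoprime_two_left.mpr hqo).pow_left
    exact mul_dvd_mul_left 2 (hc.dvd_of_dvd_mul_right hpq)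
  · right
    have hc : IsCoprime ((2 : ℤ) ^ n) p := (Int.isCoprime_two_left.mpr ho).pow_left
    exact mul_dvd_mul_left 2 (hc.dvd_of_dvd_mul_left hpq)

theorem Int.mul_sq_add_mul_sq_ne_four {a b : ℤ} (ha : Odd a) (hb : Odd b) (ha1 : 1 < a)
    (hb1 : 1 < b) (u v : ℤ) : a * u ^ 2 + b * v ^ 2 ≠ 4 := by
  intro h
  have ha3 : 3 ≤ a := by obtain ⟨k, rfl⟩ := ha; omega
  have hb3 : 3 ≤ b := by obtain ⟨k, rfl⟩ := hb; omega
  have hu : u ^ 2 ≤ 1 := by nlinarith [sq_nonneg u, sq_nonneg v]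
  have hv : v ^ 2 ≤ 1 := by nlinarith [sq_nonneg u, sq_nonneg v]
  have hu0 := sq_nonneg u
  have hv0 := sq_nonneg v
  generalize u ^ 2 = x at *
  generalize v ^ 2 = y at *
  obtain ⟨k, rfl⟩ := ha
  obtain ⟨l, rfl⟩ := hb
  interval_cases x <;> interval_cases y <;> omega

theorem Int.not_two_pow_dvd_of_mul_sq_add_mul_sq {a b x y x' y' : ℤ} {n : ℕ}
    (ha : Odd a) (hb : Odd b) (ha1 : 1 < a) (hb1 : 1 < b)
    (h : a * x ^ 2 + b * y ^ 2 = 2 ^ (n + 1)) (h' : x' ^ 2 + a * b * y' ^ 2 = 2 ^ (n + 1)) :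
    ¬ 2 ^ n ∣ y * x' + a * x * y' := by
  rintro ⟨v, hv⟩
  have key : a * (x * x' - b * y * y') ^ 2 + b * (y * x' + a * x * y') ^ 2
      = (2 ^ n) ^ 2 * 4 := by
    calc _ = (a * x ^ 2 + b * y ^ 2) * (x' ^ 2 + a * b * y' ^ 2) := by ring
      _ = _ := by rw [h, h']; ring
  rw [hv] at key
  have hdvd : ((2 : ℤ) ^ n) ^ 2 ∣ a * (x * x' - b * y * y') ^ 2 :=
    ⟨4 - b * v ^ 2, by linear_combination key⟩
  have hc : IsCoprime (((2 : ℤ) ^ n) ^ 2) a := (Int.isCoprime_two_left.mpr ha).pow_left.pow_left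
  obtain ⟨u, hu⟩ := (Int.pow_dvd_pow_iff two_ne_zero).mp (hc.dvd_of_dvd_mul_left hdvd)
  rw [hu] at key
  refine Int.mul_sq_add_mul_sq_ne_four ha hb ha1 hb1 u v
    (mul_left_cancel₀ (pow_ne_zero 2 (pow_ne_zero n (two_ne_zero' ℤ))) ?_)
  linear_combination key

/-- For coprime odd `D₁, D₂` both `> 1`, there is no positive integer `Z`
such that both `D₁·X² + D₂·Y² = 2^(Z+2)` and `X'² + D₁·D₂·Y'² = 2^(Z+2)`
have coprime integer solutions. -/
theorem stmt_7 (D₁ D₂ : ℕ) (hD₁odd : Odd D₁) (hD₂odd : Odd D₂)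
    (hcop : Nat.Coprime D₁ D₂) (hD₁ : 1 < D₁) (hD₂ : 1 < D₂) :
    ¬ ∃ (Z : ℕ) (X Y X' Y' : ℤ), 0 < Z ∧
      Int.gcd X Y = 1 ∧ Int.gcd X' Y' = 1 ∧
      (D₁ : ℤ) * X ^ 2 + (D₂ : ℤ) * Y ^ 2 = 2 ^ (Z + 2) ∧
      X' ^ 2 + ((D₁ : ℤ) * (D₂ : ℤ)) * Y' ^ 2 = 2 ^ (Z + 2) := by
  rintro ⟨Z, X, Y, X', Y', -, hXY, hXY', h, h'⟩
  have ha : Odd (D₁ : ℤ) := by exact_mod_cast hD₁odd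
  have hb : Odd (D₂ : ℤ) := by exact_mod_cast hD₂odd
  have ha1 : (1 : ℤ) < D₁ := by exact_mod_cast hD₁
  have hb1 : (1 : ℤ) < D₂ := by exact_mod_cast hD₂
  have hN : Even ((2 : ℤ) ^ (Z + 2)) := even_two.pow_of_ne_zero (by omega)
  obtain ⟨hX, hY⟩ := Int.odd_and_odd_of_mul_sq_add_mul_sq ha hb hN hXY h
  obtain ⟨hX', hY'⟩ := Int.odd_and_odd_of_mul_sq_add_mul_sq odd_one (ha.mul hb) hN hXY'
    (by rw [one_mul]; exact h')
  have hprod : (2 : ℤ) ^ (Z + 2) ∣ (Y * X' + D₁ * X * Y') * (Y * X' - D₁ * X * Y') :=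
    ⟨Y ^ 2 - D₁ * Y' ^ 2, by linear_combination Y ^ 2 * h' - D₁ * Y' ^ 2 * h⟩
  rcases Int.two_pow_dvd_add_or_sub (hY.mul hX') ((ha.mul hX).mul hY') hprod with hd | hd
  · exact Int.not_two_pow_dvd_of_mul_sq_add_mul_sq ha hb ha1 hb1 h h' hd
  · refine Int.not_two_pow_dvd_of_mul_sq_add_mul_sq (x' := X') (y' := -Y') ha hb ha1 hb1 h
      (by rw [neg_sq]; exact h') ?_
    rwa [mul_neg, ← sub_eq_add_neg]
end

section
/- Let D be a positive integer with D ≠ 7. Then the equation 1 + D·y² = 2^(z+2) has at most one solution in positive integers (y,z). Moreover, for D = 7 the equation 1 + 7·y² = 2^(z+2) has exactly two solutions in positive integers, namely (y,z) = (1,1) and (y,z) = (3,4). -/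
/-- In every solution of the Pell-type equation `(w + 1) X² - w Y² = 1`, the value `X` is odd. -/
theorem odd_of_succ_mul_sq_eq {w : ℤ} (hw : 0 < w) (n : ℕ) :
    ∀ X Y : ℤ, X.toNat = n → 0 < X → 0 < Y → (w + 1) * X ^ 2 = w * Y ^ 2 + 1 → Odd X := by
  induction n using Nat.strong_induction_on with
  | _ n ih =>
    intro X Y hn hX hY h
    obtain rfl | hX2 : X = 1 ∨ 2 ≤ X := by lia
    · exact odd_one
    have hXY : X < Y := by
      by_contra! hc
      have h1 : Y ^ 2 ≤ X ^ 2 := by gcongr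
      nlinarith
    have hpos : 0 < (2 * w + 1) * X - 2 * w * Y := by
      by_contra! hc
      have h1 : ((2 * w + 1) * X) ^ 2 ≤ (2 * w * Y) ^ 2 := by
        exact pow_le_pow_left₀ (by positivity) (by linarith) 2
      nlinarith
    have hlt : (2 * w + 1) * X - 2 * w * Y < X := by nlinarith
    have hY' : (2 * w + 1) * Y - 2 * (w + 1) * X ≠ 0 := by
      intro h0
      have h1 : (w + 1) * ((2 * w + 1) * X - 2 * w * Y) ^ 2 = 1 := by
        linear_combination h + w * ((2 * w + 1) * Y - 2 * (w + 1) * X) * h0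
      nlinarith
    have hodd := ih _ (by lia) ((2 * w + 1) * X - 2 * w * Y)
      |(2 * w + 1) * Y - 2 * (w + 1) * X| rfl hpos (abs_pos.mpr hY')
      (by rw [sq_abs]; linear_combination h)
    have hX' : X = ((2 * w + 1) * X - 2 * w * Y) + 2 * (w * (Y - X)) := by ring
    rw [hX']
    exact hodd.add_even (even_two_mul _)

theorem eq_three_of_two_pow_add_one_eq_sq {n v : ℕ} (h : 2 ^ n + 1 = v ^ 2) : n = 3 := by
  obtain ⟨t, rfl⟩ : ∃ t, v = t + 1 := by
    refine ⟨v - 1, ?_⟩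
    rcases v with _ | v <;> simp_all
  have hmul : t * (t + 2) = 2 ^ n := by linarith
  obtain ⟨i, -, hi⟩ := (Nat.dvd_prime_pow Nat.prime_two).mp (hmul ▸ Dvd.intro _ rfl)
  obtain ⟨j, -, hj⟩ := (Nat.dvd_prime_pow Nat.prime_two).mp (hmul ▸ Dvd.intro_left _ rfl)
  have ht : t = 2 := by
    rcases i with _ | _ | i
    · rcases j with _ | j
      · simp_all
      · rw [pow_succ] at hj
        lia
    · simpa using hi
    · rcases j with _ | _ | j
      · simp at hj
      · simp at hj
        rw [hj] at hi
        exact absurd hi (pow_pos two_pos _).ne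
      · rw [pow_succ, pow_succ] at hi hj
        lia
  subst ht
  exact Nat.pow_right_injective le_rfl (show 2 ^ n = 2 ^ 3 by lia)

/-- The equation `(x ^ a - 1) / (x - 1) = u²` with `x = 2 ^ d` and `a` odd forces `a = 1`. -/
theorem eq_one_of_odd_of_two_pow_sub_one_eq {d a u : ℕ} (hd : 0 < d) (ha : Odd a)
    (h : (2 : ℤ) ^ (d * a) - 1 = (2 ^ d - 1) * u ^ 2) : a = 1 := by
  obtain ⟨k, rfl⟩ := ha
  have hx : (1 : ℤ) < 2 ^ d := one_lt_pow₀ (by norm_num) hd.ne'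
  have hu : 0 < u := by
    rw [Nat.pos_iff_ne_zero]
    rintro rfl
    have : (1 : ℤ) < 2 ^ (d * (2 * k + 1)) := one_lt_pow₀ (by norm_num) (by positivity)
    simp at h
    lia
  have hodd := odd_of_succ_mul_sq_eq (w := 2 ^ d - 1) (by linarith) _ (2 ^ (d * k)) u rfl
    (by positivity) (by exact_mod_cast hu) (by rw [← h]; ring)
  by_contra hk
  have hne : d * k ≠ 0 := by
    simp only [ne_eq, mul_eq_zero, not_or]
    lia
  exact absurd ((Int.odd_pow' hne).mp hodd) (by decide)

/-- The only nontrivial square of the form `(x ^ a - 1) / (x - 1)` with `x = 2 ^ d` is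
`(8 ^ 2 - 1) / (8 - 1) = 9`. -/
theorem eq_one_or_of_two_pow_sub_one_eq {d a u : ℕ} (hd : 0 < d) (ha : 0 < a)
    (h : (2 : ℤ) ^ (d * a) - 1 = (2 ^ d - 1) * u ^ 2) : a = 1 ∨ d = 3 ∧ a = 2 := by
  rcases Nat.even_or_odd' a with ⟨k, rfl | rfl⟩
  swap
  · exact Or.inl (eq_one_of_odd_of_two_pow_sub_one_eq hd ⟨k, rfl⟩ h)
  right
  have hx : (1 : ℤ) < 2 ^ d := one_lt_pow₀ (by norm_num) hd.ne'
  have hdk : d * k ≠ 0 := by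
    simp only [ne_eq, mul_eq_zero, not_or]
    lia
  obtain ⟨S, hS⟩ : ((2 : ℤ) ^ d - 1) ∣ 2 ^ (d * k) - 1 := by
    simpa [pow_mul] using sub_dvd_pow_sub_pow ((2 : ℤ) ^ d) 1 k
  have hprod : (2 ^ (d * k) + 1) * S = (u : ℤ) ^ 2 := by
    apply mul_left_cancel₀ (show (2 : ℤ) ^ d - 1 ≠ 0 by linarith)
    rw [← h]
    linear_combination (-(2 : ℤ) ^ (d * k) - 1) * hS
  have hcop : IsCoprime ((2 : ℤ) ^ (d * k) + 1) S := by
    obtain ⟨r, hr⟩ : (2 : ℤ) ∣ 2 ^ (d * k) := dvd_pow_self 2 hdk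
    refine ⟨1 - r, (2 ^ d - 1) * r, ?_⟩
    linear_combination (-r) * hS + hr
  obtain ⟨v, hv⟩ := Int.sq_of_gcd_eq_one (Int.isCoprime_iff_gcd_eq_one.mp hcop) hprod
  have hpow : (0 : ℤ) < 2 ^ (d * k) := by positivity
  replace hv : (2 : ℤ) ^ (d * k) + 1 = v ^ 2 := hv.resolve_right fun h' ↦ by nlinarith
  have h3 : d * k = 3 := by
    apply eq_three_of_two_pow_add_one_eq_sq (v := v.natAbs)
    zify
    rw [sq_abs, hv]
  rcases (Nat.dvd_prime Nat.prime_three).mp (Dvd.intro _ h3) with rfl | rfl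
  · obtain rfl : k = 3 := by lia
    have h7 : (u : ℤ) ^ 2 = 63 := by norm_num at h; linarith
    have h7 : u ^ 2 = 63 := by exact_mod_cast h7
    have : u < 8 := by nlinarith
    interval_cases u <;> simp at h7
  · exact ⟨rfl, by lia⟩

theorem eq_or_of_one_add_mul_sq_eq_two_pow {D y z y' z' : ℕ} (hD : 0 < D)
    (hz : 0 < z) (hz' : 0 < z') (h : 1 + D * y ^ 2 = 2 ^ z) (h' : 1 + D * y' ^ 2 = 2 ^ z') :
    z = z' ∨ D = 7 ∧ (z = 3 ∧ z' = 6 ∨ z = 6 ∧ z' = 3) := by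
  have hg : 0 < Nat.gcd z z' := Nat.gcd_pos_of_pos_left _ hz
  have hgcd : D * Nat.gcd y y' ^ 2 = 2 ^ Nat.gcd z z' - 1 := by
    rw [← Nat.pow_sub_one_gcd_pow_sub_one, ← h, ← h', Nat.add_sub_cancel_left,
      Nat.add_sub_cancel_left, Nat.gcd_mul_left, Nat.pow_gcd_pow]
  obtain ⟨a, ha⟩ := Nat.gcd_dvd_left z z'
  obtain ⟨b, hb⟩ := Nat.gcd_dvd_right z z'
  obtain ⟨u, hu⟩ := Nat.gcd_dvd_left y y'
  obtain ⟨v, hv⟩ := Nat.gcd_dvd_right y y'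
  generalize Nat.gcd z z' = d at *
  generalize Nat.gcd y y' = t at *
  subst ha hb hu hv
  have hgcd' : (D : ℤ) * t ^ 2 = 2 ^ d - 1 := by
    zify [Nat.one_le_two_pow (n := d)] at hgcd
    exact hgcd
  zify at h h'
  have h1 := eq_one_or_of_two_pow_sub_one_eq (u := u) hg (Nat.pos_of_mul_pos_left hz)
    (by rw [← hgcd', ← h]; ring)
  have h2 := eq_one_or_of_two_pow_sub_one_eq (u := v) hg (Nat.pos_of_mul_pos_left hz')
    (by rw [← hgcd', ← h']; ring)
  have hD7 : d = 3 → D = 7 := by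
    rintro rfl
    norm_num at hgcd
    have : t < 3 := by nlinarith
    interval_cases t <;> lia
  rcases h1 with rfl | ⟨rfl, rfl⟩ <;> rcases h2 with rfl | ⟨h2, rfl⟩ <;> simp_all

theorem eq_of_one_add_mul_sq_eq {D y y' N : ℕ} (hD : 0 < D) (h : 1 + D * y ^ 2 = N)
    (h' : 1 + D * y' ^ 2 = N) : y = y' := by
  have : D * y ^ 2 = D * y' ^ 2 := by lia
  exact Nat.pow_left_injective two_ne_zero (Nat.eq_of_mul_eq_mul_left hD this)

/-- For a positive integer `D ≠ 7`, the equation `1 + D·y² = 2^(z+2)` has at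
most one solution in positive integers `(y, z)`; for `D = 7` it has exactly
the two solutions `(1, 1)` and `(3, 4)`. -/
theorem stmt_8 :
    (∀ D : ℕ, 0 < D → D ≠ 7 →
      ∀ y z y' z' : ℕ, 0 < y → 0 < z → 0 < y' → 0 < z' →
        1 + D * y ^ 2 = 2 ^ (z + 2) → 1 + D * y' ^ 2 = 2 ^ (z' + 2) →
        (y, z) = (y', z')) ∧
    {p : ℕ × ℕ | 0 < p.1 ∧ 0 < p.2 ∧ 1 + 7 * p.1 ^ 2 = 2 ^ (p.2 + 2)} =
      {(1, 1), (3, 4)} := by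
  refine ⟨fun D hD hD7 y z y' z' hy hz hy' hz' h h' ↦ ?_, ?_⟩
  · rcases eq_or_of_one_add_mul_sq_eq_two_pow hD (by lia) (by lia) h h' with hzz | ⟨h7, -⟩
    · obtain rfl : z = z' := by lia
      rw [eq_of_one_add_mul_sq_eq hD h h']
    · exact absurd h7 hD7
  · ext ⟨y, z⟩
    simp only [Set.mem_ofPred_eq, Set.mem_insert_iff, Set.mem_singleton_iff, Prod.mk.injEq]
    constructor
    · rintro ⟨hy, hz, h⟩
      have hzz : z = 1 ∨ z = 4 := by
        rcases eq_or_of_one_add_mul_sq_eq_two_pow (y' := 1) (z' := 3) (by norm_num) (by lia)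
          (by lia) h (by norm_num) with hzz | ⟨-, hzz⟩ <;> lia
      rcases hzz with rfl | rfl
      · exact Or.inl ⟨eq_of_one_add_mul_sq_eq (by norm_num) h (by norm_num), rfl⟩
      · exact Or.inr ⟨eq_of_one_add_mul_sq_eq (by norm_num) h (by norm_num), rfl⟩
    · rintro (⟨rfl, rfl⟩ | ⟨rfl, rfl⟩) <;> norm_num
end

section
/- Let D₁ and D₂ be coprime odd positive integers with min(D₁,D₂) > 1, and let N₁(D₁,D₂) denote the number of triples (x,m,n) of positive integers with m odd satisfying D₁·x² + D₂^m = 2^(n+2). If (D₁,D₂) ∉ {(3,5), (5,3), (13,3)}, then N₁(D₁,D₂) ≤ 2. -/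
/-- The Lehmer numbers `(α ^ (2 s + 1) - β ^ (2 s + 1)) / (α - β)`, where `(α + β) ^ 2 = A` and
`α * β = Q`. -/
def lehmerE (A Q : ℤ) : ℕ → ℤ
  | 0 => 1
  | 1 => A - Q
  | s + 2 => (A - 2 * Q) * lehmerE A Q (s + 1) - Q ^ 2 * lehmerE A Q s

/-- The companion numbers `(α ^ (2 s + 1) + β ^ (2 s + 1)) / (α + β)`, where `(α + β) ^ 2 = A` and
`α * β = Q`. -/
def lehmerF (A Q : ℤ) : ℕ → ℤ
  | 0 => 1
  | 1 => A - 3 * Q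
  | s + 2 => (A - 2 * Q) * lehmerF A Q (s + 1) - Q ^ 2 * lehmerF A Q s

theorem two_mul_lehmer_succ (A Q : ℤ) (s : ℕ) :
    2 * lehmerE A Q (s + 1) = (A - 2 * Q) * lehmerE A Q s + A * lehmerF A Q s ∧
      2 * lehmerF A Q (s + 1) = (A - 2 * Q) * lehmerF A Q s - (4 * Q - A) * lehmerE A Q s := by
  induction s with
  | zero => simp only [lehmerE, lehmerF]; constructor <;> ring
  | succ s ih =>
    obtain ⟨h1, h2⟩ := ih
    simp only [lehmerE, lehmerF]
    constructor
    · apply mul_left_cancel₀ (two_ne_zero (α := ℤ))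
      linear_combination (A - 2 * Q) * h1 - A * h2
    · apply mul_left_cancel₀ (two_ne_zero (α := ℤ))
      linear_combination (A - 2 * Q) * h2 + (4 * Q - A) * h1

theorem lehmer_norm (A Q : ℤ) (s : ℕ) :
    A * lehmerF A Q s ^ 2 + (4 * Q - A) * lehmerE A Q s ^ 2 = 4 * Q ^ (2 * s + 1) := by
  induction s with
  | zero => simp only [lehmerE, lehmerF]; ring
  | succ s ih =>
    obtain ⟨h1, h2⟩ := two_mul_lehmer_succ A Q s
    have h : 4 * (A * lehmerF A Q (s + 1) ^ 2 + (4 * Q - A) * lehmerE A Q (s + 1) ^ 2)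
        = 4 * (4 * Q ^ (2 * (s + 1) + 1)) := by
      have : A * (2 * lehmerF A Q (s + 1)) ^ 2 + (4 * Q - A) * (2 * lehmerE A Q (s + 1)) ^ 2
        = 4 * (4 * Q ^ (2 * (s + 1) + 1)) := by
        rw [h1, h2]
        linear_combination 4 * Q ^ 2 * ih
      linear_combination this
    exact mul_left_cancel₀ (by norm_num) h

theorem odd_lehmerE {A Q : ℤ} (hA : Odd A) (hQ : Even Q) (s : ℕ) : Odd (lehmerE A Q s) := by
  induction s using Nat.twoStepInduction with
  | zero => exact odd_one
  | one => exact hA.sub_even hQ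
  | more s _ h =>
    exact ((hA.sub_even (hQ.mul_left 2)).mul h).sub_even
        ((hQ.pow_of_ne_zero two_ne_zero).mul_right _)

theorem odd_lehmerF {A Q : ℤ} (hA : Odd A) (hQ : Even Q) (s : ℕ) : Odd (lehmerF A Q s) := by
  induction s using Nat.twoStepInduction with
  | zero => exact odd_one
  | one => exact hA.sub_even (hQ.mul_left 3)
  | more s _ h =>
    exact ((hA.sub_even (hQ.mul_left 2)).mul h).sub_even
        ((hQ.pow_of_ne_zero two_ne_zero).mul_right _)

theorem lehmer_binet (A Q : ℤ) : ∃ α β γ : ℂ, γ ^ 2 = A ∧ α + β = γ ∧ α * β = Q ∧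
    (α - β) ^ 2 = A - 4 * Q := by
  obtain ⟨γ, hγ⟩ := IsAlgClosed.exists_pow_nat_eq (A : ℂ) (n := 2) (by norm_num)
  obtain ⟨δ, hδ⟩ := IsAlgClosed.exists_pow_nat_eq ((A : ℂ) - 4 * Q) (n := 2) (by norm_num)
  refine ⟨(γ + δ) / 2, (γ - δ) / 2, γ, hγ, by ring, ?_, ?_⟩
  · linear_combination hγ / 4 - hδ / 4
  · linear_combination hδ

theorem sub_mul_lehmerE {A Q : ℤ} {α β : ℂ} (h1 : (α + β) ^ 2 = A) (h2 : α * β = Q) (s : ℕ) :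
    (α - β) * lehmerE A Q s = α ^ (2 * s + 1) - β ^ (2 * s + 1) := by
  induction s using Nat.twoStepInduction with
  | zero => simp [lehmerE]
  | one => simp only [lehmerE]; push_cast; rw [← h1, ← h2]; ring
  | more s ih1 ih2 =>
    simp only [lehmerE]; push_cast
    rw [← h1, ← h2] at *
    linear_combination (α ^ 2 + β ^ 2) * ih2 - (α * β) ^ 2 * ih1

theorem add_mul_lehmerF {A Q : ℤ} {α β : ℂ} (h1 : (α + β) ^ 2 = A) (h2 : α * β = Q) (s : ℕ) :
    (α + β) * lehmerF A Q s = α ^ (2 * s + 1) + β ^ (2 * s + 1) := by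
  induction s using Nat.twoStepInduction with
  | zero => simp [lehmerF]
  | one => simp only [lehmerF]; push_cast; rw [← h1, ← h2]; ring
  | more s ih1 ih2 =>
    simp only [lehmerF]; push_cast
    rw [← h1, ← h2] at *
    linear_combination (α ^ 2 + β ^ 2) * ih2 - (α * β) ^ 2 * ih1

theorem lehmerE_comp {A Q : ℤ} (hAQ : A ≠ 4 * Q) (s u : ℕ) :
    lehmerE A Q ((2 * s + 1) * u + s)
      = lehmerE A Q s * lehmerE (A * lehmerF A Q s ^ 2) (Q ^ (2 * s + 1)) u := by
  obtain ⟨α, β, γ, hγ, hs, hp, hd⟩ := lehmer_binet A Q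
  rw [← hs] at hγ
  have hne : α - β ≠ 0 := by
    intro h
    rw [h] at hd
    apply hAQ
    have : (A : ℂ) = ((4 * Q : ℤ) : ℂ) := by push_cast; linear_combination -hd
    exact_mod_cast this
  have key : ((lehmerE A Q ((2 * s + 1) * u + s) : ℤ) : ℂ)
      = ((lehmerE A Q s * lehmerE (A * lehmerF A Q s ^ 2) (Q ^ (2 * s + 1)) u : ℤ) : ℂ) := by
    apply mul_left_cancel₀ hne
    rw [sub_mul_lehmerE hγ hp]
    have h := sub_mul_lehmerE (A := A * lehmerF A Q s ^ 2) (Q := Q ^ (2 * s + 1))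
      (α := α ^ (2 * s + 1)) (β := β ^ (2 * s + 1))
      (by rw [← add_mul_lehmerF hγ hp]; push_cast; rw [← hγ]; ring)
      (by rw [← mul_pow, hp]; push_cast; rfl) u
    push_cast
    rw [← mul_assoc, sub_mul_lehmerE hγ hp, h]
    ring
  exact_mod_cast key

/-- The pair of Morgan-Voyce sequences `b, S` at `z`, determined by `b 0 = 1`, `S 0 = 0`,
`S (s + 1) = S s + b s` and `b (s + 1) = b s + z * S (s + 1)`. -/
def morganVoyce {R : Type*} [CommRing R] (z : R) : ℕ → R × R
  | 0 => (1, 0)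
  | s + 1 => ((1 + z) * (morganVoyce z s).1 + z * (morganVoyce z s).2,
      (morganVoyce z s).1 + (morganVoyce z s).2)

theorem morganVoyce_eq_sum {R : Type*} [CommRing R] (z : R) {s N : ℕ} (h : s < N) :
    (morganVoyce z s).1 = ∑ i ∈ Finset.range N, ((s + i).choose (2 * i) : R) * z ^ i ∧
      (morganVoyce z s).2 = ∑ i ∈ Finset.range N, ((s + i).choose (2 * i + 1) : R) * z ^ i := by
  induction s with
  | zero =>
    obtain ⟨M, rfl⟩ : ∃ M, N = M + 1 := ⟨N - 1, by omega⟩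
    constructor
    · rw [Finset.sum_range_succ', Finset.sum_eq_zero]
      · simp [morganVoyce]
      · intro i _
        rw [Nat.choose_eq_zero_of_lt (by omega)]; simp
    · rw [Finset.sum_eq_zero]
      · simp [morganVoyce]
      · intro i _
        rw [Nat.choose_eq_zero_of_lt (by omega)]; simp
  | succ s ih =>
    obtain ⟨h1, h2⟩ := ih (by omega)
    have hS : (morganVoyce z (s + 1)).2
        = ∑ i ∈ Finset.range N, ((s + 1 + i).choose (2 * i + 1) : R) * z ^ i := by
      simp only [morganVoyce]
      rw [h1, h2, ← Finset.sum_add_distrib]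
      refine Finset.sum_congr rfl fun i _ => ?_
      rw [show s + 1 + i = (s + i) + 1 by ring, Nat.choose_succ_succ]
      push_cast; ring
    refine ⟨?_, hS⟩
    have hb : (morganVoyce z (s + 1)).1 = (morganVoyce z s).1 + z * (morganVoyce z (s + 1)).2 := by
      simp only [morganVoyce]; ring
    rw [hb, hS, h1]
    obtain ⟨M, rfl⟩ : ∃ M, N = M + 1 := ⟨N - 1, by omega⟩
    rw [Finset.sum_range_succ', Finset.sum_range_succ' (n := M) (f := fun i =>
      ((s + 1 + i).choose (2 * i) : R) * z ^ i), Finset.sum_range_succ (n := M),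
      Nat.choose_eq_zero_of_lt (show s + 1 + M < 2 * M + 1 by omega), mul_add, Finset.mul_sum]
    have : ∀ i ∈ Finset.range M, ((s + 1 + (i + 1)).choose (2 * (i + 1)) : R) * z ^ (i + 1)
        = ((s + (i + 1)).choose (2 * (i + 1)) : R) * z ^ (i + 1)
          + z * (((s + 1 + i).choose (2 * i + 1) : R) * z ^ i) := by
      intro i _
      rw [show s + 1 + (i + 1) = (s + 1 + i) + 1 by ring,
        show 2 * (i + 1) = (2 * i + 1) + 1 by ring,
        Nat.choose_succ_succ, show s + (i + 1) = s + 1 + i by ring]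
      push_cast; ring
    rw [Finset.sum_congr rfl this, Finset.sum_add_distrib]
    simp; ring

theorem lehmerE_eq_morganVoyce {R : Type*} [CommRing R] {A Q : ℤ} {z : R}
    (h : z * (Q : R) = -(A : R)) (s : ℕ) :
    (lehmerE A Q s : R) = (-(Q : R)) ^ s * (morganVoyce z s).1 := by
  induction s using Nat.twoStepInduction with
  | zero => simp [lehmerE, morganVoyce]
  | one => simp only [lehmerE, morganVoyce]; push_cast; linear_combination h
  | more s ih1 ih2 =>
    have hb : (morganVoyce z (s + 2)).1 = (2 + z) * (morganVoyce z (s + 1)).1 -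
        (morganVoyce z s).1 := by
      simp only [morganVoyce]; ring
    rw [hb]
    simp only [lehmerE]
    push_cast
    rw [ih1, ih2]
    linear_combination (morganVoyce z (s + 1)).1 * (-(Q : R)) ^ (s + 1) * h

open Polynomial in
/-- The polynomial `∏_{1 ≤ l < i} (X - l)`. -/
noncomputable def chooseCofactor (R : Type*) [CommRing R] (i : ℕ) : R[X] :=
  ∏ l ∈ Finset.range i, (X - C ((l : R) + 1))

theorem choose_succ_mul_factorial {R : Type*} [CommRing R] (s i : ℕ) :
    (s.choose (i + 1) : R) * ((i + 1).factorial : R) = s * (chooseCofactor R i).eval (s : R) := by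
  induction i with
  | zero => simp [chooseCofactor]
  | succ i ih =>
    rw [chooseCofactor, Finset.prod_range_succ, ← chooseCofactor, Polynomial.eval_mul,
      ← mul_assoc, ← ih, Nat.factorial_succ (i + 1)]
    simp only [Polynomial.eval_sub, Polynomial.eval_X, Polynomial.eval_C]
    have h := congrArg (Nat.cast (R := R)) (Nat.choose_succ_right_eq s (i + 1))
    push_cast at h ⊢
    rcases lt_or_ge s (i + 1) with hlt | hle
    · rw [Nat.choose_eq_zero_of_lt hlt, Nat.choose_eq_zero_of_lt (by omega : s < i + 1 + 1)]
      simp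
    · rw [Nat.cast_sub hle] at h
      push_cast at h
      linear_combination ((i + 1).factorial : R) * h

open Polynomial in
/-- The polynomial `∏_{1 ≤ l < i} (X - l) (X + l + 1)`. -/
noncomputable def centralCofactor (R : Type*) [CommRing R] (i : ℕ) : R[X] :=
  ∏ l ∈ Finset.range i, ((X - C ((l : R) + 1)) * (X + C ((l : R) + 2)))

theorem choose_even_mul_factorial {R : Type*} [CommRing R] (s i : ℕ) :
    ((s + (i + 1)).choose (2 * (i + 1)) : R) * ((2 * (i + 1)).factorial : R)
      = s * (s + 1) * (centralCofactor R i).eval (s : R) := by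
  have key : ∀ k : ℕ, ((s + k).choose (2 * k + 1) : R) * (2 * k + 1)
      = (s + k).choose (2 * k) * ((s : R) - k) := by
    intro k
    have h := congrArg (Nat.cast (R := R)) (Nat.choose_succ_right_eq (s + k) (2 * k))
    push_cast at h
    rcases lt_or_ge s k with hlt | hle
    · rw [Nat.choose_eq_zero_of_lt (by omega : s + k < 2 * k),
        Nat.choose_eq_zero_of_lt (by omega : s + k < 2 * k + 1)]; simp
    · rw [Nat.cast_sub (by omega)] at h
      push_cast at h
      linear_combination h
  have key2 : ∀ k : ℕ, ((s + (k + 1)).choose (2 * (k + 1)) : R) * (2 * k + 2)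
      = (s + k + 1) * (s + k).choose (2 * k + 1) := by
    intro k
    have h := congrArg (Nat.cast (R := R)) (Nat.add_one_mul_choose_eq (s + k) (2 * k + 1))
    push_cast at h
    rw [show s + (k + 1) = s + k + 1 by ring, show 2 * (k + 1) = 2 * k + 1 + 1 by ring]
    linear_combination -h
  have step : ∀ k : ℕ, ((s + (k + 1)).choose (2 * (k + 1)) : R) * ((2 * (k + 1)).factorial : R)
      = (s + k).choose (2 * k) * ((2 * k).factorial : R) * (((s : R) - k) * (s + k + 1)) := by
    intro k
    rw [show 2 * (k + 1) = (2 * k + 1) + 1 by ring, Nat.factorial_succ, Nat.factorial_succ]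
    have h1 := key k
    have h2 := key2 k
    rw [show 2 * (k + 1) = (2 * k + 1) + 1 by ring] at h2
    push_cast
    linear_combination ((2 * k).factorial : R) * (2 * k + 1) * h2
      + ((2 * k).factorial : R) * (s + k + 1) * h1
  induction i with
  | zero => rw [step]; simp [centralCofactor]
  | succ i ih =>
    rw [step, ih, centralCofactor, centralCofactor, Finset.prod_range_succ]
    simp only [Polynomial.eval_mul, Polynomial.eval_sub, Polynomial.eval_add, Polynomial.eval_X,
      Polynomial.eval_C]
    push_cast
    ring

theorem choose_odd_mul_factorial {R : Type*} [CommRing R] (s i : ℕ) :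
    ((s + (i + 1)).choose (2 * (i + 1) + 1) : R) * ((2 * (i + 1) + 1).factorial : R)
      = s * (s + 1) * (centralCofactor R i).eval (s : R) * (s - (i + 1)) := by
  have key : ((s + (i + 1)).choose (2 * (i + 1) + 1) : R) * (2 * (i + 1) + 1)
      = (s + (i + 1)).choose (2 * (i + 1)) * ((s : R) - (i + 1)) := by
    have h := congrArg (Nat.cast (R := R)) (Nat.choose_succ_right_eq (s + (i + 1)) (2 * (i + 1)))
    push_cast at h
    rcases lt_or_ge s (i + 1) with hlt | hle
    · rw [Nat.choose_eq_zero_of_lt (by omega : s + (i + 1) < 2 * (i + 1)),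
        Nat.choose_eq_zero_of_lt (by omega : s + (i + 1) < 2 * (i + 1) + 1)]; simp
    · rw [Nat.cast_sub (by omega)] at h
      push_cast at h
      linear_combination h
  rw [← choose_even_mul_factorial, Nat.factorial_succ]
  push_cast
  linear_combination ((2 * (i + 1)).factorial : R) * key

theorem sub_one_mul_padicValNat_factorial_lt (p : ℕ) [hp : Fact p.Prime] {n : ℕ} (hn : n ≠ 0) :
    (p - 1) * padicValNat p n.factorial < n := by
  rw [sub_one_mul_padicValNat_factorial]
  have : 0 < (p.digits n).sum := by
    by_contra h
    have h0 : (p.digits n).sum = 0 := by omega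
    rw [List.sum_eq_zero_iff] at h0
    apply hn
    have hl := Nat.getLast_digit_ne_zero p hn
    exact absurd (h0 _ (List.getLast_mem (Nat.digits_ne_nil_iff_ne_zero.mpr hn))) hl
  omega

theorem exists_factorial_mul_eq (p : ℕ) [hp : Fact p.Prime] {a : ℤ_[p]} {n k : ℕ}
    (ha : (p : ℤ_[p]) ^ k ∣ a) (hk : padicValNat p n.factorial + 1 ≤ k) :
    ∃ c : ℤ_[p], (n.factorial : ℤ_[p]) * (p * c) = a := by
  have h : (n.factorial : ℤ_[p]) * p ∣ a := by
    refine dvd_trans ?_ ha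
    have hne : (n.factorial : ℤ_[p]) ≠ 0 := by exact_mod_cast n.factorial_ne_zero
    have h1 : (n.factorial : ℤ_[p]) ∣ (p : ℤ_[p]) ^ padicValNat p n.factorial := by
      have hs := PadicInt.unitCoeff_spec hne
      have hv : (n.factorial : ℤ_[p]).valuation = padicValNat p n.factorial := by
        zify
        rw [← PadicInt.valuation_coe, PadicInt.coe_natCast, Padic.valuation_natCast,
          padicValRat.of_nat]
      rw [hv] at hs
      conv_lhs => rw [hs]
      exact (Units.mul_left_dvd).mpr dvd_rfl
    calc (n.factorial : ℤ_[p]) * p ∣ (p : ℤ_[p]) ^ padicValNat p n.factorial * p :=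
          mul_dvd_mul_right h1 _
      _ = (p : ℤ_[p]) ^ (padicValNat p n.factorial + 1) := (pow_succ _ _).symm
      _ ∣ _ := pow_dvd_pow _ hk
  obtain ⟨c, hc⟩ := h
  exact ⟨c, by rw [hc]; ring⟩

open Polynomial in
/-- For an odd prime `p`, the function `s ↦ (1 + w) ^ s` with `p ∣ w` agrees on any initial segment
with a polynomial `1 + s w (1 + p P(s))`. -/
theorem exists_poly_one_add_pow {p : ℕ} [hp : Fact p.Prime] (hp3 : 3 ≤ p) {w : ℤ_[p]}
    (hw : (p : ℤ_[p]) ∣ w) (N : ℕ) :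
    ∃ P : ℤ_[p][X], ∀ s ≤ N, (1 + w) ^ s = 1 + s * w * (1 + p * P.eval (s : ℤ_[p])) := by
  have hc : ∀ i : ℕ, ∃ c : ℤ_[p], ((i + 2).factorial : ℤ_[p]) * (p * c) = w ^ (i + 1) := by
    intro i
    refine exists_factorial_mul_eq p (pow_dvd_pow_of_dvd hw _) ?_
    have h := sub_one_mul_padicValNat_factorial_lt p (n := i + 2) (by omega)
    have h2 : 2 * padicValNat p (i + 2).factorial ≤ (p - 1) * padicValNat p (i + 2).factorial :=
      Nat.mul_le_mul_right _ (by omega)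
    omega
  choose c hc using hc
  refine ⟨∑ i ∈ Finset.range N, C (c i) * chooseCofactor ℤ_[p] (i + 1), fun s hs => ?_⟩
  have hsum : (1 + w) ^ s = ∑ i ∈ Finset.range (N + 2), (s.choose i : ℤ_[p]) * w ^ i := by
    rw [add_comm, add_pow]
    rw [Finset.sum_subset (Finset.range_subset_range.mpr (show s + 1 ≤ N + 2 by omega))]
    · exact Finset.sum_congr rfl fun i _ => by rw [one_pow]; ring
    · intro i _ hi
      rw [Nat.choose_eq_zero_of_lt (by simpa using hi)]; simp
  rw [hsum, Finset.sum_range_succ', Finset.sum_range_succ', Polynomial.eval_finsetSum]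
  have : ∀ i ∈ Finset.range N, (s.choose (i + 1 + 1) : ℤ_[p]) * w ^ (i + 1 + 1)
      = s * w * p * (C (c i) * chooseCofactor ℤ_[p] (i + 1)).eval (s : ℤ_[p]) := by
    intro i _
    rw [pow_succ, ← hc, eval_mul, eval_C]
    have := choose_succ_mul_factorial (R := ℤ_[p]) s (i + 1)
    linear_combination p * c i * w * this
  rw [Finset.sum_congr rfl this, ← Finset.mul_sum]
  simp
  ring

open Polynomial in
theorem exists_poly_morganVoyce_fst {p : ℕ} [hp : Fact p.Prime] {z : ℤ_[p]}
    (hz : (5 ≤ p ∧ (p : ℤ_[p]) ∣ z) ∨ (3 ≤ p ∧ (p : ℤ_[p]) ^ 2 ∣ z)) (N : ℕ) :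
    ∃ P : ℤ_[p][X], ∀ s ≤ N, 2 * (morganVoyce z s).1
      = 2 + z * (s * (s + 1)) * (1 + p * P.eval (s : ℤ_[p])) := by
  have hc : ∀ i : ℕ, ∃ c : ℤ_[p], ((2 * (i + 2)).factorial : ℤ_[p]) * (p * c) = z ^ (i + 1) := by
    intro i
    have h := sub_one_mul_padicValNat_factorial_lt p (n := 2 * (i + 2)) (by omega)
    rcases hz with ⟨h5, hz⟩ | ⟨h3, hz⟩
    · refine exists_factorial_mul_eq p (pow_dvd_pow_of_dvd hz _) ?_
      have h2 : 4 * padicValNat p (2 * (i + 2)).factorial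
          ≤ (p - 1) * padicValNat p (2 * (i + 2)).factorial := Nat.mul_le_mul_right _ (by omega)
      omega
    · have := pow_dvd_pow_of_dvd hz (i + 1)
      rw [← pow_mul] at this
      refine exists_factorial_mul_eq p this ?_
      have h2 : 2 * padicValNat p (2 * (i + 2)).factorial
          ≤ (p - 1) * padicValNat p (2 * (i + 2)).factorial := Nat.mul_le_mul_right _ (by omega)
      omega
  choose c hc using hc
  refine ⟨∑ i ∈ Finset.range N, C (2 * c i) * centralCofactor ℤ_[p] (i + 1), fun s hs => ?_⟩
  rw [(morganVoyce_eq_sum z (show s < N + 2 by omega)).1, Finset.sum_range_succ',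
    Finset.sum_range_succ', Polynomial.eval_finsetSum]
  have : ∀ i ∈ Finset.range N, ((s + (i + 1 + 1)).choose (2 * (i + 1 + 1)) : ℤ_[p]) *
      z ^ (i + 1 + 1)
      = s * (s + 1) * z * p * (C (c i) * centralCofactor ℤ_[p] (i + 1)).eval (s : ℤ_[p]) := by
    intro i _
    rw [pow_succ, ← hc, eval_mul, eval_C]
    have := choose_even_mul_factorial (R := ℤ_[p]) s (i + 1)
    linear_combination p * c i * z * this
  have h1 := choose_even_mul_factorial (R := ℤ_[p]) s 0
  simp [centralCofactor] at h1
  rw [Finset.sum_congr rfl this, ← Finset.mul_sum]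
  simp only [C_mul, eval_mul, eval_C, mul_assoc, ← Finset.mul_sum]
  simp
  linear_combination z * h1

open Polynomial in
theorem exists_poly_morganVoyce_snd {p : ℕ} [hp : Fact p.Prime] {z : ℤ_[p]}
    (hp5 : 5 ≤ p) (hz : (p : ℤ_[p]) ∣ z) (N : ℕ) :
    ∃ P : ℤ_[p][X], ∀ s ≤ N, (morganVoyce z s).2 = s + p * P.eval (s : ℤ_[p]) := by
  have hc : ∀ i : ℕ, ∃ c : ℤ_[p], ((2 * (i + 1) + 1).factorial : ℤ_[p]) * (p * c) =
      z ^ (i + 1) := by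
    intro i
    have h := sub_one_mul_padicValNat_factorial_lt p (n := 2 * (i + 1) + 1) (by omega)
    refine exists_factorial_mul_eq p (pow_dvd_pow_of_dvd hz _) ?_
    have h2 : 4 * padicValNat p (2 * (i + 1) + 1).factorial
        ≤ (p - 1) * padicValNat p (2 * (i + 1) + 1).factorial := Nat.mul_le_mul_right _ (by omega)
    omega
  choose c hc using hc
  refine ⟨∑ i ∈ Finset.range N, C (c i) *
      (X * (X + 1) * centralCofactor ℤ_[p] i * (X - C (i + 1 : ℤ_[p]))),
    fun s hs => ?_⟩
  rw [(morganVoyce_eq_sum z (show s < N + 1 by omega)).2, Finset.sum_range_succ',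
    Polynomial.eval_finsetSum, Finset.mul_sum]
  have : ∀ i ∈ Finset.range N, ((s + (i + 1)).choose (2 * (i + 1) + 1) : ℤ_[p]) * z ^ (i + 1)
      = p * (C (c i) * (X * (X + 1) * centralCofactor ℤ_[p] i * (X - C (i + 1 : ℤ_[p])))).eval
        (s : ℤ_[p]) := by
    intro i _
    rw [← hc]
    simp only [eval_mul, eval_C, eval_sub, eval_add, eval_X, eval_one]
    have := choose_odd_mul_factorial (R := ℤ_[p]) s i
    linear_combination p * c i * this
  rw [Finset.sum_congr rfl this]
  simp
  ring

theorem exists_two_mul_mul_eq {p : ℕ} [hp : Fact p.Prime] (hp3 : 3 ≤ p) {Q : ℤ} (hQ : ¬ (p : ℤ) ∣ Q)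
    (A : ℤ) : ∃ z : ℤ_[p], 2 * (Q : ℤ_[p]) * z = -(A : ℤ_[p]) := by
  have h : IsUnit ((2 * Q : ℤ) : ℤ_[p]) := by
    rw [PadicInt.isUnit_iff]
    by_contra h
    have h1 := (PadicInt.norm_int_lt_one_iff_dvd (p := p) (2 * Q)).mp
      (lt_of_le_of_ne (PadicInt.norm_le_one _) h)
    rcases (Nat.prime_iff_prime_int.mp hp.out).dvd_or_dvd h1 with h2 | h2
    · have := Int.le_of_dvd (by norm_num) h2
      omega
    · exact hQ h2
  obtain ⟨u, hu⟩ := h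
  refine ⟨-(↑u⁻¹ * (A : ℤ_[p])), ?_⟩
  have : (2 * (Q : ℤ_[p])) = u := by rw [hu]; push_cast; rfl
  rw [this, mul_neg, ← mul_assoc, Units.mul_inv, one_mul]

theorem dvd_of_two_mul_mul_eq {p : ℕ} [hp : Fact p.Prime] (hp3 : 3 ≤ p) {Q A : ℤ}
    (hQ : ¬ (p : ℤ) ∣ Q) {z : ℤ_[p]} (h : 2 * (Q : ℤ_[p]) * z = -(A : ℤ_[p])) {k : ℕ}
    (hA : (p : ℤ) ^ k ∣ A) : (p : ℤ_[p]) ^ k ∣ z := by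
  have hA' : (p : ℤ_[p]) ^ k ∣ ((2 * Q : ℤ) : ℤ_[p]) * z := by
    have := (PadicInt.pow_p_dvd_int_iff k A).mpr hA
    push_cast
    rw [h]
    exact (dvd_neg).mpr this
  refine PadicInt.prime_p.pow_dvd_of_dvd_mul_left k ?_ hA'
  intro h1
  have h2 := (PadicInt.pow_p_dvd_int_iff 1 (2 * Q)).mp (by simpa using h1)
  rw [pow_one] at h2
  rcases (Nat.prime_iff_prime_int.mp hp.out).dvd_or_dvd h2 with h2 | h2
  · have := Int.le_of_dvd (by norm_num) h2
    omega
  · exact hQ h2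

open Polynomial in
theorem exists_poly_of_lehmerE_sq_eq_one {p : ℕ} [hp : Fact p.Prime] {A Q : ℤ}
    (hA : (5 ≤ p ∧ (p : ℤ) ∣ A) ∨ (3 ≤ p ∧ (p : ℤ) ^ 2 ∣ A)) (hQ : ¬ (p : ℤ) ∣ Q) {z : ℤ_[p]}
    (hz : 2 * (Q : ℤ_[p]) * z = -(A : ℤ_[p])) (N : ℕ) :
    ∃ P R : ℤ_[p][X], ∀ s ≤ N, 0 < s → lehmerE A Q s ^ 2 = 1 →
      ((Q : ℤ_[p]) ^ (p - 1) - 1) * (1 + p * P.eval (s : ℤ_[p]))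
        = z * (s + 1) * (1 + p * R.eval (s : ℤ_[p])) := by
  have hp3 : 3 ≤ p := by omega
  have hpA : (p : ℤ) ^ 1 ∣ A := by
    rcases hA with h | h
    · simpa using h.2
    · exact dvd_trans (pow_dvd_pow _ (by norm_num)) h.2
  have hz1 : (p : ℤ_[p]) ∣ z := by simpa using dvd_of_two_mul_mul_eq hp3 hQ hz hpA
  obtain ⟨y, rfl⟩ := hz1
  set z : ℤ_[p] := p * y with hzdef
  have hz2 : (5 ≤ p ∧ (p : ℤ_[p]) ∣ 2 * z) ∨ (3 ≤ p ∧ (p : ℤ_[p]) ^ 2 ∣ 2 * z) := by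
    rcases hA with h | h
    · left
      exact ⟨h.1, Dvd.intro_left _ (by rw [hzdef]; ring : 2 * y * p = 2 * z)⟩
    · right
      exact ⟨h.1, (dvd_of_two_mul_mul_eq hp3 hQ hz h.2).mul_left 2⟩
  have hw : (p : ℤ_[p]) ∣ (Q : ℤ_[p]) ^ (p - 1) - 1 := by
    have h1 := Int.ModEq.pow_card_sub_one_eq_one hp.out (n := Q)
      ((Nat.prime_iff_prime_int.mp hp.out).coprime_iff_not_dvd.mpr hQ).symm
    have h2 := (PadicInt.pow_p_dvd_int_iff (p := p) 1 (Q ^ (p - 1) - 1)).mpr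
      (by rw [pow_one]; exact h1.symm.dvd)
    simpa using h2
  set w : ℤ_[p] := (Q : ℤ_[p]) ^ (p - 1) - 1 with hwdef
  obtain ⟨P1, hP1⟩ := exists_poly_one_add_pow hp3 hw N
  obtain ⟨P2, hP2⟩ := exists_poly_morganVoyce_fst hz2 N
  obtain ⟨k, hk⟩ := powAddExpansion (1 : ℤ_[p][X]) (C z * (X * (X + 1)) * (1 + C (p : ℤ_[p]) * P2))
    (p - 1)
  let P3 : ℤ_[p][X] := P2 - 1 - C (p : ℤ_[p]) * P2
    - k * C y * (X * (X + 1)) * (1 + C (p : ℤ_[p]) * P2) ^ 2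
  refine ⟨P1 - C y * (X * (X + 1)) * (1 + C (p : ℤ_[p]) * P3) * (1 + C (p : ℤ_[p]) * P1), P3,
    fun s hs hs0 he => ?_⟩
  have h1 := hP1 s hs
  have h2 := hP2 s hs
  have hb : (morganVoyce (2 * z) s).1
      = 1 + z * (s * (s + 1)) * (1 + p * P2.eval (s : ℤ_[p])) := by
    apply mul_left_cancel₀ (two_ne_zero (α := ℤ_[p]))
    linear_combination h2
  have hbp : (morganVoyce (2 * z) s).1 ^ (p - 1)
      = 1 - z * (s * (s + 1)) * (1 + p * P3.eval (s : ℤ_[p])) := by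
    have h3 := congrArg (Polynomial.eval (s : ℤ_[p])) hk
    simp only [eval_pow, eval_add, eval_mul, eval_C, eval_X, eval_one, one_pow, eval_natCast,
      mul_one] at h3
    rw [hb, h3]
    simp only [P3, eval_pow, eval_add, eval_sub, eval_mul, eval_C, eval_X, eval_one]
    rw [Nat.cast_sub (by omega), Nat.cast_one, hzdef]
    ring
  have hE : (1 + w) ^ s * (morganVoyce (2 * z) s).1 ^ (p - 1) = 1 := by
    have heven : Even (p - 1) := hp.out.even_sub_one (by omega)
    have h4 := lehmerE_eq_morganVoyce (R := ℤ_[p]) (A := A) (Q := Q) (z := 2 * z)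
      (by linear_combination hz) s
    have h5 : (lehmerE A Q s : ℤ_[p]) ^ (p - 1) = 1 := by
      obtain ⟨m, hm⟩ := heven
      rw [hm, ← two_mul, pow_mul]
      have : (lehmerE A Q s : ℤ_[p]) ^ 2 = 1 := by
        exact_mod_cast congrArg (Int.cast (R := ℤ_[p])) he
      rw [this, one_pow]
    rw [h4, mul_pow, ← pow_mul, mul_comm s, pow_mul, heven.neg_pow] at h5
    rw [hwdef]
    rw [add_sub_cancel]
    exact h5
  rw [h1, hbp] at hE
  have hsne : (s : ℤ_[p]) ≠ 0 := by exact_mod_cast hs0.ne'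
  apply mul_left_cancel₀ hsne
  simp only [eval_add, eval_sub, eval_mul, eval_C, eval_X, eval_one]
  linear_combination hE + (1 + p * P3.eval (s : ℤ_[p])) * (s * w * (s * (s + 1))) *
      (1 + p * P1.eval (s : ℤ_[p])) * hzdef

theorem one_add_p_mul_ne_zero {p : ℕ} [hp : Fact p.Prime] (x : ℤ_[p]) : 1 + p * x ≠ 0 := by
  intro h
  have h1 : (p : ℤ_[p]) ∣ 1 := ⟨-x, by linear_combination h⟩
  exact PadicInt.prime_p.not_dvd_one h1

/-- There is at most one positive index `s` with `e_s = ± 1`. -/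
theorem lehmerE_sq_eq_one_unique {p : ℕ} [hp : Fact p.Prime] {A Q : ℤ} (hA0 : A ≠ 0)
    (hA : (5 ≤ p ∧ (p : ℤ) ∣ A) ∨ (3 ≤ p ∧ (p : ℤ) ^ 2 ∣ A)) (hQ : ¬ (p : ℤ) ∣ Q) {s t : ℕ}
    (hs : 0 < s) (ht : 0 < t) (hes : lehmerE A Q s ^ 2 = 1) (het : lehmerE A Q t ^ 2 = 1) :
    s = t := by
  have hp3 : 3 ≤ p := by omega
  obtain ⟨z, hz⟩ := exists_two_mul_mul_eq hp3 hQ A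
  have hz0 : z ≠ 0 := by
    rintro rfl
    apply hA0
    have : (A : ℤ_[p]) = 0 := by linear_combination hz
    exact_mod_cast this
  obtain ⟨P, R, h⟩ := exists_poly_of_lehmerE_sq_eq_one hA hQ hz (max s t)
  have h1 := h s (le_max_left _ _) hs hes
  have h2 := h t (le_max_right _ _) ht het
  obtain ⟨a, ha⟩ := Polynomial.sub_dvd_eval_sub (s : ℤ_[p]) (t : ℤ_[p]) P
  obtain ⟨b, hb⟩ := Polynomial.sub_dvd_eval_sub (s : ℤ_[p]) (t : ℤ_[p]) R
  set w : ℤ_[p] := (Q : ℤ_[p]) ^ (p - 1) - 1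
  have hw0 : w ≠ 0 := by
    intro hw
    rw [hw, zero_mul] at h1
    have hs1 : ((s : ℤ_[p]) + 1) ≠ 0 := by exact_mod_cast s.succ_ne_zero
    exact mul_ne_zero (mul_ne_zero hz0 hs1) (one_add_p_mul_ne_zero _) h1.symm
  set x := P.eval (s : ℤ_[p])
  set x' := P.eval (t : ℤ_[p])
  set r := R.eval (s : ℤ_[p])
  set r' := R.eval (t : ℤ_[p])
  have hc : (1 + p * x) * ((t + 1) * (1 + p * r')) = (1 + p * x') * ((s + 1) * (1 + p * r)) := by
    apply mul_left_cancel₀ (mul_ne_zero hw0 hz0)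
    linear_combination z * ((t + 1) * (1 + p * r')) * h1 - (z * ((s + 1) * (1 + p * r))) * h2
  have hprod : ((t : ℤ_[p]) - s) * (1 + p * (r' + x + p * x * r'
      - (s + 1) * (a - b - p * (x' * b) + p * (r' * a)))) = 0 := by
    linear_combination hc - (s + 1) * p * (1 + p * r') * ha + (s + 1) * p * (1 + p * x') * hb
  rcases mul_eq_zero.mp hprod with h3 | h3
  · have : (t : ℤ_[p]) = s := by linear_combination h3
    exact_mod_cast this.symm
  · exact absurd h3 (one_add_p_mul_ne_zero _)

theorem lehmerE_sq_ne_one_of_pow_dvd {p : ℕ} [hp : Fact p.Prime] {A Q : ℤ}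
    (hA : (5 ≤ p ∧ (p : ℤ) ∣ A) ∨ (3 ≤ p ∧ (p : ℤ) ^ 2 ∣ A)) (hQ : ¬ (p : ℤ) ∣ Q) {k : ℕ}
    (hk : (p : ℤ) ^ k ∣ A) (hkQ : ¬ (p : ℤ) ^ k ∣ Q ^ (p - 1) - 1) {s : ℕ} (hs : 0 < s) :
    lehmerE A Q s ^ 2 ≠ 1 := by
  intro hes
  have hp3 : 3 ≤ p := by omega
  obtain ⟨z, hz⟩ := exists_two_mul_mul_eq hp3 hQ A
  obtain ⟨P, R, h⟩ := exists_poly_of_lehmerE_sq_eq_one hA hQ hz s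
  have h1 := h s le_rfl hs hes
  apply hkQ
  rw [← PadicInt.pow_p_dvd_int_iff]
  push_cast
  refine PadicInt.prime_p.pow_dvd_of_dvd_mul_right k (b := 1 + p * P.eval (s : ℤ_[p])) ?_ ?_
  · intro hd
    have h2 : (p : ℤ_[p]) ∣ 1 := (dvd_add_left (dvd_mul_right _ _)).mp hd
    exact PadicInt.prime_p.not_dvd_one h2
  · rw [h1, mul_assoc]
    exact (dvd_of_two_mul_mul_eq hp3 hQ hz hk).mul_right _

theorem morganVoyce_three_mul {R : Type*} [CommRing R] (z : R) (u : ℕ) :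
    (morganVoyce z (3 * u)).1 = (morganVoyce (z * (z + 3) ^ 2) u).1
        - z * (z + 3) * (morganVoyce (z * (z + 3) ^ 2) u).2 ∧
      (morganVoyce z (3 * u)).2 = (z + 3) * (z + 1) * (morganVoyce (z * (z + 3) ^ 2) u).2 := by
  induction u with
  | zero => simp [morganVoyce]
  | succ u ih =>
    obtain ⟨h1, h2⟩ := ih
    rw [show 3 * (u + 1) = 3 * u + 1 + 1 + 1 by ring]
    simp only [morganVoyce]
    rw [h1, h2]
    constructor <;> ring

theorem morganVoyce_three_mul_add_two {R : Type*} [CommRing R] (z : R) (u : ℕ) :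
    (morganVoyce z (3 * u + 2)).1 = (morganVoyce (z * (z + 3) ^ 2) (u + 1)).1
        - z * (z + 3) * (z + 2) * (morganVoyce (z * (z + 3) ^ 2) (u + 1)).2 := by
  obtain ⟨h1, h2⟩ := morganVoyce_three_mul z u
  rw [show 3 * u + 2 = 3 * u + 1 + 1 by ring]
  simp only [morganVoyce]
  rw [h1, h2]
  ring

open Polynomial in
theorem exists_poly_one_add_pow_mul_morganVoyce {p : ℕ} [hp : Fact p.Prime] (hp5 : 5 ≤ p)
    {x : ℤ_[p]} (hx : (p : ℤ_[p]) ∣ x) (y r : ℤ_[p]) (N : ℕ) :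
    ∃ P : ℤ_[p][X], ∀ u ≤ N,
      (1 + x) ^ (3 * u) * ((morganVoyce (y * x ^ 2) u).1 + x * r * (morganVoyce (y * x ^ 2) u).2)
        = 1 + x * ((3 + r) * u + p * P.eval (u : ℤ_[p])) := by
  obtain ⟨x0, rfl⟩ := hx
  set x : ℤ_[p] := p * x0 with hxdef
  have hpx : (p : ℤ_[p]) ∣ x := Dvd.intro _ rfl
  have hw : (p : ℤ_[p]) ∣ x * (3 + 3 * x + x ^ 2) := hpx.mul_right _
  have hz : (p : ℤ_[p]) ∣ y * x ^ 2 := (hpx.trans (Dvd.intro_left x (by ring))).mul_left y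
  obtain ⟨h, hh⟩ := exists_two_mul_mul_eq (p := p) (by omega) (Q := 1)
    (fun h => by have := Int.le_of_dvd one_pos h; omega) (-1)
  have hh' : 2 * h = 1 := by simpa using hh
  obtain ⟨P1, hP1⟩ := exists_poly_one_add_pow (by omega) hw N
  obtain ⟨P2, hP2⟩ := exists_poly_morganVoyce_fst (Or.inl ⟨hp5, hz⟩) N
  obtain ⟨P3, hP3⟩ := exists_poly_morganVoyce_snd hp5 hz N
  let K1 : ℤ_[p][X] := C (x0 * (3 + x)) + C (3 + 3 * x + x ^ 2) * P1
  let K2 : ℤ_[p][X] := C (x0 * y * h) * (X * (X + 1)) * (1 + C (p : ℤ_[p]) * P2)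
  refine ⟨X * K1 + K2 + C r * P3 + C x0 * X * (3 + C (p : ℤ_[p]) * K1)
    * (C (p : ℤ_[p]) * K2 + C r * (X + C (p : ℤ_[p]) * P3)), fun u hu => ?_⟩
  have h1 := hP1 u hu
  have h2 := hP2 u hu
  have h3 := hP3 u hu
  have hb : (morganVoyce (y * x ^ 2) u).1
      = 1 + h * (y * x ^ 2) * (u * (u + 1)) * (1 + p * P2.eval (u : ℤ_[p])) := by
    apply mul_left_cancel₀ (two_ne_zero (α := ℤ_[p]))
    rw [h2]
    linear_combination (-(y * x ^ 2) * (u * (u + 1)) * (1 + p * P2.eval (u : ℤ_[p]))) * hh'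
  have hpow : (1 + x) ^ (3 * u) = (1 + x * (3 + 3 * x + x ^ 2)) ^ u := by
    rw [pow_mul]; congr 1; ring
  rw [hpow, h1, hb, h3]
  simp only [K1, K2, eval_add, eval_mul, eval_C, eval_X, eval_one, eval_ofNat]
  rw [hxdef]
  ring

theorem lehmerE_three_unique_of_prime {p : ℕ} [hp : Fact p.Prime] (hp5 : 5 ≤ p) {Q : ℤ}
    (hQ : (p : ℤ) ∣ Q - 1) (hQ1 : Q ≠ 1) :
    (∀ u, lehmerE 3 Q (3 * u) ^ 2 = 1 → u = 0) ∧
      ∀ u v, lehmerE 3 Q (3 * u + 2) ^ 2 = 1 → lehmerE 3 Q (3 * v + 2) ^ 2 = 1 → u = v := by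
  have hpQ : ¬ (p : ℤ) ∣ Q := by
    intro h
    have h1 : (p : ℤ) ∣ 1 := by simpa using dvd_sub h hQ
    have := Int.le_of_dvd one_pos h1
    omega
  set x : ℤ_[p] := (Q : ℤ_[p]) - 1 with hxdef
  have hpx : (p : ℤ_[p]) ∣ x := by
    have := (PadicInt.pow_p_dvd_int_iff (p := p) 1 (Q - 1)).mpr (by simpa using hQ)
    simpa using this
  have hx0 : x ≠ 0 := by
    intro h
    apply hQ1
    have : (Q : ℤ_[p]) = 1 := by linear_combination h
    exact_mod_cast this
  have hQx : (Q : ℤ_[p]) = 1 + x := by rw [hxdef]; ring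
  obtain ⟨q, hq⟩ := exists_two_mul_mul_eq (p := p) (by omega) hpQ (-2)
  have hqQ : q * (1 + x) = 1 := by
    apply mul_left_cancel₀ (two_ne_zero (α := ℤ_[p]))
    push_cast at hq
    rw [hQx] at hq
    linear_combination hq
  obtain ⟨x0, hx0'⟩ := hpx
  -- `(-1) ^ s * e_s` is `1` as soon as it is `± 1`, since it is `1` modulo `p`
  have hsign : ∀ (s : ℕ) (c : ℤ_[p]), lehmerE 3 Q s ^ 2 = 1 →
      (1 + x) ^ s * (morganVoyce (-3 * q) s).1 = 1 + p * c →
      (1 + x) ^ s * (morganVoyce (-3 * q) s).1 = 1 := by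
    intro s c he hc
    have h1 := lehmerE_eq_morganVoyce (R := ℤ_[p]) (A := 3) (Q := Q) (z := -3 * q)
      (by rw [hQx]; push_cast; linear_combination -3 * hqQ) s
    have h2 : ((1 + x) ^ s * (morganVoyce (-3 * q) s).1) ^ 2 = 1 := by
      have h3 : (lehmerE 3 Q s : ℤ_[p]) ^ 2 = 1 := by
        exact_mod_cast congrArg (Int.cast (R := ℤ_[p])) he
      rw [h1, neg_pow, hQx] at h3
      have h4 : ((-1 : ℤ_[p]) ^ s) ^ 2 = 1 := by rw [← pow_mul, mul_comm, pow_mul]; simp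
      linear_combination h3 - ((1 + x) ^ s * (morganVoyce (-3 * q) s).1) ^ 2 * h4
    rcases mul_self_eq_one_iff.mp ((sq _).symm.trans h2) with h3 | h3
    · exact h3
    · exfalso
      have h4 : ((p : ℤ_[p]) ^ 1) ∣ ((2 : ℤ) : ℤ_[p]) :=
          ⟨-c, by push_cast; linear_combination h3 - hc⟩
      have h5 := (PadicInt.pow_p_dvd_int_iff (p := p) 1 2).mp h4
      rw [pow_one] at h5
      have := Int.le_of_dvd (by norm_num) h5
      omega
  have hq1 : q = 1 - q * x := by linear_combination hqQ
  have hq2 : q = 1 - p * (q * x0) := by linear_combination hqQ - q * hx0'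
  have hz' : -3 * q * (-3 * q + 3) ^ 2 = (-27 * q ^ 3) * x ^ 2 := by
    linear_combination 27 * q * (1 - q + q * x) * hq1
  have hnd : ∀ m a : ℤ_[p], ∀ k : ℤ, ¬ p ∣ k.natAbs → m * (k + p * a) = 0 → m = 0 := by
    intro m a k hk h
    rcases mul_eq_zero.mp h with h | h
    · exact h
    · exfalso
      have h4 : ((p : ℤ_[p]) ^ 1) ∣ (k : ℤ_[p]) := ⟨-a, by linear_combination h⟩
      have h5 := (PadicInt.pow_p_dvd_int_iff (p := p) 1 k).mp h4
      rw [pow_one] at h5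
      exact hk (Int.natCast_dvd.mp h5)
  have h6 : ¬ p ∣ 6 := by
    intro h
    rcases (Nat.Prime.dvd_mul hp.out).mp (show p ∣ 2 * 3 from h) with h1 | h1
    · have := Nat.le_of_dvd (by norm_num) h1
      omega
    · have := Nat.le_of_dvd (by norm_num) h1
      omega
  have h12 : ¬ p ∣ 12 := by
    intro h
    rcases (Nat.Prime.dvd_mul hp.out).mp (show p ∣ 2 * 6 from h) with h1 | h1
    · have := Nat.le_of_dvd (by norm_num) h1
      omega
    · exact h6 h1
  constructor
  · intro u hu
    obtain ⟨P, hP⟩ := exists_poly_one_add_pow_mul_morganVoyce hp5 (x := x) ⟨x0, hx0'⟩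
      (-27 * q ^ 3) (9 * q ^ 2) u
    have hF : ∀ v ≤ u, lehmerE 3 Q (3 * v) ^ 2 = 1 →
        (3 + 9 * q ^ 2) * v + p * P.eval (v : ℤ_[p]) = 0 := by
      intro v hv he
      have h1 := hP v hv
      have h2 : (morganVoyce (-3 * q) (3 * v)).1 = (morganVoyce ((-27 * q ^ 3) * x ^ 2) v).1
          + x * (9 * q ^ 2) * (morganVoyce ((-27 * q ^ 3) * x ^ 2) v).2 := by
        rw [(morganVoyce_three_mul (-3 * q) v).1, hz']
        linear_combination (-9 * q) * (morganVoyce ((-27 * q ^ 3) * x ^ 2) v).2 * hqQ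
      rw [← h2] at h1
      have h3 := hsign (3 * v) (x0 * ((3 + 9 * q ^ 2) * v + p * P.eval (v : ℤ_[p]))) he
        (by rw [h1, hx0']; ring)
      apply mul_left_cancel₀ hx0
      linear_combination h3 - h1
    have h0 := hF 0 (Nat.zero_le _) (by simp [lehmerE])
    have h1 := hF u le_rfl hu
    obtain ⟨a, ha⟩ := Polynomial.sub_dvd_eval_sub (u : ℤ_[p]) ((0 : ℕ) : ℤ_[p]) P
    have h2 : (u : ℤ_[p]) = 0 := by
      refine hnd u (a - 9 * q * x0 * (q + 1)) 12 h12 ?_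
      push_cast at *
      linear_combination h1 - h0 - p * ha - 9 * u * (q + 1) * hq2
    exact_mod_cast h2
  · intro u v hu hv
    obtain ⟨P, hP⟩ := exists_poly_one_add_pow_mul_morganVoyce hp5 (x := x) ⟨x0, hx0'⟩
      (-27 * q ^ 3) (9 * q ^ 2 * (2 - 3 * q)) (max u v + 1)
    have hF : ∀ t ≤ max u v, lehmerE 3 Q (3 * t + 2) ^ 2 = 1 →
        (3 + 9 * q ^ 2 * (2 - 3 * q)) * (t + 1) + p * P.eval (t + 1 : ℤ_[p]) = 1 := by
      intro t ht he
      have h1 := hP (t + 1) (by omega)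
      have h2 : (morganVoyce (-3 * q) (3 * t + 2)).1
          = (morganVoyce ((-27 * q ^ 3) * x ^ 2) (t + 1)).1 + x * (9 * q ^ 2 * (2 - 3 * q))
            * (morganVoyce ((-27 * q ^ 3) * x ^ 2) (t + 1)).2 := by
        rw [morganVoyce_three_mul_add_two (-3 * q) t, hz']
        linear_combination (-9 * q) * (2 - 3 * q) *
          (morganVoyce ((-27 * q ^ 3) * x ^ 2) (t + 1)).2 * hqQ
      rw [← h2, show 3 * (t + 1) = 3 * t + 2 + 1 by ring, pow_succ] at h1
      push_cast at h1
      have h3 := hsign (3 * t + 2) (x0 * (q * ((3 + 9 * q ^ 2 * (2 - 3 * q)) * (t + 1)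
          + p * P.eval (t + 1 : ℤ_[p])) - q)) he
        (by linear_combination q * h1 -
          ((1 + x) ^ (3 * t + 2) * (morganVoyce (-3 * q) (3 * t + 2)).1
              - 1) * hqQ + (q * ((3 + 9 * q ^ 2 * (2 - 3 * q)) * (t + 1)
          + p * P.eval (t + 1 : ℤ_[p])) - q) * hx0')
      apply mul_left_cancel₀ hx0
      linear_combination (1 + x) * h3 - h1
    have h0 := hF u (le_max_left _ _) hu
    have h1 := hF v (le_max_right _ _) hv
    obtain ⟨a, ha⟩ := Polynomial.sub_dvd_eval_sub (u + 1 : ℤ_[p]) (v + 1 : ℤ_[p]) P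
    have h2 : (u : ℤ_[p]) - v = 0 := by
      refine hnd (u - v) (a + 9 * q * x0 * (1 + q + 3 * q ^ 2)) (-6) (by simpa using h6) ?_
      push_cast at *
      linear_combination h0 - h1 - p * ha + 9 * (u - v) * (1 + q + 3 * q ^ 2) * hq2
    have h3 : (u : ℤ_[p]) = v := by linear_combination h2
    exact_mod_cast h3

theorem lehmerE_dvd_lehmerE_mul {A Q : ℤ} (hAQ : A ≠ 4 * Q) (s u : ℕ) :
    lehmerE A Q s ∣ lehmerE A Q ((2 * s + 1) * u + s) := by
  rw [lehmerE_comp hAQ]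
  exact dvd_mul_right _ _

theorem lehmerE_modEq_of_period {A Q m : ℤ} {k P : ℕ}
    (h0 : lehmerE A Q (k + P) ≡ lehmerE A Q k [ZMOD m])
    (h1 : lehmerE A Q (k + 1 + P) ≡ lehmerE A Q (k + 1) [ZMOD m]) (s : ℕ) :
    lehmerE A Q (k + s + P) ≡ lehmerE A Q (k + s) [ZMOD m] := by
  induction s using Nat.twoStepInduction with
  | zero => exact h0
  | one => exact h1
  | more s ih1 ih2 =>
    rw [show k + (s + 2) + P = k + s + P + 2 by ring, show k + (s + 2) = k + s + 2 by ring]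
    simp only [lehmerE]
    rw [show k + (s + 1) + P = k + s + P + 1 by ring] at ih2
    exact (ih2.mul_left _).sub (ih1.mul_left _)

theorem lehmerE_modEq_add_mul {A Q m : ℤ} {k P : ℕ}
    (h0 : lehmerE A Q (k + P) ≡ lehmerE A Q k [ZMOD m])
    (h1 : lehmerE A Q (k + 1 + P) ≡ lehmerE A Q (k + 1) [ZMOD m]) (s j : ℕ) :
    lehmerE A Q (k + s + P * j) ≡ lehmerE A Q (k + s) [ZMOD m] := by
  induction j with
  | zero => rfl
  | succ j ih =>
    have := lehmerE_modEq_of_period h0 h1 (s + P * j)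
    rw [show k + (s + P * j) + P = k + s + P * (j + 1) by ring,
      show k + (s + P * j) = k + s + P * j by ring] at this
    exact this.trans ih

theorem lehmerE_three_four_sq_eq_one {s : ℕ} (hs : 0 < s) (he : lehmerE 3 4 s ^ 2 = 1) : s = 1 := by
  have hmod : s % 3 = 1 := by
    have h16 := lehmerE_modEq_add_mul (A := 3) (Q := 4) (m := 16) (k := 1) (P := 4)
      (by simp only [lehmerE]; decide) (by simp only [lehmerE]; decide) ((s - 1) % 4) ((s - 1) / 4)
    have h7 := lehmerE_modEq_add_mul (A := 3) (Q := 4) (m := 7) (k := 0) (P := 24)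
      (by decide) (by decide) (s % 24) (s / 24)
    rw [show 1 + (s - 1) % 4 + 4 * ((s - 1) / 4) = s by omega] at h16
    rw [show 0 + s % 24 + 24 * (s / 24) = s by omega, zero_add] at h7
    have hd16 : ∀ r < 4, lehmerE 3 4 (1 + r) % 16 = 1 ∨ lehmerE 3 4 (1 + r) % 16 = 15 → r = 0 := by
      decide
    have hd7 : ∀ r < 24, lehmerE 3 4 r % 7 = 1 ∨ lehmerE 3 4 r % 7 = 6 → r % 4 = 1 → r % 3 = 1 := by
      decide
    have he' : lehmerE 3 4 s = 1 ∨ lehmerE 3 4 s = -1 := by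
      rcases mul_self_eq_one_iff.mp ((sq _).symm.trans he) with h | h <;> simp [h]
    unfold Int.ModEq at h16 h7
    have h4 := hd16 _ (Nat.mod_lt _ (by norm_num)) (by
      rw [← h16]; rcases he' with h | h <;> rw [h] <;> simp)
    have h24 := hd7 _ (Nat.mod_lt _ (by norm_num)) (by
      rw [← h7]; rcases he' with h | h <;> rw [h] <;> simp) (by omega)
    omega
  obtain ⟨u, rfl⟩ : ∃ u, s = (2 * 1 + 1) * u + 1 := ⟨s / 3, by omega⟩
  rcases Nat.eq_zero_or_pos u with rfl | hu
  · rfl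
  · exfalso
    rw [lehmerE_comp (by norm_num)] at he
    simp only [lehmerE, lehmerF] at he
    have : Fact (Nat.Prime 3) := ⟨Nat.prime_three⟩
    refine lehmerE_sq_ne_one_of_pow_dvd (p := 3) (A := 3 * (3 - 3 * 4) ^ 2) (Q := 4 ^ (2 * 1 + 1))
      (Or.inr (by norm_num)) (by norm_num) (k := 5) (by norm_num) (by norm_num) hu ?_
    linear_combination he

theorem lehmerE_pow_two_sq_eq_one_unique {A : ℤ} {n : ℕ} (hA : Odd A) (hA3 : 3 ≤ A) (hn : 1 ≤ n)
    (hne : ¬ (A = 3 ∧ n = 1)) {s t : ℕ} (hs : 0 < s) (ht : 0 < t)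
    (hes : lehmerE A (2 ^ n) s ^ 2 = 1) (het : lehmerE A (2 ^ n) t ^ 2 = 1) : s = t := by
  have hAQ : A ≠ 4 * 2 ^ n := by
    rintro rfl
    exact (Int.not_odd_iff_even.mpr ((by decide : Even (4 : ℤ)).mul_right _)) hA
  have hpQ : ∀ p : ℕ, p.Prime → 3 ≤ p → ¬ (p : ℤ) ∣ 2 ^ n := by
    intro p hp h3 h
    have h1 := Int.prime_iff_natAbs_prime.mpr (by simpa using hp) |>.dvd_of_dvd_pow h
    have := Int.le_of_dvd (by norm_num) h1
    omega
  have key : ∀ N : ℕ, Odd N → (∀ p : ℕ, p.Prime → 5 ≤ p → ¬ p ∣ N) → ∃ k, N = 3 ^ k := by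
    intro N hN h
    refine ⟨N.primeFactorsList.length, Nat.eq_prime_pow_of_unique_prime_dvd hN.pos.ne' ?_⟩
    intro d hd hdN
    by_contra h3
    have h2 : d ≠ 2 := by
      rintro rfl
      exact (Nat.not_even_iff_odd.mpr hN) (even_iff_two_dvd.mpr hdN)
    have h4 : d ≠ 4 := by rintro rfl; revert hd; decide
    have := hd.two_le
    exact h d hd (by omega) hdN
  by_cases h5 : ∃ p : ℕ, p.Prime ∧ 5 ≤ p ∧ (p : ℤ) ∣ A
  · obtain ⟨p, hp, hp5, hpA⟩ := h5
    have : Fact p.Prime := ⟨hp⟩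
    exact lehmerE_sq_eq_one_unique (by omega) (Or.inl ⟨hp5, hpA⟩) (hpQ p hp (by omega)) hs ht hes
        het
  by_cases h9 : (9 : ℤ) ∣ A
  · have : Fact (Nat.Prime 3) := ⟨Nat.prime_three⟩
    exact lehmerE_sq_eq_one_unique (p := 3) (by omega) (Or.inr ⟨le_rfl, by norm_num; exact h9⟩)
      (hpQ 3 Nat.prime_three le_rfl) hs ht hes het
  have hA' : A = 3 := by
    lift A to ℕ using by omega
    obtain ⟨k, hk⟩ := key A (by exact_mod_cast hA) (fun p hp hp5 h =>
      h5 ⟨p, hp, hp5, by exact_mod_cast h⟩)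
    match k, hk with
    | 0, hk => simp at hk; omega
    | 1, hk => simp [hk]
    | k + 2, hk =>
      exfalso
      apply h9
      rw [hk]
      push_cast
      exact Dvd.intro_left _ (by ring : 3 ^ k * 9 = (3 : ℤ) ^ (k + 2))
  subst hA'
  have hn2 : 2 ≤ n := by
    by_contra h
    exact hne ⟨rfl, by omega⟩
  rcases Nat.eq_or_lt_of_le hn2 with rfl | hn3
  · rw [lehmerE_three_four_sq_eq_one hs (by simpa using hes),
      lehmerE_three_four_sq_eq_one ht (by simpa using het)]
  have h8 : (8 : ℤ) ∣ 2 ^ n := by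
    have := pow_dvd_pow (2 : ℤ) hn3
    simpa using this
  have h8' : (8 : ℤ) ≤ 2 ^ n := Int.le_of_dvd (by positivity) h8
  obtain ⟨p, hp, hp5, hpQ1⟩ : ∃ p : ℕ, p.Prime ∧ 5 ≤ p ∧ (p : ℤ) ∣ 2 ^ n - 1 := by
    by_contra h
    push Not at h
    have hpos : 1 ≤ 2 ^ n := Nat.one_le_two_pow
    have hodd : Odd (2 ^ n - 1) := by
      rw [Nat.odd_sub hpos]
      simp [Nat.even_pow]; omega
    obtain ⟨k, hk⟩ := key (2 ^ n - 1) hodd (fun p hp hp5 hd => h p hp hp5 (by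
      have := Int.natCast_dvd_natCast.mpr hd
      rw [Nat.cast_sub hpos] at this
      simpa using this))
    have h81 : 8 ∣ 2 ^ n := pow_dvd_pow 2 hn3
    have hk8 : 3 ^ k % 8 = 1 ∨ 3 ^ k % 8 = 3 := by
      clear hk
      induction k with
      | zero => simp
      | succ k ih => rw [pow_succ]; omega
    omega
  have : Fact p.Prime := ⟨hp⟩
  obtain ⟨hc0, hc2⟩ := lehmerE_three_unique_of_prime hp5 hpQ1 (by omega)
  have hc1 : ∀ u, lehmerE 3 (2 ^ n) (3 * u + 1) ^ 2 ≠ 1 := by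
    intro u hu
    have h1 := lehmerE_dvd_lehmerE_mul hAQ 1 u
    have h2 : lehmerE 3 (2 ^ n) 1 ∣ 1 := by
      rw [← hu]
      exact h1.trans (dvd_pow_self _ two_ne_zero)
    simp only [lehmerE] at h2
    have h3 := Int.le_of_dvd one_pos ((neg_dvd).mpr h2)
    rcases Int.isUnit_iff.mp (isUnit_of_dvd_one h2) with h3 | h3 <;> omega
  have hcls : ∀ r, 0 < r → lehmerE 3 (2 ^ n) r ^ 2 = 1 → ∃ u, r = 3 * u + 2 := by
    intro r hr he
    refine ⟨r / 3, ?_⟩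
    by_contra hne2
    rcases (by omega : r = 3 * (r / 3) ∨ r = 3 * (r / 3) + 1) with h | h
    · rw [h] at he
      have := hc0 _ he
      omega
    · rw [h] at he
      exact hc1 _ he
  obtain ⟨u, rfl⟩ := hcls s hs hes
  obtain ⟨v, rfl⟩ := hcls t ht het
  rw [hc2 u v hes het]

theorem lehmerE_succ_modEq_sq (A Q : ℤ) (s : ℕ) :
    lehmerE A Q (s + 1) ≡ (-(4 * Q - A)) ^ s * ((2 * s + 3) * Q - (4 * Q - A)) [ZMOD Q ^ 2] := by
  induction s with
  | zero => simp only [lehmerE]; unfold Int.ModEq; congr 1; push_cast; ring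
  | succ s ih =>
    have h := ih.mul_left (A - 2 * Q)
    simp only [lehmerE]
    rw [Int.modEq_iff_dvd] at h ⊢
    obtain ⟨c, hc⟩ := h
    refine ⟨c + lehmerE A Q s - 2 * (2 * s + 3) * (-(4 * Q - A)) ^ s, ?_⟩
    push_cast
    linear_combination hc

theorem two_pow_dvd_pow_sub_one_iff {D : ℤ} (hD : Odd D) (k N : ℕ) :
    2 ^ N ∣ D ^ (2 * k) - 1 ↔ 2 ^ N ∣ (D ^ 2 - 1) * k := by
  have h := Int.two_pow_sub_pow (x := D) (y := 1) (n := 2 * k)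
    (by have := hD.sub_odd odd_one; exact this.two_dvd)
    (by rw [← even_iff_two_dvd, Int.not_even_iff_odd]; exact hD) (even_two_mul k)
  rw [one_pow] at h
  have h2 : emultiplicity (2 : ℤ) ((2 * k : ℕ) : ℤ) = 1 + emultiplicity (2 : ℤ) (k : ℤ) := by
    push_cast
    rw [emultiplicity_mul Int.prime_two]
    congr 1
    exact (FiniteMultiplicity.of_prime_left Int.prime_two two_ne_zero).emultiplicity_self
  have h3 : emultiplicity (2 : ℤ) (D ^ (2 * k) - 1) = emultiplicity (2 : ℤ) ((D ^ 2 - 1) * k) := by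
    rw [show (D ^ 2 - 1) * (k : ℤ) = (D + 1) * (D - 1) * k by ring,
      emultiplicity_mul Int.prime_two, emultiplicity_mul Int.prime_two]
    rw [h2] at h
    have h4 : emultiplicity (2 : ℤ) (D ^ (2 * k) - 1) + 1 = (emultiplicity 2 (D + 1)
        + emultiplicity 2 (D - 1) + emultiplicity (2 : ℤ) (k : ℤ)) + 1 := by
      rw [h]; ring
    exact (ENat.add_left_injective_of_ne_top (by simp)) h4
  rw [pow_dvd_iff_le_emultiplicity, pow_dvd_iff_le_emultiplicity, h3]

theorem exists_unit_sq_dvd_of_lehmerE {Q D : ℤ} {m s : ℕ} (hm : 1 ≤ m) (hDs : D = 2 * s + 3)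
    (hcop : IsCoprime (Q ^ 2) D) (he : lehmerE (4 * Q - D ^ m) Q (s + 1) ^ 2 = D ^ 2) :
    ∃ ε : ℤ, (ε = 1 ∨ ε = -1) ∧ Q ^ 2 ∣ D ^ (m * s) * (Q - D ^ (m - 1)) - ε := by
  have h := (lehmerE_succ_modEq_sq (4 * Q - D ^ m) Q s).dvd
  have hDm : D ^ m = D * D ^ (m - 1) := by rw [← pow_succ', Nat.sub_add_cancel hm]
  have hs : (-1 : ℤ) ^ s * (-1) ^ s = 1 := by rw [← mul_pow]; simp
  have hpow : (-(4 * Q - (4 * Q - D ^ m))) ^ s = (-1) ^ s * D ^ (m * s) := by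
    rw [pow_mul, ← mul_pow]; congr 1; ring
  rw [hpow] at h
  have key : ∀ η : ℤ, lehmerE (4 * Q - D ^ m) Q (s + 1) = η * D →
      Q ^ 2 ∣ D ^ (m * s) * (Q - D ^ (m - 1)) - (-1) ^ s * η := by
    intro η hη
    apply hcop.dvd_of_dvd_mul_right
    rw [hη] at h
    obtain ⟨c, hc⟩ := h
    refine ⟨(-1) ^ s * c, ?_⟩
    rw [← hDs] at hc
    linear_combination (-1) ^ s * hc - (D ^ (m * s) * (D * Q - D ^ m)) * hs + D ^ (m * s) * hDm
  have hsgn := neg_one_pow_eq_or ℤ s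
  rcases sq_eq_sq_iff_eq_or_eq_neg.mp he with h1 | h1
  · exact ⟨_, by rcases hsgn with h | h <;> simp [h], key 1 (by rw [h1]; ring)⟩
  · exact ⟨_, by rcases hsgn with h | h <;> simp [h], key (-1) (by rw [h1]; ring)⟩

theorem sq_dvd_one_add_pow_sub (x : ℤ) (N : ℕ) : x ^ 2 ∣ (1 + x) ^ N - 1 - N * x := by
  obtain ⟨k, hk⟩ := Polynomial.powAddExpansion 1 x N
  refine ⟨k, ?_⟩
  rw [hk]; simp; ring

theorem cube_dvd_one_add_pow_sub (x : ℤ) (N : ℕ) :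
    x ^ 3 ∣ 2 * ((1 + x) ^ N - 1 - N * x) - N * (N - 1) * x ^ 2 := by
  induction N with
  | zero => simp
  | succ N ih =>
    obtain ⟨c, hc⟩ := ih
    refine ⟨c * (1 + x) + N * (N - 1), ?_⟩
    push_cast
    linear_combination (1 + x) * hc

theorem three_pow_two_pow_modEq {n : ℕ} (hn : 6 ≤ n) :
    (32 * 2 ^ n : ℤ) ∣ 3 ^ 2 ^ (n - 2) - (1 - 3 * 2 ^ n) := by
  induction n, hn using Nat.le_induction with
  | base => norm_num
  | succ n hn ih =>
    obtain ⟨c, hc⟩ := ih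
    obtain ⟨j, rfl⟩ := Nat.exists_eq_add_of_le hn
    have h : (3 : ℤ) ^ 2 ^ (6 + j + 1 - 2) = (3 ^ 2 ^ (6 + j - 2)) ^ 2 := by
      rw [← pow_mul, ← pow_succ]; congr 2; omega
    rw [h, eq_add_of_sub_eq hc]
    exact ⟨c + 2 ^ j * (32 * c - 3) ^ 2, by ring⟩

theorem sq_dvd_unit_of_pow_mul {Q P ε : ℤ} (h : Q ^ 2 ∣ P * (Q - 1) - ε) :
    Q ^ 2 ∣ P + ε * (1 + Q) := by
  obtain ⟨c, hc⟩ := h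
  exact ⟨P - (Q + 1) * c, by linear_combination -(Q + 1) * hc⟩

/-- If `Q ∣ M * k` exactly, with `k` odd, and `Q` a power of two, then `M` is an odd multiple
of `Q`. -/
theorem exists_odd_mul_of_dvd_mul {n : ℕ} {M k : ℤ} (hk : Odd k) (h : 2 ^ n ∣ M * k)
    (h' : ¬ 2 * 2 ^ n ∣ M * k) : ∃ c, Odd c ∧ M = c * 2 ^ n := by
  have hcop : IsCoprime ((2 : ℤ) ^ n) k :=
    (Int.isCoprime_two_left.mpr hk).pow_left
  obtain ⟨c, hc⟩ := hcop.dvd_of_dvd_mul_right h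
  refine ⟨c, ?_, by rw [hc]; ring⟩
  by_contra hodd
  obtain ⟨b, hb⟩ := Int.not_odd_iff_even.mp hodd
  exact h' ⟨b * k, by rw [hc, hb]; ring⟩

section LargeModulus

variable {n s : ℕ} {c ε : ℤ}

theorem not_sq_dvd_of_odd (hn : 4 ≤ n) (hε : ε = 1 ∨ ε = -1)
    (hc : 2 * (s + 1 : ℤ) = c * 2 ^ n) (hc0 : 0 < c) (hc4 : c < 4) :
    ¬ ((2 : ℤ) ^ n) ^ 2 ∣ (2 * s + 3) ^ s * (2 ^ n - 1) - ε := by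
  have hQ : (16 : ℤ) ≤ 2 ^ n := by
    calc (16 : ℤ) = 2 ^ 4 := by norm_num
      _ ≤ 2 ^ n := pow_le_pow_right₀ (by norm_num) hn
  generalize (2 : ℤ) ^ n = Q at *
  intro h
  obtain ⟨a, ha⟩ := sq_dvd_one_add_pow_sub (c * Q) s
  rw [show (2 * s + 3 : ℤ) = 1 + c * Q by rw [← hc]; ring] at h
  obtain ⟨b, hb⟩ := h
  have h1 : Q * (2 * (1 + c)) - 2 - 2 * ε
      = Q ^ 2 * (2 * b - 2 * c ^ 2 * a * (Q - 1) - 2 * s * c + c ^ 2) := by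
    linear_combination 2 * hb - 2 * (Q - 1) * ha + c * Q * hc
  rcases hε with rfl | rfl
  · have : Q ∣ 4 := ⟨2 * (1 + c) - Q * (2 * b - 2 * c ^ 2 * a * (Q - 1) - 2 * s * c + c ^ 2), by
      linear_combination -h1⟩
    have := Int.le_of_dvd (by norm_num) this
    omega
  · have : Q ∣ 2 * (1 + c) := ⟨2 * b - 2 * c ^ 2 * a * (Q - 1) - 2 * s * c + c ^ 2, by
      apply mul_left_cancel₀ (show Q ≠ 0 by omega)
      linear_combination h1⟩
    have := Int.le_of_dvd (by omega) this
    omega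

theorem not_sq_dvd_of_two_mod_four (hn : 6 ≤ n) (hε : ε = 1 ∨ ε = -1) (hs : s % 4 = 2)
    (hc : 4 * (s + 2 : ℤ) = c * 2 ^ n) (hc0 : 0 < c) (hc8 : c < 8) :
    ¬ ((2 : ℤ) ^ n) ^ 2 ∣ (2 * s + 3) ^ s * (2 ^ n - 1) - ε := by
  intro h
  obtain ⟨i, rfl⟩ := Nat.exists_eq_add_of_le hn
  have hq : (1 : ℤ) ≤ 2 ^ i := one_le_pow₀ (by norm_num)
  have h := sq_dvd_unit_of_pow_mul h
  rw [pow_add] at h hc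
  generalize (2 : ℤ) ^ i = q at *
  obtain ⟨t, rfl⟩ : ∃ t, s = 4 * t + 2 := ⟨s / 4, by omega⟩
  obtain ⟨a, ha⟩ := cube_dvd_one_add_pow_sub (-2 * ((4 * t + 2 : ℕ) + 2)) (4 * t + 2)
  have heven : (2 * ((4 * t + 2 : ℕ) : ℤ) + 3) ^ (4 * t + 2)
      = (1 + (-2 * (((4 * t + 2 : ℕ) : ℤ) + 2))) ^ (4 * t + 2) := by
    rw [← Even.neg_pow ⟨2 * t + 1, by ring⟩]; congr 1
  rw [heven] at h
  generalize (1 + (-2 * (((4 * t + 2 : ℕ) : ℤ) + 2))) ^ (4 * t + 2) = P at *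
  obtain ⟨b, hb⟩ := h
  push_cast at ha hc
  have htc : (t : ℤ) = 4 * c * q - 1 := by linarith
  rw [htc] at ha
  have h1 : ∃ d, P = 1 + 64 * q * c + 512 * q ^ 2 * c ^ 2 + 2048 * q ^ 2 * d := by
    refine ⟨c ^ 2 - 8 * a * c ^ 3 * q - 20 * c ^ 3 * q + 64 * q ^ 2 * c ^ 4, ?_⟩
    apply mul_left_cancel₀ (two_ne_zero (α := ℤ))
    linear_combination ha
  obtain ⟨d, hd⟩ := h1
  rw [hd] at hb
  rcases hε with rfl | rfl
  · have : 64 * q ∣ 2 := ⟨64 * q * b - (8 * q * c ^ 2 + 32 * q * d) - c - 1, by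
      linear_combination hb⟩
    have := Int.le_of_dvd (by norm_num) this
    omega
  · have h2 : c - 1 = 8 * q * (8 * b - c ^ 2 - 4 * d) := by
      apply mul_left_cancel₀ (show 64 * q ≠ 0 by omega)
      linear_combination hb
    have h3 : c = 1 := by
      have h4 : 8 * q ∣ c - 1 := ⟨_, h2⟩
      rcases (show 0 ≤ c - 1 by omega).eq_or_lt with h5 | h5
      · omega
      · have := Int.le_of_dvd h5 h4
        omega
    rw [h3] at h2
    have h4 : (8 * b - 1 ^ 2 - 4 * d) = 0 := by
      rcases mul_eq_zero.mp h2.symm with h | h <;> omega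
    omega

theorem not_sq_dvd_of_zero_mod_four (hn : 8 ≤ n) (hε : ε = 1 ∨ ε = -1)
    (hc : 4 * (s : ℤ) = c * 2 ^ n) (hc0 : 0 < c) (hc8 : c < 8) :
    ¬ ((2 : ℤ) ^ n) ^ 2 ∣ (2 * s + 3) ^ s * (2 ^ n - 1) - ε := by
  intro h
  have h := sq_dvd_unit_of_pow_mul h
  obtain ⟨g, hg⟩ := three_pow_two_pow_modEq (show 6 ≤ n by omega)
  obtain ⟨i, rfl⟩ := Nat.exists_eq_add_of_le hn
  lift c to ℕ using hc0.le
  have hs : s = 2 ^ (8 + i - 2) * c := by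
    have h1 : 4 * s = c * 2 ^ (8 + i) := by exact_mod_cast hc
    rw [show 8 + i - 2 = 6 + i by omega]
    rw [pow_add] at h1 ⊢
    linarith
  have h3 : ∃ d : ℤ, (3 : ℤ) ^ s = 1 - 3 * c * 2 ^ (8 + i) + 32 * 2 ^ (8 + i) * d := by
    rw [hs, pow_mul, show (3 : ℤ) ^ 2 ^ (8 + i - 2) = 1 + 2 ^ (8 + i) * (32 * g - 3) by
      linear_combination hg]
    obtain ⟨a, ha⟩ := sq_dvd_one_add_pow_sub (2 ^ (8 + i) * (32 * g - 3)) c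
    exact ⟨c * g + 8 * 2 ^ i * (32 * g - 3) ^ 2 * a, by linear_combination ha⟩
  obtain ⟨d, hd⟩ := h3
  obtain ⟨k, hk⟩ := Polynomial.powAddExpansion (3 : ℤ) (2 * s) s
  have hq : (1 : ℤ) ≤ 2 ^ i := one_le_pow₀ (by norm_num)
  obtain ⟨b, hb⟩ := h
  rw [add_comm (2 * (s : ℤ)) 3, hk, hd] at hb
  rw [pow_add] at hb hc
  have hs' : (s : ℤ) = 64 * c * 2 ^ i := by linarith
  rw [hs'] at hb
  generalize (2 : ℤ) ^ i = q at *
  generalize (3 : ℤ) ^ (s - 1) = w at *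
  rcases hε with rfl | rfl
  · have : 256 * q ∣ 2 := ⟨256 * q * b - 1 + 3 * c - 32 * d - 32 * q * c ^ 2 * w
      - 64 * c ^ 2 * k * q, by linear_combination hb⟩
    have := Int.le_of_dvd (by norm_num) this
    omega
  · have h2 : (3 * c + 1 : ℤ) = 32 * (d + q * c ^ 2 * w + 2 * c ^ 2 * k * q - 8 * q * b) := by
      apply mul_left_cancel₀ (show 256 * q ≠ 0 by omega)
      linear_combination -hb
    omega

end LargeModulus

theorem sq_dvd_small_cases : ∀ n : Fin 8, ∀ s : Fin 256, 2 ≤ n.val → 1 ≤ s.val →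
    2 * s.val + 6 ≤ 4 * 2 ^ n.val →
    ((2 * s.val + 3) ^ s.val * (2 ^ n.val - 1) % (2 ^ n.val) ^ 2 = 1 ∨
      (2 * s.val + 3) ^ s.val * (2 ^ n.val - 1) % (2 ^ n.val) ^ 2 = (2 ^ n.val) ^ 2 - 1) →
    n.val = 2 ∧ s.val = 1 ∨ n.val = 3 ∧ s.val = 11 ∨ n.val = 4 ∧ s.val = 28 := by
  decide +kernel

theorem sq_dvd_small {n s : ℕ} {ε : ℤ} (hn : 2 ≤ n) (hn8 : n < 8) (hs : 1 ≤ s)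
    (hsn : 2 * s + 6 ≤ 4 * 2 ^ n) (hε : ε = 1 ∨ ε = -1)
    (h : ((2 : ℤ) ^ n) ^ 2 ∣ (2 * s + 3) ^ s * (2 ^ n - 1) - ε) :
    n = 2 ∧ s = 1 ∨ n = 3 ∧ s = 11 ∨ n = 4 ∧ s = 28 := by
  have h4 : 4 ≤ 2 ^ n := by
    calc 4 = 2 ^ 2 := by norm_num
      _ ≤ 2 ^ n := Nat.pow_le_pow_right (by norm_num) hn
  have h128 : 2 ^ n ≤ 128 := by
    calc 2 ^ n ≤ 2 ^ 7 := Nat.pow_le_pow_right (by norm_num) (by omega)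
      _ = 128 := by norm_num
  refine sq_dvd_small_cases ⟨n, hn8⟩ ⟨s, by omega⟩ hn hs hsn ?_
  change (2 * s + 3) ^ s * (2 ^ n - 1) % (2 ^ n) ^ 2 = 1 ∨
    (2 * s + 3) ^ s * (2 ^ n - 1) % (2 ^ n) ^ 2 = (2 ^ n) ^ 2 - 1
  have h16 : 16 ≤ (2 ^ n) ^ 2 := by nlinarith
  have h1 : (((2 * s + 3) ^ s * (2 ^ n - 1) : ℕ) : ℤ) = (2 * s + 3) ^ s * (2 ^ n - 1) := by
    push_cast [Nat.cast_sub (show 1 ≤ 2 ^ n by omega)]; ring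
  rw [← h1, show ((2 : ℤ) ^ n) ^ 2 = (((2 ^ n) ^ 2 : ℕ) : ℤ) by push_cast; ring] at h
  generalize (2 * s + 3) ^ s * (2 ^ n - 1) = X at *
  generalize (2 ^ n) ^ 2 = M at *
  rw [← Int.modEq_iff_dvd] at h
  have h2 := h.symm
  rcases hε with rfl | rfl
  · left
    exact Nat.mod_eq_of_modEq (Int.natCast_modEq_iff.mp (by simpa using h2)) (by omega)
  · right
    refine Nat.mod_eq_of_modEq (Int.natCast_modEq_iff.mp (h2.trans ?_)) (by omega)
    rw [Int.modEq_iff_dvd, Nat.cast_sub (by omega)]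
    exact ⟨1, by push_cast; ring⟩

theorem exact_dvd_of_sq_dvd {n m s : ℕ} {D ε : ℤ} (hn : 2 ≤ n) (hm : 1 ≤ m)
    (hDs : D = 2 * s + 3) (hε : ε = 1 ∨ ε = -1)
    (h : ((2 : ℤ) ^ n) ^ 2 ∣ D ^ (m * s) * (2 ^ n - D ^ (m - 1)) - ε) :
    (2 : ℤ) ^ n ∣ 2 * (s + 1) * (s + 2) * (m * (s + 1) - 1) ∧
      ¬ 2 * (2 : ℤ) ^ n ∣ 2 * (s + 1) * (s + 2) * (m * (s + 1) - 1) := by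
  have hD : Odd D := ⟨s + 1, by rw [hDs]; ring⟩
  obtain ⟨i, rfl⟩ := Nat.exists_eq_add_of_le hn
  have hk1 : 1 ≤ m * (s + 1) := Nat.mul_pos hm s.succ_pos
  have hkc : ((m * (s + 1) - 1 : ℕ) : ℤ) = m * (s + 1) - 1 := by
    rw [Nat.cast_sub hk1]; push_cast; ring
  have hk : m * (s + 1) - 1 = m * s + (m - 1) := by rw [mul_add, mul_one]; omega
  have hodd : Odd (D ^ (m * s) * D ^ (m * s + (m - 1))) := hD.pow.mul hD.pow
  have hpow : D ^ (2 * (m * (s + 1) - 1)) = (D ^ (m * s)) ^ 2 * (D ^ (m - 1)) ^ 2 := by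
    rw [hk]; ring
  have hε2 : ε ^ 2 = 1 := by rcases hε with rfl | rfl <;> norm_num
  obtain ⟨w, hw⟩ := hodd
  obtain ⟨b, hb⟩ := h
  have hmain : ∃ z : ℤ, D ^ (2 * (m * (s + 1) - 1)) - 1 = 2 * 2 ^ (2 + i) * (2 * z + 1) := by
    refine ⟨w + 2 ^ i * (b * (D ^ (m * s) * (2 ^ (2 + i) - D ^ (m - 1)) + ε)
      - (D ^ (m * s)) ^ 2), ?_⟩
    rw [hpow]
    rw [pow_add D] at hw
    generalize D ^ (m * s) = P at *
    generalize D ^ (m - 1) = R at *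
    rw [pow_add] at *
    generalize (2 : ℤ) ^ i = q at *
    linear_combination (P * (2 ^ 2 * q - R) + ε) * hb + hε2 + 8 * q * hw
  obtain ⟨z, hz⟩ := hmain
  have h1 : (2 : ℤ) ^ (2 + i + 1) ∣ D ^ (2 * (m * (s + 1) - 1)) - 1 :=
    ⟨2 * z + 1, by rw [hz]; ring⟩
  have h2 : ¬ (2 : ℤ) ^ (2 + i + 2) ∣ D ^ (2 * (m * (s + 1) - 1)) - 1 := by
    rintro ⟨c, hc⟩
    rw [hz] at hc
    have : 2 * z + 1 = 2 * c := by
      apply mul_left_cancel₀ (show (2 * 2 ^ (2 + i) : ℤ) ≠ 0 by positivity)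
      linear_combination hc
    omega
  rw [two_pow_dvd_pow_sub_one_iff hD, hkc, hDs] at h1 h2
  constructor
  · obtain ⟨c, hc⟩ := h1
    refine ⟨c, ?_⟩
    apply mul_left_cancel₀ (two_ne_zero (α := ℤ))
    linear_combination hc
  · rintro ⟨c, hc⟩
    exact h2 ⟨c, by linear_combination 2 * hc⟩

theorem lehmerE_sq_eq_sq_of_one {n s : ℕ} (hn : 2 ≤ n) (hs : 1 ≤ s)
    (hA : 3 ≤ 4 * (2 : ℤ) ^ n - (2 * s + 3))
    (he : lehmerE (4 * 2 ^ n - (2 * s + 3)) (2 ^ n) (s + 1) ^ 2 = (2 * s + 3) ^ 2) :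
    n = 2 ∧ s = 1 := by
  have hQ : (4 : ℤ) ≤ 2 ^ n := by
    calc (4 : ℤ) = 2 ^ 2 := by norm_num
      _ ≤ 2 ^ n := pow_le_pow_right₀ (by norm_num) hn
  have hD : Odd (2 * s + 3 : ℤ) := ⟨s + 1, by ring⟩
  have hcop : IsCoprime (((2 : ℤ) ^ n) ^ 2) (2 * s + 3) := by
    rw [← pow_mul]
    exact (Int.isCoprime_two_left.mpr hD).pow_left
  obtain ⟨ε, hε, h⟩ := exists_unit_sq_dvd_of_lehmerE (Q := 2 ^ n) (m := 1) (s := s) le_rfl rfl hcop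
    (by rw [pow_one]; exact he)
  obtain ⟨hd, hd'⟩ := exact_dvd_of_sq_dvd hn le_rfl rfl hε h
  simp only [one_mul, Nat.sub_self, pow_zero] at h
  rw [Nat.cast_one, one_mul, add_sub_cancel_right] at hd hd'
  rcases lt_or_ge n 8 with hn8 | hn8
  · have hsn : 2 * s + 6 ≤ 4 * 2 ^ n := by
      have : (2 * s + 6 : ℤ) ≤ 4 * 2 ^ n := by linarith
      exact_mod_cast this
    rcases sq_dvd_small hn hn8 hs hsn hε h with h1 | ⟨rfl, rfl⟩ | ⟨rfl, rfl⟩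
    · exact h1
    · norm_num [lehmerE] at he
    · norm_num [lehmerE] at he
  exfalso
  have hbd : ∀ c K : ℤ, c * 2 ^ n < K * 2 ^ n → c < K := fun c K h =>
    lt_of_mul_lt_mul_right h (by positivity)
  have hpos : ∀ c : ℤ, 0 < c * 2 ^ n → 0 < c := fun c h => pos_of_mul_pos_left h (by positivity)
  rcases Nat.even_or_odd s with hse | hso
  · rcases (show s % 4 = 2 ∨ s % 4 = 0 by obtain ⟨k, hk⟩ := hse; omega) with h2 | h0
    · obtain ⟨k, hk⟩ : ∃ k, s = 4 * k + 2 := ⟨s / 4, by omega⟩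
      have ho : Odd ((s + 1 : ℤ) * (2 * k + 1)) := by
        rw [hk]; push_cast
        exact (Odd.mul ⟨2 * k + 1, by ring⟩ ⟨k, by ring⟩)
      have hr : 2 * (s + 1) * (s + 2) * s = 4 * (s + 2 : ℤ) * ((s + 1 : ℤ) * (2 * k + 1)) := by
        rw [hk]; push_cast; ring
      rw [hr] at hd hd'
      obtain ⟨c, _, hc⟩ := exists_odd_mul_of_dvd_mul ho hd hd'
      exact not_sq_dvd_of_two_mod_four (by omega) hε h2 hc (hpos c (by rw [← hc]; positivity))
        (hbd c 8 (by rw [← hc]; linarith)) h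
    · obtain ⟨k, hk⟩ : ∃ k, s = 4 * k := ⟨s / 4, by omega⟩
      have ho : Odd ((s + 1 : ℤ) * (2 * k + 1)) := by
        rw [hk]; push_cast
        exact (Odd.mul ⟨2 * k, by ring⟩ ⟨k, by ring⟩)
      have hr : 2 * (s + 1) * (s + 2) * s = 4 * (s : ℤ) * ((s + 1 : ℤ) * (2 * k + 1)) := by
        rw [hk]; push_cast; ring
      rw [hr] at hd hd'
      obtain ⟨c, _, hc⟩ := exists_odd_mul_of_dvd_mul ho hd hd'
      exact not_sq_dvd_of_zero_mod_four (by omega) hε hc (hpos c (by rw [← hc]; positivity))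
        (hbd c 8 (by rw [← hc]; linarith)) h
  · have ho : Odd ((s + 2 : ℤ) * s) := by
      obtain ⟨k, rfl⟩ := hso
      push_cast
      exact (Odd.mul ⟨k + 1, by ring⟩ ⟨k, by ring⟩)
    have hr : 2 * (s + 1) * (s + 2) * s = 2 * (s + 1 : ℤ) * ((s + 2 : ℤ) * s) := by ring
    rw [hr] at hd hd'
    obtain ⟨c, _, hc⟩ := exists_odd_mul_of_dvd_mul ho hd hd'
    exact not_sq_dvd_of_odd (by omega) hε hc (hpos c (by rw [← hc]; positivity))
      (hbd c 4 (by rw [← hc]; linarith)) h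

theorem lehmerE_sq_eq_sq {n m s : ℕ} {D : ℤ} (hn : 1 ≤ n) (hm : Odd m) (hs : 1 ≤ s)
    (hDs : D = 2 * s + 1) (hA : 3 ≤ 4 * (2 : ℤ) ^ n - D ^ m)
    (he : lehmerE (4 * 2 ^ n - D ^ m) (2 ^ n) s ^ 2 = D ^ 2) :
    m = 1 ∧ (n = 1 ∧ D = 3 ∨ n = 1 ∧ D = 5 ∨ n = 2 ∧ D = 5) ∨ n = 3 ∧ m = 3 ∧ D = 3 := by
  obtain ⟨s, rfl⟩ : ∃ t, s = t + 1 := ⟨s - 1, by omega⟩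
  obtain ⟨t, rfl⟩ := hm
  have hDs : D = 2 * s + 3 := by rw [hDs]; push_cast; ring
  have hD3 : 3 ≤ D := by omega
  have hDt : (1 : ℤ) ≤ (D ^ t) ^ 2 := one_le_pow₀ (one_le_pow₀ (by omega))
  have hDm : D ^ (2 * t + 1) = D * (D ^ t) ^ 2 := by ring
  rcases hn.eq_or_lt with rfl | hn2
  · left
    have ht : t = 0 := by
      by_contra h
      obtain ⟨t, rfl⟩ := Nat.exists_eq_succ_of_ne_zero h
      have h1 : (1 : ℤ) ≤ D ^ t := one_le_pow₀ (by omega)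
      have h2 : D ≤ D ^ (t + 1) := by rw [pow_succ]; nlinarith
      rw [hDm, Nat.succ_eq_add_one] at hA
      nlinarith [mul_le_mul h2 h2 (by omega) (by omega), mul_le_mul hD3 hD3 (by omega) (by omega)]
    subst ht
    norm_num at hA ⊢
    omega
  have hn2 : 2 ≤ n := hn2
  have hD : Odd D := ⟨s + 1, by rw [hDs]; ring⟩
  have hcop : IsCoprime (((2 : ℤ) ^ n) ^ 2) D := by
    rw [← pow_mul]
    exact (Int.isCoprime_two_left.mpr hD).pow_left
  obtain ⟨ε, hε, h⟩ := exists_unit_sq_dvd_of_lehmerE (by omega) hDs hcop he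
  obtain ⟨hd, hd'⟩ := exact_dvd_of_sq_dvd hn2 (by omega) hDs hε h
  rcases Nat.eq_zero_or_pos t with rfl | ht
  · have hs : 1 ≤ s := by
      by_contra hs
      obtain rfl : s = 0 := by omega
      simp at hd'
    rw [mul_zero, zero_add, pow_one, hDs] at hA he
    obtain ⟨rfl, rfl⟩ := lehmerE_sq_eq_sq_of_one hn2 hs hA he
    left
    norm_num at hDs ⊢
    exact hDs
  right
  have hcopQ : ∀ k : ℤ, Odd k → IsCoprime ((2 : ℤ) ^ n) k := fun k hk =>
    (Int.isCoprime_two_left.mpr hk).pow_left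
  have hgrow : ∀ a : ℤ, 2 ≤ a → ∀ t : ℕ, 1 ≤ t → (a : ℤ) * t ≤ a ^ t := by
    intro a ha t ht
    induction t, ht using Nat.le_induction with
    | base => simp
    | succ t ht ih =>
      rw [pow_succ]; push_cast
      have : (1 : ℤ) ≤ t := by exact_mod_cast ht
      nlinarith [mul_le_mul_of_nonneg_left this (show (0 : ℤ) ≤ a by omega),
        mul_le_mul_of_nonneg_left ih (show (0 : ℤ) ≤ a by omega)]
  have hgr := hgrow (D ^ 2) (by nlinarith) t ht
  have hDm' : D ^ (2 * t + 1) = D * (D ^ 2) ^ t := by rw [← pow_mul]; ring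
  rw [hDm'] at hA
  have ht' : (1 : ℤ) ≤ t := by exact_mod_cast ht
  rcases Nat.even_or_odd s with ⟨k, hk⟩ | ⟨k, hk⟩
  · have ho : Odd (s + 1 : ℤ) := ⟨k, by rw [hk]; push_cast; ring⟩
    rw [show 2 * (s + 1) * (s + 2) * ((2 * t + 1 : ℕ) * (s + 1) - 1)
      = 2 * (s + 2 : ℤ) * ((2 * t + 1) * (s + 1) - 1) * (s + 1) by push_cast; ring] at hd
    have hd := (hcopQ _ ho).dvd_of_dvd_mul_right hd
    have h1 := Int.le_of_dvd (mul_pos (by positivity) (by nlinarith)) hd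
    rcases Nat.eq_zero_or_pos k with rfl | hk0
    · obtain rfl : s = 0 := hk
      simp only [Nat.cast_zero, mul_zero, zero_add] at hDs h1 hd
      subst hDs
      rcases ht.nat_succ_le.eq_or_lt with rfl | ht2
      · norm_num at hA hd
        obtain rfl : n = 3 := by
          have hle : n ≤ 3 := by
            have h8 : (2 : ℤ) ^ n ≤ 2 ^ 3 := Int.le_of_dvd (by norm_num) hd
            exact (pow_le_pow_iff_right₀ (by norm_num)).mp h8
          interval_cases n <;> omega
        norm_num
      · exfalso
        obtain ⟨u, rfl⟩ := Nat.exists_eq_add_of_le ht2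
        have hu := hgrow 9 (by norm_num) (u + 1) (by omega)
        rw [show 0 + 1 + 1 + u = u + 1 + 1 by ring, pow_succ] at hA
        norm_num at hA
        push_cast at hu h1
        linarith
    · exfalso
      have hs2 : (2 : ℤ) ≤ s := by omega
      have h3 : D * (D ^ 2 * t) ≤ D * (D ^ 2) ^ t := by gcongr
      have h4 : 7 * (D ^ 2 * t) ≤ D * (D ^ 2 * t) := by gcongr; omega
      rw [hDs] at h3 h4 hA
      nlinarith [mul_le_mul_of_nonneg_left ht' (sq_nonneg (2 * s + 3 : ℤ))]
  · exfalso
    have ho : Odd ((s + 2 : ℤ) * ((2 * t + 1 : ℕ) * (s + 1) - 1)) := by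
      rw [hk]; push_cast
      exact Odd.mul ⟨k + 1, by ring⟩ ⟨2 * t * (k + 1) + k, by ring⟩
    rw [show 2 * (s + 1) * (s + 2) * ((2 * t + 1 : ℕ) * (s + 1) - 1)
      = 2 * (s + 1 : ℤ) * ((s + 2 : ℤ) * ((2 * t + 1 : ℕ) * (s + 1) - 1)) by ring] at hd
    have h1 := Int.le_of_dvd (by positivity) ((hcopQ _ ho).dvd_of_dvd_mul_right hd)
    have h2 : D ^ 2 ≤ (D ^ 2) ^ t := le_trans (by nlinarith) hgr
    have h3 : D * 9 ≤ D * (D ^ 2) ^ t := by gcongr; nlinarith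
    linarith

theorem lehmerE_modEq_disc (A Q : ℤ) (s : ℕ) :
    4 * Q - A ∣ lehmerE A Q s - (2 * s + 1) * Q ^ s := by
  induction s using Nat.twoStepInduction with
  | zero => simp [lehmerE]
  | one => exact ⟨-1, by simp only [lehmerE]; push_cast; ring⟩
  | more s ih1 ih2 =>
    obtain ⟨a, ha⟩ := ih1
    obtain ⟨b, hb⟩ := ih2
    refine ⟨(A - 2 * Q) * b - Q ^ 2 * a - (2 * s + 3) * Q ^ (s + 1), ?_⟩
    simp only [lehmerE]
    push_cast at hb ⊢
    linear_combination (A - 2 * Q) * hb - Q ^ 2 * ha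

theorem lehmerE_modEq_disc_sq (A Q : ℤ) (s : ℕ) :
    (4 * Q - A) ^ 2 ∣ 6 * Q * lehmerE A Q s - (6 * (2 * s + 1) * Q ^ (s + 1)
      - s * (s + 1) * (2 * s + 1) * (4 * Q - A) * Q ^ s) := by
  induction s using Nat.twoStepInduction with
  | zero => simp [lehmerE]
  | one => exact ⟨0, by simp only [lehmerE]; push_cast; ring⟩
  | more s ih1 ih2 =>
    obtain ⟨a, ha⟩ := ih1
    obtain ⟨b, hb⟩ := ih2
    refine ⟨(A - 2 * Q) * b - Q ^ 2 * a + (s + 1) * (s + 2) * (2 * s + 3) * Q ^ (s + 1), ?_⟩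
    simp only [lehmerE]
    push_cast at hb ⊢
    linear_combination (A - 2 * Q) * hb - Q ^ 2 * ha

theorem emultiplicity_lehmerE_of_prime {A Q : ℤ} {q a : ℕ} (hq : q.Prime)
    (hqB : (q : ℤ) ∣ 4 * Q - A)
    (hqQ : ¬ (q : ℤ) ∣ Q) (hq2 : q ≠ 2) (hq3 : q = 3 → 9 ∣ 4 * Q - A) (ha : (2 * a + 1).Prime) :
    emultiplicity (q : ℤ) (lehmerE A Q a) = emultiplicity (q : ℤ) (2 * a + 1) := by
  have hqp : Prime (q : ℤ) := Nat.prime_iff_prime_int.mp hq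
  have hqQ' : ∀ k, ¬ (q : ℤ) ∣ Q ^ k := fun k h => hqQ (hqp.dvd_of_dvd_pow h)
  have h1 := hqB.trans (lehmerE_modEq_disc A Q a)
  by_cases hqa : q = 2 * a + 1
  · have hqa' : (2 * a + 1 : ℤ) = q := by rw [hqa]; push_cast; ring
    have hnd : ¬ (q : ℤ) ^ 2 ∣ q * Q ^ a := by
      rintro ⟨c, hc⟩
      refine hqQ' a ⟨c, mul_left_cancel₀ hqp.ne_zero ?_⟩
      rw [hc]; ring
    have hsq : (q : ℤ) ^ 2 ∣ lehmerE A Q a - q * Q ^ a := by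
      by_cases h3 : q = 3
      · obtain rfl : a = 1 := by omega
        obtain ⟨c, hc⟩ := hq3 h3
        rw [h3]
        exact ⟨-c, by simp only [lehmerE]; push_cast; linear_combination -hc⟩
      · obtain ⟨b, hb⟩ := hqB
        have h2 := lehmerE_modEq_disc_sq A Q a
        rw [hb, hqa'] at h2
        obtain ⟨c, hc⟩ := h2
        have h4 : (q : ℤ) ^ 2 ∣ 6 * Q * (lehmerE A Q a - q * Q ^ a) :=
          ⟨b ^ 2 * c - a * (a + 1) * b * Q ^ a, by linear_combination hc⟩
        have hcop : IsCoprime ((q : ℤ) ^ 2) (6 * Q) := by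
          apply IsCoprime.pow_left
          rw [Prime.coprime_iff_not_dvd hqp]
          intro h6
          rcases hqp.dvd_or_dvd h6 with h | h
          · have h6 : q ∣ 2 * 3 := by exact_mod_cast h
            rcases hq.dvd_mul.mp h6 with h | h
            · exact hq2 ((Nat.prime_dvd_prime_iff_eq hq Nat.prime_two).mp h)
            · exact h3 ((Nat.prime_dvd_prime_iff_eq hq Nat.prime_three).mp h)
          · exact hqQ h
        exact hcop.dvd_of_dvd_mul_left h4
    have e1 : emultiplicity (q : ℤ) (lehmerE A Q a) = (1 : ℕ) := by
      apply emultiplicity_eq_of_dvd_of_not_dvd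
      · rw [pow_one]
        have := dvd_add ((dvd_pow_self _ two_ne_zero).trans hsq) (dvd_mul_right (q : ℤ) (Q ^ a))
        simpa using this
      · intro h
        exact hnd ((dvd_sub_right h).mp hsq)
    have e2 : emultiplicity (q : ℤ) (2 * a + 1) = (1 : ℕ) := by
      rw [hqa']
      exact (FiniteMultiplicity.of_prime_left hqp hqp.ne_zero).emultiplicity_self
    rw [e1, e2]
  · have hna : ¬ (q : ℤ) ∣ 2 * a + 1 := by
      intro h
      exact hqa ((Nat.prime_dvd_prime_iff_eq hq ha).mp (by exact_mod_cast h))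
    have hne : ¬ (q : ℤ) ∣ lehmerE A Q a := by
      intro h
      rcases hqp.dvd_or_dvd ((dvd_sub_right h).mp h1) with h | h
      · exact hna h
      · exact hqQ' a h
    rw [emultiplicity_eq_zero.mpr hna, emultiplicity_eq_zero.mpr hne]

theorem ne_four_mul_of_odd {A Q : ℤ} (hA : Odd A) : A ≠ 4 * Q := by
  obtain ⟨k, rfl⟩ := hA
  omega

theorem four_mul_pow_sub_eq (A Q : ℤ) (a : ℕ) :
    4 * Q ^ (2 * a + 1) - A * lehmerF A Q a ^ 2 = (4 * Q - A) * lehmerE A Q a ^ 2 := by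
  linear_combination -lehmer_norm A Q a

theorem emultiplicity_lehmerE {q : ℕ} (hq : q.Prime) (hq2 : q ≠ 2) (r : ℕ) :
    ∀ {A Q : ℤ}, Odd A → Even Q → (q : ℤ) ∣ 4 * Q - A → ¬ (q : ℤ) ∣ Q →
      (q = 3 → 9 ∣ 4 * Q - A) → ∀ s, r = 2 * s + 1 →
      emultiplicity (q : ℤ) (lehmerE A Q s) = emultiplicity (q : ℤ) (2 * s + 1) := by
  induction r using induction_on_primes with
  | zero => intro A Q _ _ _ _ _ s hs; omega
  | one =>
    intro A Q _ _ _ _ _ s hs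
    obtain rfl : s = 0 := by omega
    simp [lehmerE]
  | prime_mul p r hp ih =>
    intro A Q hA hQ hqB hqQ hq3 s hs
    have hodd : Odd (p * r) := ⟨s, hs⟩
    obtain ⟨⟨a, rfl⟩, ⟨u, rfl⟩⟩ := Nat.odd_mul.mp hodd
    obtain rfl : s = (2 * a + 1) * u + a := by
      have : 2 * s + 1 = 2 * ((2 * a + 1) * u + a) + 1 := by rw [← hs]; ring
      omega
    have hqp : Prime (q : ℤ) := Nat.prime_iff_prime_int.mp hq
    rw [lehmerE_comp (ne_four_mul_of_odd hA), emultiplicity_mul hqp,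
      emultiplicity_lehmerE_of_prime hq hqB hqQ hq2 hq3 hp,
      ih (hA.mul (odd_lehmerF hA hQ a).pow) (hQ.pow_of_ne_zero (by omega))
        (by rw [four_mul_pow_sub_eq]; exact hqB.mul_right _)
        (fun h => hqQ (hqp.dvd_of_dvd_pow h))
        (fun h => by rw [four_mul_pow_sub_eq]; exact (hq3 h).mul_right _) u rfl,
      ← emultiplicity_mul hqp]
    congr 1
    push_cast; ring

theorem dvd_lehmerE_iff {A : ℤ} {n s C : ℕ} (hA : Odd A) (hn : 1 ≤ n) (hC : Odd C)
    (h9 : 3 ∣ C → (9 : ℤ) ∣ 4 * 2 ^ n - A)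
    (h : ∀ q : ℕ, q.Prime → q ∣ C → (q : ℤ) ∣ 4 * 2 ^ n - A) :
    (C : ℤ) ∣ lehmerE A (2 ^ n) s ↔ C ∣ 2 * s + 1 := by
  have hQ : Even ((2 : ℤ) ^ n) := (even_two).pow_of_ne_zero (by omega)
  have key : ∀ q k : ℕ, q.Prime → q ∣ C →
      (q ^ k ∣ (lehmerE A (2 ^ n) s).natAbs ↔ q ^ k ∣ 2 * s + 1) := by
    intro q k hq hqC
    have hq2 : q ≠ 2 := by
      rintro rfl
      exact Nat.not_even_iff_odd.mpr hC (even_iff_two_dvd.mpr hqC)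
    have hqQ : ¬ (q : ℤ) ∣ 2 ^ n := by
      intro h
      have := (Nat.prime_iff_prime_int.mp hq).dvd_of_dvd_pow h
      exact hq2 ((Nat.prime_dvd_prime_iff_eq hq Nat.prime_two).mp (by exact_mod_cast this))
    have he := emultiplicity_lehmerE hq hq2 _ hA hQ (h q hq hqC) hqQ
      (by rintro rfl; exact h9 hqC) s rfl
    rw [← Int.natCast_dvd, ← Int.natCast_dvd_natCast]
    push_cast
    rw [pow_dvd_iff_le_emultiplicity, pow_dvd_iff_le_emultiplicity, he]
  rw [Int.natCast_dvd, Nat.dvd_iff_prime_pow_dvd_dvd, Nat.dvd_iff_prime_pow_dvd_dvd]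
  constructor <;> intro hd q k hq hk <;> rcases Nat.eq_zero_or_pos k with rfl | hk0
  · simp
  · exact (key q k hq ((dvd_pow_self _ hk0.ne').trans hk)).mp (hd q k hq hk)
  · simp
  · exact (key q k hq ((dvd_pow_self _ hk0.ne').trans hk)).mpr (hd q k hq hk)

/-- If every prime dividing `lehmerE A (2 ^ n) w` and every prime dividing `C = 2 w + 1` divides
the discriminant, then `lehmerE A (2 ^ n) w = ± C`. -/
theorem lehmerE_natAbs_eq {A : ℤ} {n w C : ℕ} (hA : Odd A) (hn : 1 ≤ n) (hC : C = 2 * w + 1)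
    (h9 : 3 ∣ C → (9 : ℤ) ∣ 4 * 2 ^ n - A) (h9' : 3 ∣ lehmerE A (2 ^ n) w → (9 : ℤ) ∣ 4 * 2 ^ n - A)
    (h : ∀ q : ℕ, q.Prime → q ∣ C → (q : ℤ) ∣ 4 * 2 ^ n - A)
    (h' : ∀ q : ℕ, q.Prime → (q : ℤ) ∣ lehmerE A (2 ^ n) w → (q : ℤ) ∣ 4 * 2 ^ n - A) :
    (lehmerE A (2 ^ n) w).natAbs = C := by
  have hQ : Even ((2 : ℤ) ^ n) := (even_two).pow_of_ne_zero (by omega)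
  apply Nat.dvd_antisymm
  · rw [hC]
    refine (dvd_lehmerE_iff hA hn (Int.natAbs_odd.mpr (odd_lehmerE hA hQ w)) ?_ ?_).mp
      Int.natAbs_dvd_self
    · exact fun h3 => h9' (Int.natCast_dvd.mpr h3)
    · exact fun q hq hqd => h' q hq (Int.natCast_dvd.mpr hqd)
  · refine Int.natCast_dvd.mp ((dvd_lehmerE_iff hA hn ⟨w, hC⟩ h9 h).mpr (by rw [hC]))

theorem lehmerE_modEq_pow (A Q : ℤ) (s : ℕ) : Q ∣ lehmerE A Q s - A ^ s := by
  induction s using Nat.twoStepInduction with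
  | zero => simp [lehmerE]
  | one => exact ⟨-1, by simp only [lehmerE]; ring⟩
  | more s ih1 ih2 =>
    obtain ⟨b, hb⟩ := ih2
    refine ⟨A * b - 2 * lehmerE A Q (s + 1) - Q * lehmerE A Q s, ?_⟩
    simp only [lehmerE]
    linear_combination A * hb

theorem pow_dvd_two_mul_of_pow_modEq {A : ℤ} {n w : ℕ} (hA : Odd A) (hw : Even w)
    (h : (2 : ℤ) ^ n ∣ A ^ w - (2 * w + 1)) : (2 : ℤ) ^ n ∣ 2 * w := by
  obtain ⟨k, rfl⟩ := hw
  rw [← two_mul] at h ⊢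
  obtain ⟨t, rfl⟩ := hA
  have h8 : ∃ c, (2 * t + 1) ^ 2 - 1 = 8 * c := by
    obtain ⟨c, hc⟩ := Int.even_mul_succ_self t
    exact ⟨c, by linear_combination 4 * hc⟩
  obtain ⟨c, hc⟩ := h8
  have key : ∀ N ≤ n, (2 : ℤ) ^ N ∣ 2 * (2 * k : ℕ) := by
    intro N
    induction N with
    | zero => simp
    | succ N ih =>
      intro hN
      obtain ⟨d, hd⟩ := ih (by omega)
      push_cast at hd
      have h1 : (2 : ℤ) ^ (N + 1) ∣ (2 * t + 1) ^ (2 * k) - 1 := by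
        rw [two_pow_dvd_pow_sub_one_iff ⟨t, rfl⟩, hc]
        exact ⟨c * d, by rw [pow_succ]; linear_combination 2 * c * hd⟩
      have h2 := (pow_dvd_pow (2 : ℤ) hN).trans h
      have := dvd_sub h1 h2
      rwa [show (2 * t + 1) ^ (2 * k) - 1 - ((2 * t + 1) ^ (2 * k) - (2 * (2 * k : ℕ) + 1))
        = (2 * (2 * k : ℕ) : ℤ) by ring] at this
  exact key n le_rfl

theorem three_pow_mod_eight (b : ℕ) : (3 : ℤ) ^ b % 8 = 1 ∨ (3 : ℤ) ^ b % 8 = 3 := by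
  induction b with
  | zero => simp
  | succ b ih => rw [pow_succ]; omega

/-- The exceptional case where `lehmerE A (2 ^ n) 1` is divisible by `9`. -/
theorem eq_of_lehmerE_eq_sub_three_pow {n b w : ℕ} {A η : ℤ} (hη : η = 1 ∨ η = -1) (hb : 1 ≤ b)
    (hA : A = 2 ^ n + 3 * (η * 3 ^ b)) (hw : 2 ^ n - η * 3 ^ b = 2 * w + 1) (hA3 : 3 ≤ A)
    (hw3 : ¬ (3 : ℤ) ∣ 2 * w + 1) (he : lehmerE A (2 ^ n) w ^ 2 = (2 * w + 1) ^ 2) :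
    n = 2 ∧ w = 0 := by
  have hb3 : (3 : ℤ) ^ b % 3 = 0 := by
    obtain ⟨b, rfl⟩ := Nat.exists_eq_add_of_le hb
    rw [pow_add]; omega
  have hb1 : (3 : ℤ) ≤ 3 ^ b := by have : (0 : ℤ) < 3 ^ b := by positivity
                                   omega
  have h3b := three_pow_mod_eight b
  rcases lt_or_ge n 3 with hn3 | hn3
  · interval_cases n <;> rcases hη with rfl | rfl <;> norm_num at hA hw ⊢ <;> omega
  exfalso
  have h8 : (8 : ℤ) ∣ 2 ^ n := by simpa using pow_dvd_pow (2 : ℤ) hn3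
  have hmod := h8.trans (lehmerE_modEq_pow A (2 ^ n) w)
  have hpw : w % 2 = 0 ∧ A ^ w % 8 = 1 ∨ w % 2 = 1 ∧ A ^ w % 8 = A % 8 := by
    have hsq : A ^ 2 ≡ 1 [ZMOD 8] := by
      have : A % 8 = 1 ∨ A % 8 = 3 ∨ A % 8 = 5 ∨ A % 8 = 7 := by
        rcases hη with rfl | rfl <;> omega
      rcases this with h | h | h | h <;> simp [Int.ModEq, sq, Int.mul_emod, h]
    rcases Nat.even_or_odd' w with ⟨k, rfl | rfl⟩
    · left
      have := hsq.pow k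
      rw [← pow_mul, one_pow] at this
      exact ⟨by omega, this⟩
    · right
      have := (hsq.pow k).mul_right A
      rw [← pow_mul, ← pow_succ, one_pow, one_mul] at this
      exact ⟨by omega, this⟩
  have hgoal : w % 2 = 0 ∧ η = -1 ∧ lehmerE A (2 ^ n) w = 2 * w + 1 := by
    rcases sq_eq_sq_iff_eq_or_eq_neg.mp he with h | h <;> rcases hη with rfl | rfl <;> omega
  obtain ⟨hw2, rfl, h⟩ := hgoal
  have h1 := lehmerE_modEq_pow A (2 ^ n) w
  rw [h] at h1
  have hAodd : Odd A := by rw [Int.odd_iff]; omega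
  have h2 := pow_dvd_two_mul_of_pow_modEq hAodd (Nat.even_iff.mpr hw2) ((dvd_sub_comm).mp h1)
  have h3 : (2 : ℤ) ^ n ∣ 3 ^ b - 1 := by
    rw [show (3 : ℤ) ^ b - 1 = 2 * w - 2 ^ n by linear_combination hw]
    exact dvd_sub_self_right.mpr h2
  have := Int.le_of_dvd (by omega) h3
  omega

theorem lehmerE_sq_eq_sq_of_dvd {n m s : ℕ} {D : ℕ} (hn : 1 ≤ n) (hm : Odd m) (hD : Odd D)
    (hD3 : 3 ≤ D) (hA3 : 3 ≤ 4 * (2 : ℤ) ^ n - D ^ m)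
    (hr : D ∣ 2 * s + 1)
    (h : ∀ w, D = 2 * w + 1 → lehmerE (4 * 2 ^ n - D ^ m) (2 ^ n) w ∣
      lehmerE (4 * 2 ^ n - D ^ m) (2 ^ n) s → (lehmerE (4 * 2 ^ n - D ^ m) (2 ^ n) w).natAbs = D) :
    m = 1 ∧ (n = 1 ∧ D = 3 ∨ n = 1 ∧ D = 5 ∨ n = 2 ∧ D = 5) ∨ n = 3 ∧ m = 3 ∧ D = 3 := by
  obtain ⟨w, hw⟩ := hD
  obtain ⟨c, hc⟩ := hr
  have hco : Odd c := (Nat.odd_mul.mp (hc ▸ ⟨s, rfl⟩ : Odd (D * c))).2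
  obtain ⟨u, rfl⟩ := hco
  have hs : s = (2 * w + 1) * u + w := by
    rw [hw] at hc
    have : 2 * s + 1 = 2 * ((2 * w + 1) * u + w) + 1 := by rw [hc]; ring
    omega
  have hA : Odd (4 * (2 : ℤ) ^ n - D ^ m) :=
    (((by decide : Even (4 : ℤ)).mul_right _).sub_odd
      ((show Odd (D : ℤ) from ⟨w, by rw [hw]; push_cast; ring⟩).pow))
  have he := h w hw (by rw [hs]; exact lehmerE_dvd_lehmerE_mul (ne_four_mul_of_odd hA) w u)
  have := lehmerE_sq_eq_sq (D := D) (s := w) hn hm (by omega) (by exact_mod_cast hw) hA3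
    (by rw [← Int.natAbs_sq, he])
  exact_mod_cast this

theorem eq_unit_mul_three_pow {x : ℤ} (hx : x ≠ 0)
    (h : ∀ q : ℕ, q.Prime → (q : ℤ) ∣ x → q = 3) :
    ∃ (b : ℕ) (η : ℤ), (η = 1 ∨ η = -1) ∧ x = η * 3 ^ b := by
  have h1 := Nat.eq_prime_pow_of_unique_prime_dvd (n := x.natAbs) (p := 3)
    (by simpa using hx) (fun {d} hd hdx => h d hd (Int.natCast_dvd.mpr hdx))
  have h1' : (x.natAbs : ℤ) = 3 ^ x.natAbs.primeFactorsList.length := by exact_mod_cast h1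
  refine ⟨x.natAbs.primeFactorsList.length, ?_⟩
  rcases Int.natAbs_eq x with h2 | h2
  · exact ⟨1, Or.inl rfl, by rw [one_mul, ← h1']; exact h2⟩
  · exact ⟨-1, Or.inr rfl, by rw [neg_one_mul, ← h1']; exact h2⟩

theorem eq_of_natAbs_lehmerE_one_eq_three {n s u C D : ℕ} (hn : 1 ≤ n) (hD : Odd D) (hD3 : 3 ≤ D)
    (hA3 : 3 ≤ 4 * (2 : ℤ) ^ n - D) (hC : D = 3 * C)
    (habs : (lehmerE (4 * 2 ^ n - D) (2 ^ n) 1).natAbs = 3) (hu : s = (2 * 1 + 1) * u + 1)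
    (hprime : ∀ q : ℕ, q.Prime → (q : ℤ) ∣ lehmerE (4 * 2 ^ n - D) (2 ^ n) s → q ∣ D)
    (hDe : (D : ℤ) ∣ lehmerE (4 * 2 ^ n - D) (2 ^ n) s) :
    n = 1 ∧ D = 3 ∨ n = 1 ∧ D = 5 ∨ n = 2 ∧ D = 5 := by
  have hDZ : Odd (D : ℤ) := by exact_mod_cast hD
  have hA : Odd (4 * (2 : ℤ) ^ n - D) := ((by decide : Even (4 : ℤ)).mul_right _).sub_odd hDZ
  have hQ : Even ((2 : ℤ) ^ n) := (even_two).pow_of_ne_zero (by omega)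
  have hAQ := ne_four_mul_of_odd (Q := 2 ^ n) hA
  have hB : 4 * 2 ^ n - (4 * (2 : ℤ) ^ n - D) = D := by ring
  have hB' := four_mul_pow_sub_eq (4 * 2 ^ n - D) (2 ^ n) 1
  have hcomp := fun u => lehmerE_comp hAQ 1 u
  have hA' := hA.mul (Odd.pow (n := 2) (odd_lehmerF hA hQ 1))
  rw [← Int.natAbs_sq (lehmerE _ _ 1), habs, hB, ← pow_mul] at hB'
  rw [← pow_mul] at hcomp
  generalize (4 * 2 ^ n - D : ℤ) * lehmerF (4 * 2 ^ n - D) (2 ^ n) 1 ^ 2 = A' at *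
  have h9' : (9 : ℤ) ∣ 4 * 2 ^ (n * (2 * 1 + 1)) - A' := ⟨D, by rw [hB']; push_cast; ring⟩
  have hDB' : ∀ q : ℕ, q ∣ D → (q : ℤ) ∣ 4 * 2 ^ (n * (2 * 1 + 1)) - A' := fun q h => by
    rw [hB']; exact (Int.natCast_dvd_natCast.mpr h).mul_right _
  have hE' : ∀ u, lehmerE A' (2 ^ (n * (2 * 1 + 1))) u ∣
      lehmerE (4 * 2 ^ n - D) (2 ^ n) ((2 * 1 + 1) * u + 1) := fun u => by
    rw [hcomp]; exact dvd_mul_left _ _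
  have hr : D ∣ 2 * s + 1 := by
    have h1 : (lehmerE A' (2 ^ (n * (2 * 1 + 1))) u).natAbs ∣ 2 * u + 1 := by
      refine (dvd_lehmerE_iff hA' (by omega)
        (Int.natAbs_odd.mpr (odd_lehmerE hA' (even_two.pow_of_ne_zero (by omega)) u))
        (fun _ => h9') ?_).mp Int.natAbs_dvd_self
      intro q hq h
      exact hDB' q (hprime q hq ((Int.natCast_dvd.mpr h).trans (hu ▸ hE' u)))
    have h2 := Int.natCast_dvd.mp hDe
    rw [hu, hcomp, Int.natAbs_mul, habs] at h2
    rw [show 2 * s + 1 = 3 * (2 * u + 1) by rw [hu]; ring]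
    exact h2.trans (Nat.mul_dvd_mul_left 3 h1)
  have := lehmerE_sq_eq_sq_of_dvd (m := 1) hn odd_one hD hD3 (by simpa using hA3) hr (by
    rw [pow_one]
    intro w hw hd
    obtain ⟨c, hc⟩ := (Nat.odd_mul.mp (hC ▸ hD)).2
    obtain rfl : w = (2 * 1 + 1) * c + 1 := by omega
    rw [hcomp, Int.natAbs_mul, habs, lehmerE_natAbs_eq hA' (by omega) hc (fun _ => h9')
      (fun _ => h9') (fun q _ h => hDB' q (h.trans ⟨3, by rw [hC]; ring⟩))
      (fun q hq h => hDB' q (hprime q hq ((h.trans (hE' c)).trans hd))), hC])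
  rcases this with ⟨_, h⟩ | ⟨_, h, _⟩
  · exact h
  · omega

theorem lehmerE_sq_eq_pow {n m s j D : ℕ} (hn : 1 ≤ n) (hm : Odd m) (hD : Odd D) (hD3 : 3 ≤ D)
    (hA3 : 3 ≤ 4 * (2 : ℤ) ^ n - D ^ m) (hj : 1 ≤ j)
    (he : lehmerE (4 * 2 ^ n - D ^ m) (2 ^ n) s ^ 2 = (D ^ j) ^ 2) :
    m = 1 ∧ (n = 1 ∧ D = 3 ∨ n = 1 ∧ D = 5 ∨ n = 2 ∧ D = 5) ∨ n = 3 ∧ m = 3 ∧ D = 3 ∨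
      n = 2 ∧ m = 1 ∧ D = 3 := by
  have hDZ : Odd (D : ℤ) := by exact_mod_cast hD
  have hA : Odd (4 * (2 : ℤ) ^ n - D ^ m) := ((by decide : Even (4 : ℤ)).mul_right _).sub_odd
      hDZ.pow
  have hQ : Even ((2 : ℤ) ^ n) := (even_two).pow_of_ne_zero (by omega)
  have hB : 4 * 2 ^ n - (4 * (2 : ℤ) ^ n - D ^ m) = (D : ℤ) ^ m := by ring
  have hprime : ∀ q : ℕ, q.Prime → (q : ℤ) ∣ lehmerE (4 * 2 ^ n - D ^ m) (2 ^ n) s → q ∣ D := by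
    intro q hq h
    have h1 := h.trans (dvd_pow_self _ two_ne_zero)
    rw [he, ← pow_mul] at h1
    exact_mod_cast (Nat.prime_iff_prime_int.mp hq).dvd_of_dvd_pow h1
  have hm0 : m ≠ 0 := by rintro rfl; exact absurd hm (by decide)
  have hDB : ∀ q : ℕ, q ∣ D → (q : ℤ) ∣ (D : ℤ) ^ m := fun q h =>
    (Int.natCast_dvd_natCast.mpr h).trans (dvd_pow_self _ hm0)
  have hDe : (D : ℤ) ∣ lehmerE (4 * 2 ^ n - D ^ m) (2 ^ n) s := by
    rw [← Int.pow_dvd_pow_iff two_ne_zero, he]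
    exact pow_dvd_pow_of_dvd (dvd_pow_self _ (by omega)) 2
  by_cases h9 : 3 ∣ D → (9 : ℤ) ∣ (D : ℤ) ^ m
  · have hr : D ∣ 2 * s + 1 := by
      refine (dvd_lehmerE_iff hA hn hD ?_ ?_).mp hDe
      · rw [hB]; exact h9
      · rw [hB]; exact fun q _ => hDB q
    have := lehmerE_sq_eq_sq_of_dvd hn hm hD hD3 hA3 hr (fun w hw hd => by
      refine lehmerE_natAbs_eq hA hn hw ?_ ?_ ?_ ?_
      · rw [hB]; exact h9
      · rw [hB]; exact fun h => h9 (hprime 3 Nat.prime_three (h.trans hd))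
      · rw [hB]; exact fun q _ => hDB q
      · rw [hB]; exact fun q hq h => hDB q (hprime q hq (h.trans hd)))
    tauto
  push Not at h9
  obtain ⟨⟨C, hC⟩, h9⟩ := h9
  have hm1 : m = 1 := by
    by_contra h
    apply h9
    have h2 : 2 ≤ m := by omega
    have : ((9 : ℕ) : ℤ) ∣ ((D ^ m : ℕ) : ℤ) := by
      apply Int.natCast_dvd_natCast.mpr
      refine Dvd.dvd.trans ⟨C ^ 2, ?_⟩ (pow_dvd_pow D h2)
      rw [hC]; ring
    exact_mod_cast this
  subst hm1
  rw [pow_one] at *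
  have hC3 : ¬ 3 ∣ C := by
    rintro ⟨c, rfl⟩
    exact h9 ⟨c, by rw [hC]; push_cast; ring⟩
  have hCodd : Odd C := (Nat.odd_mul.mp (hC ▸ hD)).2
  have h3s : 3 ∣ 2 * s + 1 := by
    have h3 : (3 : ℤ) ∣ lehmerE (4 * 2 ^ n - D) (2 ^ n) s :=
      (show (3 : ℤ) ∣ D from ⟨C, by rw [hC]; push_cast; ring⟩).trans hDe
    have h4 := lehmerE_modEq_disc (4 * 2 ^ n - D) (2 ^ n) s
    rw [hB] at h4
    have h5 := (dvd_sub_right h3).mp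
        ((show (3 : ℤ) ∣ D from ⟨C, by rw [hC]; push_cast; ring⟩).trans h4)
    rcases Int.prime_three.dvd_or_dvd h5 with h | h
    · exact_mod_cast h
    · have := Int.prime_three.dvd_of_dvd_pow (Int.prime_three.dvd_of_dvd_pow h)
      norm_num at this
  obtain ⟨u, hu⟩ : ∃ u, s = (2 * 1 + 1) * u + 1 := ⟨s / 3, by omega⟩
  have hAQ := ne_four_mul_of_odd (Q := 2 ^ n) hA
  have he1 : lehmerE (4 * 2 ^ n - D) (2 ^ n) 1 = 3 * (2 ^ n - C) := by
    simp only [lehmerE]; rw [hC]; push_cast; ring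
  have hb : ∃ (b : ℕ) (η : ℤ), (η = 1 ∨ η = -1) ∧ (2 ^ n - C : ℤ) = η * 3 ^ b := by
    apply eq_unit_mul_three_pow
    · intro h
      have : Odd ((2 : ℤ) ^ n - C) := hQ.sub_odd (by exact_mod_cast hCodd)
      rw [h] at this
      exact absurd this (by decide)
    · intro q hq hqd
      have h1 : q ∣ D := by
        apply hprime q hq
        rw [hu]
        refine (hqd.trans ⟨3, ?_⟩).trans (lehmerE_dvd_lehmerE_mul hAQ 1 u)
        rw [he1]; ring
      rw [hC] at h1
      rcases hq.dvd_mul.mp h1 with h | h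
      · exact (Nat.prime_dvd_prime_iff_eq hq Nat.prime_three).mp h
      · exfalso
        have h2 := (dvd_sub_left (Int.natCast_dvd_natCast.mpr h)).mp hqd
        have h3 := (Nat.prime_iff_prime_int.mp hq).dvd_of_dvd_pow h2
        have h4 := (Nat.prime_dvd_prime_iff_eq hq Nat.prime_two).mp (by exact_mod_cast h3)
        rw [h4] at h
        exact Nat.not_even_iff_odd.mpr hCodd (even_iff_two_dvd.mpr h)
  obtain ⟨b, η, hη, hb⟩ := hb
  rcases Nat.eq_zero_or_pos b with rfl | hb1
  · rw [pow_zero, mul_one] at hb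
    have habs : (lehmerE (4 * 2 ^ n - D) (2 ^ n) 1).natAbs = 3 := by
      rw [he1, hb]
      rcases hη with rfl | rfl <;> rfl
    exact Or.inl ⟨rfl, eq_of_natAbs_lehmerE_one_eq_three hn hD hD3 hA3 hC habs hu hprime hDe⟩
  · right; right
    have h9C : 3 ∣ C → (9 : ℤ) ∣ 4 * 2 ^ n - (4 * 2 ^ n - D) := fun h => absurd h hC3
    have hCB : ∀ q : ℕ, q.Prime → q ∣ C → (q : ℤ) ∣ 4 * 2 ^ n - (4 * 2 ^ n - D) := by
      intro q _ h
      rw [hB]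
      exact Int.natCast_dvd_natCast.mpr (h.trans ⟨3, by rw [hC]; ring⟩)
    have hCs : C ∣ 2 * s + 1 := by
      refine (dvd_lehmerE_iff hA hn hCodd h9C hCB).mp
        ((Int.natCast_dvd_natCast.mpr ⟨3, by rw [hC]; ring⟩ : (C : ℤ) ∣ D).trans hDe)
    obtain ⟨w, hw⟩ := hCodd
    obtain ⟨c, hc⟩ := hCs
    obtain ⟨v, rfl⟩ := (Nat.odd_mul.mp (hc ▸ ⟨s, rfl⟩ : Odd (C * c))).2
    have hs : s = (2 * w + 1) * v + w := by
      rw [hw] at hc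
      have : 2 * s + 1 = 2 * ((2 * w + 1) * v + w) + 1 := by rw [hc]; ring
      omega
    have hd := lehmerE_dvd_lehmerE_mul hAQ w v
    rw [← hs] at hd
    have hnab := lehmerE_natAbs_eq hA hn hw h9C (by
      intro h
      exfalso
      have h4 := lehmerE_modEq_disc (4 * 2 ^ n - D) (2 ^ n) w
      rw [hB] at h4
      have h5 := (dvd_sub_right h).mp
        ((show (3 : ℤ) ∣ D from ⟨C, by rw [hC]; push_cast; ring⟩).trans h4)
      rcases Int.prime_three.dvd_or_dvd h5 with h | h
      · exact hC3 (by rw [hw]; exact_mod_cast h)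
      · have := Int.prime_three.dvd_of_dvd_pow (Int.prime_three.dvd_of_dvd_pow h)
        norm_num at this) hCB
      (fun q hq h => by rw [hB]; exact Int.natCast_dvd_natCast.mpr (hprime q hq (h.trans hd)))
    have hCw : (C : ℤ) = 2 * w + 1 := by rw [hw]; push_cast; ring
    have hDC : (D : ℤ) = 3 * C := by rw [hC]; push_cast; ring
    have := eq_of_lehmerE_eq_sub_three_pow (A := 4 * 2 ^ n - D) hη hb1 (by rw [← hb, hDC]; ring)
      (by rw [← hb, ← hCw]; ring) hA3 (by rw [← hCw]; exact_mod_cast hC3)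
      (by rw [← Int.natAbs_sq, hnab, hCw])
    obtain ⟨rfl, rfl⟩ := this
    exact ⟨rfl, rfl, by omega⟩

theorem lehmerE_eleven_four {s j : ℕ} (hs : 0 < s) (he : lehmerE 11 4 s ^ 2 = (5 ^ j) ^ 2) :
    s = 2 := by
  have hdvd : ∀ C : ℕ, Odd C → (∀ q : ℕ, q.Prime → q ∣ C → q = 5) →
      ((C : ℤ) ∣ lehmerE 11 4 s ↔ C ∣ 2 * s + 1) := fun C hC h =>
    dvd_lehmerE_iff (A := 11) (n := 2) (by decide) (by norm_num) hC
      (fun h3 => absurd (h 3 Nat.prime_three h3) (by norm_num))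
      (fun q hq hqC => by rw [h q hq hqC]; norm_num)
  have h5 : Nat.Prime 5 := by norm_num
  rcases Nat.eq_zero_or_pos j with rfl | hj
  · exfalso
    have h16 := lehmerE_modEq_add_mul (A := 11) (Q := 4) (m := 16) (k := 1) (P := 4)
      (by simp only [lehmerE]; decide) (by simp only [lehmerE]; decide) ((s - 1) % 4) ((s - 1) / 4)
    have h7 := lehmerE_modEq_add_mul (A := 11) (Q := 4) (m := 7) (k := 0) (P := 3)
      (by decide) (by decide) (s % 3) (s / 3)
    rw [show 1 + (s - 1) % 4 + 4 * ((s - 1) / 4) = s by omega] at h16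
    rw [show 0 + s % 3 + 3 * (s / 3) = s by omega, zero_add] at h7
    have hd16 : ∀ r < 4, lehmerE 11 4 (1 + r) % 16 ≠ 1 := by decide
    have hd7 : ∀ r < 3, lehmerE 11 4 r % 7 ≠ 6 := by decide
    unfold Int.ModEq at h16 h7
    rw [pow_zero, one_pow] at he
    rcases mul_self_eq_one_iff.mp ((sq _).symm.trans he) with h | h
    · rw [h] at h16
      exact hd16 _ (Nat.mod_lt _ (by norm_num)) h16.symm
    · rw [h] at h7
      exact hd7 _ (Nat.mod_lt _ (by norm_num)) h7.symm
  have hr : 5 ∣ 2 * s + 1 := by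
    refine (hdvd 5 (by decide) fun q hq h => (Nat.prime_dvd_prime_iff_eq hq h5).mp h).mp ?_
    rw [← Int.pow_dvd_pow_iff two_ne_zero, he]
    exact pow_dvd_pow_of_dvd (dvd_pow_self _ hj.ne') 2
  obtain ⟨u, rfl⟩ : ∃ u, s = (2 * 2 + 1) * u + 2 := ⟨s / 5, by omega⟩
  rcases Nat.eq_zero_or_pos u with rfl | hu
  · rfl
  exfalso
  rcases hj.nat_succ_le.eq_or_lt with rfl | hj2
  · rw [lehmerE_comp (by norm_num)] at he
    simp only [lehmerE, lehmerF] at he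
    have : Fact (Nat.Prime 19) := ⟨by norm_num⟩
    refine lehmerE_sq_ne_one_of_pow_dvd (p := 19) (A := 11 * (-19) ^ 2) (Q := 4 ^ (2 * 2 + 1))
      (Or.inl (by norm_num)) (by norm_num) (k := 2) (by norm_num) (by norm_num) hu ?_
    rw [show (11 * (-19) ^ 2 : ℤ) = 3971 by norm_num, show (4 ^ (2 * 2 + 1) : ℤ) = 1024 by norm_num]
    norm_num at he
    linarith
  · have h25 : 25 ∣ 2 * ((2 * 2 + 1) * u + 2) + 1 := by
      refine (hdvd 25 (by decide) fun q hq h => ?_).mp ?_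
      · exact (Nat.prime_dvd_prime_iff_eq hq h5).mp (hq.dvd_of_dvd_pow (n := 2) (by simpa using h))
      · rw [← Int.pow_dvd_pow_iff two_ne_zero, he]
        exact pow_dvd_pow_of_dvd (pow_dvd_pow (5 : ℤ) hj2) 2
    obtain ⟨v, hv⟩ : ∃ v, (2 * 2 + 1) * u + 2 = (2 * 12 + 1) * v + 12 := ⟨u / 5, by omega⟩
    rw [hv] at he
    have h1 := lehmerE_dvd_lehmerE_mul (A := 11) (Q := 4) (by norm_num) 12 v
    rw [← Int.pow_dvd_pow_iff two_ne_zero, he, Int.pow_dvd_pow_iff two_ne_zero] at h1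
    have h2 : ((923701 : ℕ) : ℤ) ∣ ((5 ^ j : ℕ) : ℤ) := by
      refine Dvd.dvd.trans ?_ (by exact_mod_cast h1)
      norm_num [lehmerE]
    have h3 := Nat.Coprime.eq_one_of_dvd
      (Nat.Coprime.pow_right j (by norm_num : Nat.Coprime 923701 5)) (Int.natCast_dvd_natCast.mp h2)
    norm_num at h3

theorem lehmerE_sq_eq_pow_unique {n m D s t i j : ℕ} (hn : 1 ≤ n) (hm : Odd m) (hD : Odd D)
    (hD3 : 3 ≤ D) (hA3 : 3 ≤ 4 * (2 : ℤ) ^ n - D ^ m)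
    (h35 : ¬ (4 * (2 : ℤ) ^ n - D ^ m = 3 ∧ D = 5)) (h53 : ¬ (4 * (2 : ℤ) ^ n - D ^ m = 5 ∧ D = 3))
    (h133 : ¬ (4 * (2 : ℤ) ^ n - D ^ m = 13 ∧ D = 3)) (hs : 0 < s) (ht : 0 < t)
    (hes : lehmerE (4 * 2 ^ n - D ^ m) (2 ^ n) s ^ 2 = (D ^ i) ^ 2)
    (het : lehmerE (4 * 2 ^ n - D ^ m) (2 ^ n) t ^ 2 = (D ^ j) ^ 2) : s = t := by
  have key : 1 ≤ i ∨ 1 ≤ j → m = 1 ∧ n = 2 ∧ D = 5 := by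
    intro h
    have h' : m = 1 ∧ (n = 1 ∧ D = 3 ∨ n = 1 ∧ D = 5 ∨ n = 2 ∧ D = 5) ∨ n = 3 ∧ m = 3 ∧ D = 3 ∨
        n = 2 ∧ m = 1 ∧ D = 3 := by
      rcases h with h | h
      · exact lehmerE_sq_eq_pow hn hm hD hD3 hA3 h hes
      · exact lehmerE_sq_eq_pow hn hm hD hD3 hA3 h het
    rcases h' with ⟨rfl, ⟨rfl, rfl⟩ | ⟨rfl, rfl⟩ | ⟨rfl, rfl⟩⟩ | ⟨rfl, rfl, rfl⟩ | ⟨rfl, rfl, rfl⟩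
    · exact absurd (by norm_num) h53
    · exact absurd (by norm_num) h35
    · exact ⟨rfl, rfl, rfl⟩
    · exact absurd (by norm_num) h53
    · exact absurd (by norm_num) h133
  by_cases hij : 1 ≤ i ∨ 1 ≤ j
  · obtain ⟨rfl, rfl, rfl⟩ := key hij
    norm_num at hes het
    rw [lehmerE_eleven_four hs hes, lehmerE_eleven_four ht het]
  · obtain ⟨rfl, rfl⟩ : i = 0 ∧ j = 0 := by omega
    rw [pow_zero, one_pow] at hes het
    have hA : Odd (4 * (2 : ℤ) ^ n - D ^ m) :=
      ((by decide : Even (4 : ℤ)).mul_right _).sub_odd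
        (show Odd (D : ℤ) by exact_mod_cast hD).pow
    refine lehmerE_pow_two_sq_eq_one_unique hA hA3 hn ?_ hs ht hes het
    rintro ⟨h3, rfl⟩
    apply h35
    refine ⟨h3, ?_⟩
    have h5 : D ^ m = 5 := by
      have : (D : ℤ) ^ m = 5 := by linarith
      exact_mod_cast this
    have hm0 : m ≠ 0 := by rintro rfl; exact absurd hm (by decide)
    have := (Nat.dvd_prime (by norm_num : Nat.Prime 5)).mp (h5 ▸ dvd_pow_self D hm0)
    omega

theorem two_pow_dvd_or_dvd {p r : ℤ} {a : ℕ} (hpr : Odd (p + r)) (h : 2 ^ a ∣ p * r) :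
    2 ^ a ∣ p ∨ 2 ^ a ∣ r := by
  rcases Int.even_or_odd p with hp | hp
  · have hr : Odd r := by
      rcases Int.even_or_odd r with hr | hr
      · exact absurd (hp.add hr) (Int.not_even_iff_odd.mpr hpr)
      · exact hr
    exact .inl ((IsCoprime.pow_left (Int.isCoprime_two_left.mpr hr)).dvd_of_dvd_mul_right h)
  · exact .inr ((IsCoprime.pow_left (Int.isCoprime_two_left.mpr hp)).dvd_of_dvd_mul_left h)

theorem two_pow_dvd_of_sq_dvd_odd_mul_sq {D Z : ℤ} {a : ℕ} (hD : Odd D)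
    (h : (2 ^ a) ^ 2 ∣ D * Z ^ 2) : 2 ^ a ∣ Z := by
  refine (Int.pow_dvd_pow_iff two_ne_zero).mp
    (IsCoprime.dvd_of_dvd_mul_left ?_ h)
  exact (IsCoprime.pow_left (IsCoprime.pow_left (Int.isCoprime_two_left.mpr hD)))

/-- Composition of two representations by `C x² + D y²` of powers of two, with the sign chosen so
that the common power of two can be divided out. -/
theorem exists_dvd_composition {C D U V X Y : ℤ} {n N a : ℕ} (hC : Odd C)
    (hU : Odd U) (hV : Odd V) (hX : Odd X) (hY : Odd Y)
    (hUV : U ^ 2 + C * D * V ^ 2 = 4 * (2 ^ n) ^ 2)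
    (hXY : C * X ^ 2 + D * Y ^ 2 = 2 ^ (N + 2)) (haN : a ≤ N) (han : a ≤ 2 * n) :
    ∃ σ X' Y' : ℤ, σ ^ 2 = 1 ∧ X * U + σ * D * Y * V = 2 ^ (a + 1) * X' ∧
      Y * U - σ * C * X * V = 2 ^ (a + 1) * Y' ∧ ((a = N ↔ a ≠ 2 * n) → Odd Y') ∧
      2 ^ a * (C * X' ^ 2 + D * Y' ^ 2) = 4 * 2 ^ (N - a) * (2 ^ n) ^ 2 := by
  obtain ⟨p, hp⟩ : Even (Y * U - C * X * V) :=
    (hY.mul hU).sub_odd ((hC.mul hX).mul hV)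
  obtain ⟨r, hr⟩ : Even (Y * U + C * X * V) :=
    (hY.mul hU).add_odd ((hC.mul hX).mul hV)
  obtain ⟨b, rfl⟩ := Nat.exists_eq_add_of_le haN
  obtain ⟨c, hc⟩ := Nat.exists_eq_add_of_le han
  have hQ : ((2 : ℤ) ^ n) ^ 2 = 2 ^ a * 2 ^ c := by
    rw [← pow_mul, ← pow_add, ← hc, mul_comm]
  have hsum : p + r = Y * U := by linarith
  have hprod : p * r = 2 ^ a * (2 ^ c * Y ^ 2 - C * V ^ 2 * 2 ^ b) := by
    have e : (2 : ℤ) ^ (a + b + 2) = 4 * (2 ^ a * 2 ^ b) := by rw [pow_add, pow_add]; ring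
    rw [e] at hXY
    have : (p + p) * (r + r) = Y ^ 2 * U ^ 2 - C ^ 2 * X ^ 2 * V ^ 2 := by
      rw [← hp, ← hr]; ring
    apply mul_left_cancel₀ (four_ne_zero (α := ℤ))
    linear_combination this + Y ^ 2 * hUV + 4 * Y ^ 2 * hQ - C * V ^ 2 * hXY
  have hodd (w q : ℤ) (h : w * q = 2 ^ c * Y ^ 2 - C * V ^ 2 * 2 ^ b)
      (hab : a = a + b ↔ a ≠ 2 * n) : Odd w := by
    apply Int.Odd.of_mul_left (n := q)
    rw [h]
    rcases eq_or_ne b 0 with rfl | hb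
    · exact (((even_two).pow_of_ne_zero (by omega)).mul_right _).sub_odd
        (by simpa using hC.mul hV.pow)
    · obtain rfl : c = 0 := by omega
      exact Odd.sub_even (by simpa using hY.pow)
        (((even_two).pow_of_ne_zero hb).mul_left _)
  have h2a : (2 : ℤ) ^ a ≠ 0 := by positivity
  have key : ∃ σ Y' : ℤ, σ ^ 2 = 1 ∧ Y * U - σ * C * X * V = 2 ^ (a + 1) * Y' ∧
      ((a = a + b ↔ a ≠ 2 * n) → Odd Y') := by
    rcases two_pow_dvd_or_dvd (hsum ▸ hY.mul hU) ⟨_, hprod⟩ with ⟨w, hw⟩ | ⟨w, hw⟩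
    · exact ⟨1, w, by norm_num, by rw [pow_succ]; linear_combination hp + 2 * hw,
        hodd w r (mul_left_cancel₀ h2a (by rw [← hprod, hw]; ring))⟩
    · exact ⟨-1, w, by norm_num, by rw [pow_succ]; linear_combination hr + 2 * hw,
        hodd w p (mul_left_cancel₀ h2a (by rw [← hprod, hw]; ring))⟩
  obtain ⟨σ, Y', hσ, hY', hYodd⟩ := key
  have e : (2 : ℤ) ^ (a + b + 2) = 4 * (2 ^ a * 2 ^ b) := by rw [pow_add, pow_add]; ring
  have e' : (2 : ℤ) ^ (a + 1) = 2 * 2 ^ a := by rw [pow_succ]; ring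
  have hnorm : C * (X * U + σ * D * Y * V) ^ 2 + D * (2 * 2 ^ a * Y') ^ 2 =
      16 * (2 ^ a) ^ 2 * 2 ^ b * 2 ^ c := by
    have h2 : C * (X * U + σ * D * Y * V) ^ 2 + D * (Y * U - σ * C * X * V) ^ 2 =
        (C * X ^ 2 + D * Y ^ 2) * (U ^ 2 + C * D * V ^ 2) := by
      linear_combination (C * D ^ 2 * Y ^ 2 * V ^ 2 + D * C ^ 2 * X ^ 2 * V ^ 2) * hσ
    rw [hXY, hUV, hY', hQ, e, e'] at h2
    linear_combination h2
  obtain ⟨X', hX'⟩ : 2 ^ (a + 1) ∣ X * U + σ * D * Y * V := by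
    refine two_pow_dvd_of_sq_dvd_odd_mul_sq hC ⟨4 * 2 ^ b * 2 ^ c - D * Y' ^ 2, ?_⟩
    rw [e']
    linear_combination hnorm
  refine ⟨σ, X', Y', hσ, hX', hY', hYodd, ?_⟩
  rw [hX', e'] at hnorm
  rw [hQ, Nat.add_sub_cancel_left]
  apply mul_left_cancel₀ (mul_ne_zero (four_ne_zero (α := ℤ)) h2a)
  linear_combination hnorm

theorem odd_of_odd_of_mul_sq_add {C D X Y : ℤ} {N : ℕ} (hC : Odd C) (hD : Odd D)
    (h : C * X ^ 2 + D * Y ^ 2 = 2 ^ (N + 1)) : Odd X ↔ Odd Y := by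
  have h2 : Even (C * X ^ 2 + D * Y ^ 2) := by
    rw [h, pow_succ]; exact even_two.mul_left _
  simp only [Int.even_add, Int.even_mul, Int.even_pow] at h2
  simp only [← Int.not_even_iff_odd] at *
  tauto

theorem sq_eq_sq_of_exponent_eq {C D X Y X₁ Y₁ : ℤ} {n : ℕ} (hD : Odd D) (hC3 : 3 ≤ C)
    (hD3 : 3 ≤ D) (hX : Odd X) (hY : Odd Y) (hX₁ : Odd X₁) (hY₁ : Odd Y₁)
    (h : C * X ^ 2 + D * Y ^ 2 = 2 ^ (n + 2))
    (h₁ : C * X₁ ^ 2 + D * Y₁ ^ 2 = 2 ^ (n + 2)) : X ^ 2 = X₁ ^ 2 ∧ Y ^ 2 = Y₁ ^ 2 := by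
  have e : (2 : ℤ) ^ (n + 2) = 4 * 2 ^ n := by rw [pow_add]; ring
  obtain ⟨p, hp⟩ : Even (X * Y₁ - X₁ * Y) := (hX.mul hY₁).sub_odd (hX₁.mul hY)
  obtain ⟨r, hr⟩ : Even (X * Y₁ + X₁ * Y) := (hX.mul hY₁).add_odd (hX₁.mul hY)
  have hsum : p + r = X * Y₁ := by linarith
  have hdiv : 2 ^ n ∣ p * r := by
    refine (IsCoprime.pow_left (Int.isCoprime_two_left.mpr hD)).dvd_of_dvd_mul_left
      (y := D) ⟨X ^ 2 - X₁ ^ 2, ?_⟩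
    have : (p + p) * (r + r) = X ^ 2 * Y₁ ^ 2 - X₁ ^ 2 * Y ^ 2 := by
      rw [← hp, ← hr]; ring
    rw [e] at h h₁
    apply mul_left_cancel₀ (four_ne_zero (α := ℤ))
    linear_combination D * this + X ^ 2 * h₁ - X₁ ^ 2 * h
  have key : ∃ σ w : ℤ, σ ^ 2 = 1 ∧ X * Y₁ - σ * X₁ * Y = 2 * 2 ^ n * w := by
    rcases two_pow_dvd_or_dvd (hsum ▸ hX.mul hY₁) hdiv with ⟨w, hw⟩ | ⟨w, hw⟩
    · exact ⟨1, w, by norm_num, by linear_combination hp + 2 * hw⟩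
    · exact ⟨-1, w, by norm_num, by linear_combination hr + 2 * hw⟩
  obtain ⟨σ, w, hσ, hw⟩ := key
  have hQ : (0 : ℤ) < (2 ^ n) ^ 2 := by positivity
  have hw0 : w = 0 := by
    by_contra hne
    have h1 : 1 ≤ w ^ 2 := by have := sq_pos_of_ne_zero hne; omega
    have h2 : (C * X * X₁ + σ * D * Y * Y₁) ^ 2 + C * D * (X * Y₁ - σ * X₁ * Y) ^ 2 =
        (C * X ^ 2 + D * Y ^ 2) * (C * X₁ ^ 2 + D * Y₁ ^ 2) := by
      linear_combination (D ^ 2 * Y ^ 2 * Y₁ ^ 2 + C * D * X₁ ^ 2 * Y ^ 2) * hσ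
    rw [h, h₁, hw, e] at h2
    have h3 : 9 ≤ C * D := by nlinarith
    have h4 : 9 ≤ C * D * w ^ 2 := by nlinarith
    nlinarith [sq_nonneg (C * X * X₁ + σ * D * Y * Y₁), mul_le_mul_of_nonneg_left h4 hQ.le]
  have hXY : X ^ 2 * Y₁ ^ 2 = X₁ ^ 2 * Y ^ 2 := by
    have : X * Y₁ = σ * X₁ * Y := by rw [hw0] at hw; linarith
    calc X ^ 2 * Y₁ ^ 2 = (X * Y₁) ^ 2 := by ring
      _ = _ := by rw [this]; linear_combination X₁ ^ 2 * Y ^ 2 * hσ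
  have hne : (2 : ℤ) ^ (n + 2) ≠ 0 := by positivity
  have hX2 : X ^ 2 = X₁ ^ 2 := by
    apply mul_left_cancel₀ hne
    linear_combination D * hXY - X ^ 2 * h₁ + X₁ ^ 2 * h
  refine ⟨hX2, mul_left_cancel₀ (show D ≠ 0 by omega) ?_⟩
  linear_combination h - h₁ - C * hX2

/-- Every representation of a power of two by `C x² + D y²` with odd `x`, `y` comes from the one
with least exponent. -/
theorem exists_eq_lehmer {C D X₁ Y₁ : ℤ} {n : ℕ} (hC : Odd C) (hD : Odd D) (hC3 : 3 ≤ C)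
    (hD3 : 3 ≤ D) (hn : 1 ≤ n) (hX₁ : Odd X₁) (hY₁ : Odd Y₁)
    (h₁ : C * X₁ ^ 2 + D * Y₁ ^ 2 = 2 ^ (n + 2))
    (hmin : ∀ {X Y : ℤ} {N : ℕ}, Odd X → Odd Y → C * X ^ 2 + D * Y ^ 2 = 2 ^ (N + 2) → n ≤ N)
    {X Y : ℤ} {N : ℕ} (hX : Odd X) (hY : Odd Y) (h : C * X ^ 2 + D * Y ^ 2 = 2 ^ (N + 2)) :
    ∃ (s : ℕ) (ε δ : ℤ), ε ^ 2 = 1 ∧ δ ^ 2 = 1 ∧ N = n * (2 * s + 1) ∧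
      X = ε * (X₁ * lehmerF (C * X₁ ^ 2) (2 ^ n) s) ∧
      Y = δ * (Y₁ * lehmerE (C * X₁ ^ 2) (2 ^ n) s) := by
  induction N using Nat.strong_induction_on generalizing X Y with
  | _ N ih =>
  have hA : Odd (C * X₁ ^ 2) := hC.mul (hX₁.pow)
  have hQ : Even ((2 : ℤ) ^ n) := (even_two).pow_of_ne_zero (by omega)
  have e₁ : (2 : ℤ) ^ (n + 2) = 4 * 2 ^ n := by rw [pow_add]; ring
  have hU : Odd (C * X₁ ^ 2 - 2 * 2 ^ n) := hA.sub_even (even_two.mul_right _)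
  have hV : Odd (X₁ * Y₁) := hX₁.mul hY₁
  have hUV : (C * X₁ ^ 2 - 2 * 2 ^ n) ^ 2 + C * D * (X₁ * Y₁) ^ 2 = 4 * (2 ^ n) ^ 2 := by
    rw [e₁] at h₁
    linear_combination C * X₁ ^ 2 * h₁
  have hnN := hmin hX hY h
  rcases hnN.eq_or_lt with rfl | hlt
  · obtain ⟨hx, hy⟩ := sq_eq_sq_of_exponent_eq hD hC3 hD3 hX hY hX₁ hY₁ h h₁
    rcases sq_eq_sq_iff_eq_or_eq_neg.mp hx with rfl | rfl <;>
    rcases sq_eq_sq_iff_eq_or_eq_neg.mp hy with rfl | rfl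
    · exact ⟨0, 1, 1, by simp [lehmerE, lehmerF]⟩
    · exact ⟨0, 1, -1, by simp [lehmerE, lehmerF]⟩
    · exact ⟨0, -1, 1, by simp [lehmerE, lehmerF]⟩
    · exact ⟨0, -1, -1, by simp [lehmerE, lehmerF]⟩
  · rcases lt_or_ge N (2 * n) with hN | hN
    · obtain ⟨σ, X', Y', hσ, hX', hY', hYodd, hnorm⟩ :=
        exists_dvd_composition (n := n) hC hU hV hX hY hUV h le_rfl hN.le
      obtain ⟨c, hc⟩ := Nat.exists_eq_add_of_lt hN
      have h' : C * X' ^ 2 + D * Y' ^ 2 = 2 ^ (c + 1 + 2) := by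
        apply mul_left_cancel₀ (show (2 : ℤ) ^ N ≠ 0 by positivity)
        rw [hnorm, ← pow_mul, mul_comm n 2, hc]
        simp only [Nat.sub_self, pow_add]; ring
      have hY'' : Odd Y' := hYodd (by omega)
      have := hmin ((odd_of_odd_of_mul_sq_add hC hD h').mpr hY'') hY'' h'
      omega
    · obtain ⟨σ, X', Y', hσ, hX', hY', hYodd, hnorm⟩ :=
        exists_dvd_composition (n := n) hC hU hV hX hY hUV h hN le_rfl
      obtain ⟨b, rfl⟩ := Nat.exists_eq_add_of_le hN
      have hQ2 : (2 : ℤ) ^ (2 * n) = (2 ^ n) ^ 2 := by rw [← pow_mul, mul_comm]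
      have hQ0 : ((2 : ℤ) ^ n) ^ 2 ≠ 0 := by positivity
      have h' : C * X' ^ 2 + D * Y' ^ 2 = 2 ^ (b + 2) := by
        apply mul_left_cancel₀ hQ0
        rw [← hQ2, hnorm, hQ2, Nat.add_sub_cancel_left, pow_add]; ring
      have hpar := odd_of_odd_of_mul_sq_add (N := b + 1) hC hD h'
      have hY'' : Odd Y' := by
        rcases eq_or_ne b 0 with rfl | hb
        · by_contra hY0
          have hX0 : ¬ Odd X' := hpar.not.mpr hY0
          rw [Int.not_odd_iff_even] at hX0 hY0
          obtain ⟨x, rfl⟩ := hX0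
          obtain ⟨y, rfl⟩ := hY0
          have h4 : C * x ^ 2 + D * y ^ 2 = 1 := by
            apply mul_left_cancel₀ (four_ne_zero (α := ℤ))
            linear_combination h'
          have hx : x = 0 := by
            by_contra hx
            have := sq_pos_of_ne_zero hx
            nlinarith [sq_nonneg y]
          have hy : y = 0 := by
            by_contra hy
            have := sq_pos_of_ne_zero hy
            nlinarith [sq_nonneg x]
          simp [hx, hy] at h4
        · exact hYodd (by omega)
      have hX'' := hpar.mpr hY''
      obtain ⟨s, ε, δ, hε, hδ, hs, rfl, rfl⟩ := ih b (by omega) hX'' hY'' h'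
      obtain ⟨he, hf⟩ := two_mul_lehmer_succ (C * X₁ ^ 2) (2 ^ n) s
      rw [e₁] at h₁
      rw [pow_succ _ (2 * n), hQ2] at hX' hY'
      set e := lehmerE (C * X₁ ^ 2) (2 ^ n)
      set f := lehmerF (C * X₁ ^ 2) (2 ^ n)
      set Q : ℤ := 2 ^ n
      have hXe : 2 * X = ε * (X₁ * f s) * (C * X₁ ^ 2 - 2 * Q) -
          σ * D * (δ * (Y₁ * e s)) * (X₁ * Y₁) := by
        apply mul_left_cancel₀ (mul_ne_zero two_ne_zero hQ0)
        linear_combination -X * hUV + (C * X₁ ^ 2 - 2 * Q) * hX' - σ * D * (X₁ * Y₁) * hY' -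
          C * D * X * (X₁ * Y₁) ^ 2 * hσ
      have hYe : 2 * Y = δ * (Y₁ * e s) * (C * X₁ ^ 2 - 2 * Q) +
          σ * C * (ε * (X₁ * f s)) * (X₁ * Y₁) := by
        apply mul_left_cancel₀ (mul_ne_zero two_ne_zero hQ0)
        linear_combination -Y * hUV + (C * X₁ ^ 2 - 2 * Q) * hY' + σ * C * (X₁ * Y₁) * hX' -
          C * D * Y * (X₁ * Y₁) ^ 2 * hσ
      have hσδ : σ * δ = ε ∨ σ * δ = -ε :=
        sq_eq_sq_iff_eq_or_eq_neg.mp (by rw [mul_pow, hσ, hδ, hε, one_mul])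
      rcases hσδ with hσδ | hσδ
      · have hσε : σ * ε = δ := by rw [← hσδ]; linear_combination δ * hσ
        refine ⟨s + 1, ε, δ, hε, hδ, by rw [hs]; ring, ?_, ?_⟩
        · apply mul_left_cancel₀ (two_ne_zero (α := ℤ))
          linear_combination hXe - ε * X₁ * hf - D * Y₁ ^ 2 * e s * X₁ * hσδ -
            ε * X₁ * e s * h₁
        · apply mul_left_cancel₀ (two_ne_zero (α := ℤ))
          linear_combination hYe - δ * Y₁ * he + C * X₁ ^ 2 * f s * Y₁ * hσε
      · exfalso
        have hXev : X = ε * X₁ * (f (s + 1) + (4 * Q - C * X₁ ^ 2) * e s) := by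
          apply mul_left_cancel₀ (two_ne_zero (α := ℤ))
          linear_combination hXe - ε * X₁ * hf - D * Y₁ ^ 2 * e s * X₁ * hσδ +
            ε * X₁ * e s * h₁
        have : Even X := by
          rw [hXev]
          refine (Odd.add_odd (odd_lehmerF hA hQ _) ?_).mul_left _
          exact ((hQ.mul_left 4).sub_odd hA).mul (odd_lehmerE hA hQ _)
        exact Int.not_even_iff_odd.mpr hX this

/-- For coprime odd `D₁, D₂` both `> 1` with
`(D₁,D₂) ∉ {(3,5), (5,3), (13,3)}`, the number of positive solutions
`(x, m, n)` with `m` odd of `D₁·x² + D₂^m = 2^(n+2)` is at most `2`. -/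
theorem stmt_9 (D₁ D₂ : ℕ) (hD₁odd : Odd D₁) (hD₂odd : Odd D₂)
    (hcop : Nat.Coprime D₁ D₂) (hD₁ : 1 < D₁) (hD₂ : 1 < D₂)
    (h1 : (D₁, D₂) ≠ (3, 5)) (h2 : (D₁, D₂) ≠ (5, 3))
    (h3 : (D₁, D₂) ≠ (13, 3)) :
    let S : Set (ℕ × ℕ × ℕ) :=
      {p | 0 < p.1 ∧ 0 < p.2.1 ∧ 0 < p.2.2 ∧ Odd p.2.1 ∧
        D₁ * p.1 ^ 2 + D₂ ^ p.2.1 = 2 ^ (p.2.2 + 2)}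
    S.Finite ∧ S.ncard ≤ 2 := by
  intro S
  rcases S.eq_empty_or_nonempty with hS | hS
  · simp [hS]
  -- the solution with the least exponent of `D₂`
  obtain ⟨m, ⟨x₀, N₀, hp₀⟩, hm_min⟩ : ∃ m, (∃ x N, (x, m, N) ∈ S) ∧
      ∀ p ∈ S, m ≤ p.2.1 := by
    have hex : ∃ m, ∃ x N, (x, m, N) ∈ S := by
      obtain ⟨⟨x, m, N⟩, hp⟩ := hS
      exact ⟨m, x, N, hp⟩
    classical
    exact ⟨Nat.find hex, Nat.find_spec hex, fun p hp ↦ Nat.find_min' hex ⟨p.1, p.2.2, hp⟩⟩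
  have hm : Odd m := hp₀.2.2.2.1
  set D := D₂ ^ m with hDdef
  have hD₁3 : 3 ≤ D₁ := by obtain ⟨k, rfl⟩ := hD₁odd; omega
  have hD₂3 : 3 ≤ D₂ := by obtain ⟨k, rfl⟩ := hD₂odd; omega
  have hC : Odd (D₁ : ℤ) := by exact_mod_cast hD₁odd
  have hDodd : Odd (D : ℤ) := by exact_mod_cast hD₂odd.pow
  have hC3 : (3 : ℤ) ≤ D₁ := by exact_mod_cast hD₁3
  have hD3 : (3 : ℤ) ≤ D := by exact_mod_cast hD₂3.trans (Nat.le_self_pow hm.pos.ne' _)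
  have hrep : ∀ p ∈ S, ∃ j : ℕ, p.2.1 = m + 2 * j ∧ Odd (p.1 : ℤ) ∧ Odd ((D₂ : ℤ) ^ j) ∧
      (D₁ : ℤ) * (p.1 : ℤ) ^ 2 + D * ((D₂ : ℤ) ^ j) ^ 2 = 2 ^ (p.2.2 + 2) := by
    intro p hp
    obtain ⟨k, hk⟩ := Nat.exists_eq_add_of_le (hm_min p hp)
    obtain ⟨-, -, -, hodd, heq⟩ := hp
    obtain ⟨j, rfl⟩ : Even k := by
      rw [hk, Nat.odd_add] at hodd
      exact hodd.mp hm
    have hj : Odd ((D₂ : ℤ) ^ j) := by exact_mod_cast hD₂odd.pow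
    have h : (D₁ : ℤ) * (p.1 : ℤ) ^ 2 + D * ((D₂ : ℤ) ^ j) ^ 2 = 2 ^ (p.2.2 + 2) := by
      rw [hk] at heq
      rw [← pow_mul, hDdef]
      push_cast
      rw [← pow_add, mul_two]
      exact_mod_cast heq
    exact ⟨j, by omega, (odd_of_odd_of_mul_sq_add (N := p.2.2 + 1) hC hDodd h).mpr hj, hj, h⟩
  -- the representation with the least exponent
  obtain ⟨n, ⟨X₁, Y₁, hX₁, hY₁, h₁⟩, hn_min⟩ : ∃ n : ℕ,
      (∃ X Y : ℤ, Odd X ∧ Odd Y ∧ D₁ * X ^ 2 + D * Y ^ 2 = 2 ^ (n + 2)) ∧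
      ∀ {X Y : ℤ} {N : ℕ}, Odd X → Odd Y → D₁ * X ^ 2 + D * Y ^ 2 = 2 ^ (N + 2) → n ≤ N := by
    have hex : ∃ n : ℕ, ∃ X Y : ℤ, Odd X ∧ Odd Y ∧ D₁ * X ^ 2 + D * Y ^ 2 = 2 ^ (n + 2) := by
      obtain ⟨j, -, hx, hj, h⟩ := hrep _ hp₀
      exact ⟨_, _, _, hx, hj, h⟩
    classical
    exact ⟨Nat.find hex, Nat.find_spec hex,
      fun hX hY h ↦ Nat.find_min' hex ⟨_, _, hX, hY, h⟩⟩
  have one_le_sq {z : ℤ} (hz : Odd z) : 1 ≤ z ^ 2 := by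
    have := sq_pos_of_ne_zero (show z ≠ 0 by rintro rfl; simp at hz)
    omega
  have hn : 1 ≤ n := by
    by_contra h0
    obtain rfl : n = 0 := by omega
    norm_num at h₁
    nlinarith [one_le_sq hX₁, one_le_sq hY₁]
  have hdesc {X Y : ℤ} {N : ℕ} (hX : Odd X) (hY : Odd Y)
      (h : (D₁ : ℤ) * X ^ 2 + D * Y ^ 2 = 2 ^ (N + 2)) :=
    exists_eq_lehmer hC hDodd hC3 hD3 hn hX₁ hY₁ h₁ hn_min hX hY h
  have hY₁sq : Y₁ ^ 2 = 1 := by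
    obtain ⟨j, hj, hx, -, h⟩ := hrep _ hp₀
    obtain rfl : j = 0 := by simpa using hj
    obtain ⟨s, ε, δ, -, -, -, -, hY⟩ := hdesc hx (by simp) h
    have : IsUnit Y₁ := isUnit_of_dvd_one ⟨δ * lehmerE (D₁ * X₁ ^ 2) (2 ^ n) s, by
      rw [pow_zero] at hY; rw [hY]; ring⟩
    exact Int.isUnit_sq this
  have hA : (D₁ : ℤ) * X₁ ^ 2 = 4 * 2 ^ n - (D₂ : ℤ) ^ m := by
    rw [hY₁sq, pow_add, hDdef] at h₁
    push_cast at h₁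
    linarith
  have hA3 : 3 ≤ (D₁ : ℤ) * X₁ ^ 2 := by nlinarith [one_le_sq hX₁]
  have hexc {a b : ℕ} (ha : a.Prime) (h : (D₁, D₂) ≠ (a, b)) :
      ¬ ((4 * 2 ^ n - (D₂ : ℤ) ^ m) = a ∧ D₂ = b) := by
    rintro ⟨hAa, rfl⟩
    rw [← hA] at hAa
    have hdvd : D₁ ∣ a := Int.natCast_dvd_natCast.mp ⟨_, hAa.symm⟩
    exact h (by rw [(ha.eq_one_or_self_of_dvd _ hdvd).resolve_left hD₁.ne'])
  have huniq {s t i j : ℕ} (hs : 0 < s) (ht : 0 < t)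
      (hes : lehmerE (D₁ * X₁ ^ 2) (2 ^ n) s ^ 2 = ((D₂ : ℤ) ^ i) ^ 2)
      (het : lehmerE (D₁ * X₁ ^ 2) (2 ^ n) t ^ 2 = ((D₂ : ℤ) ^ j) ^ 2) : s = t := by
    rw [hA] at hes het hA3
    exact lehmerE_sq_eq_pow_unique hn hm (by exact_mod_cast hD₂odd) (by exact_mod_cast hD₂3) hA3
      (by exact_mod_cast hexc Nat.prime_three h1) (by exact_mod_cast hexc Nat.prime_five h2)
      (by exact_mod_cast hexc (a := 13) (by norm_num) h3) hs ht hes het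
  have hS_index : ∀ p ∈ S, ∃ s j : ℕ, p.2.1 = m + 2 * j ∧ p.2.2 = n * (2 * s + 1) ∧
      (p.1 : ℤ) ^ 2 = X₁ ^ 2 * lehmerF (D₁ * X₁ ^ 2) (2 ^ n) s ^ 2 ∧
      lehmerE (D₁ * X₁ ^ 2) (2 ^ n) s ^ 2 = ((D₂ : ℤ) ^ j) ^ 2 := by
    intro p hp
    obtain ⟨j, hj, hx, hjodd, h⟩ := hrep p hp
    obtain ⟨s, ε, δ, hε, hδ, hN, hX, hY⟩ := hdesc hx hjodd h
    refine ⟨s, j, hj, hN, ?_, ?_⟩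
    · rw [hX, mul_pow, hε]; ring
    · rw [hY, mul_pow, mul_pow, hδ, hY₁sq]; ring
  choose! ι j hm' hN' hx' he' using hS_index
  have hinj : Set.InjOn ι S := by
    intro p hp q hq hpq
    have hj : j p = j q := by
      have : ((D₂ : ℤ) ^ j p) ^ 2 = ((D₂ : ℤ) ^ j q) ^ 2 := by
        rw [← he' p hp, ← he' q hq, hpq]
      have : (D₂ ^ j p) ^ 2 = (D₂ ^ j q) ^ 2 := by exact_mod_cast this
      exact Nat.pow_right_injective hD₂ (Nat.pow_left_injective two_ne_zero this)
    have hx : p.1 = q.1 := by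
      have : (p.1 : ℤ) ^ 2 = (q.1 : ℤ) ^ 2 := by rw [hx' p hp, hx' q hq, hpq]
      exact Nat.pow_left_injective two_ne_zero (by exact_mod_cast this)
    exact Prod.ext hx (Prod.ext (by rw [hm' p hp, hm' q hq, hj]) (by rw [hN' p hp, hN' q hq, hpq]))
  obtain ⟨s₀, hs₀⟩ : ∃ s₀, Set.MapsTo ι S {0, s₀} := by
    by_cases h : ∃ p ∈ S, 0 < ι p
    · obtain ⟨p, hp, hpos⟩ := h
      refine ⟨ι p, fun q hq ↦ ?_⟩
      rcases Nat.eq_zero_or_pos (ι q) with h0 | h0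
      · exact .inl h0
      · exact .inr (huniq h0 hpos (he' q hq) (he' p hp))
    · push Not at h
      exact ⟨0, fun q hq ↦ .inl (Nat.le_zero.mp (h q hq))⟩
  have hfin : ({0, s₀} : Set ℕ).Finite := Set.toFinite _
  exact ⟨hfin.of_injOn hs₀ hinj,
    (Set.ncard_le_ncard_of_injOn ι hs₀ hinj hfin).trans (by simpa using Set.ncard_insert_le 0 {s₀})⟩
end

section
/- The only solution in positive integers r, s with r ≥ 5 of the equation 2^(2r−3) − 2^r + 1 = 97^s is (r,s) = (5,1). -/
theorem two_pow_dvd_of_two_pow_dvd_ninetySeven_pow_sub_one (k s : ℕ)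
    (h : (2 : ℤ) ^ (k + 5) ∣ 97 ^ s - 1) : 2 ^ k ∣ s := by
  induction k generalizing s with
  | zero => simp
  | succ k ih =>
    have hmod : (97 : ℤ) ^ s ≡ 1 [ZMOD 64] :=
      (Int.modEq_iff_dvd.mpr ((pow_dvd_pow (2 : ℤ) (by lia : 6 ≤ k + 1 + 5)).trans h)).symm
    obtain ⟨t, rfl | rfl⟩ := s.even_or_odd'
    · obtain ⟨m, hm⟩ : ∃ m : ℤ, (97 : ℤ) ^ t + 1 = 2 * m ∧ IsCoprime (2 : ℤ) m := by
        have h4 : (97 : ℤ) ^ t ≡ 1 [ZMOD 4] := by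
          simpa using (show (97 : ℤ) ≡ 1 [ZMOD 4] by decide).pow t
        obtain ⟨c, hc⟩ := h4.symm.dvd
        exact ⟨2 * c + 1, by linarith, -c, 1, by ring⟩
      have hdvd : (2 : ℤ) ^ (k + 5) ∣ 97 ^ t - 1 := by
        refine hm.2.pow_left.dvd_of_dvd_mul_right (mul_dvd_mul_iff_left two_ne_zero |>.mp ?_)
        have hfac : 2 * ((97 ^ t - 1) * m) = (97 : ℤ) ^ (2 * t) - 1 := by
          linear_combination (-(97 : ℤ) ^ t + 1) * hm.1
        rwa [hfac, ← pow_succ']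
      rw [pow_succ']
      exact mul_dvd_mul_left 2 (ih t hdvd)
    · have h33 : (97 : ℤ) ^ (2 * t + 1) ≡ 33 [ZMOD 64] := by
        have hsq : ((97 : ℤ) ^ 2) ^ t ≡ 1 [ZMOD 64] := by
          simpa using (show (97 : ℤ) ^ 2 ≡ 1 [ZMOD 64] by decide).pow t
        rw [pow_succ, pow_mul]
        exact hsq.mul (show (97 : ℤ) ≡ 33 [ZMOD 64] by decide)
      exact absurd (h33.symm.trans hmod) (by decide)

/-- The only solution in positive integers `r, s` with `r ≥ 5` of
`2^(2r-3) - 2^r + 1 = 97^s` is `(r, s) = (5, 1)`. -/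
theorem stmt_11 (r s : ℕ) (hr : 5 ≤ r) (hs : 0 < s) :
    2 ^ (2 * r - 3) + 1 = 97 ^ s + 2 ^ r ↔ (r, s) = (5, 1) := by
  constructor
  · intro h
    obtain ⟨k, rfl⟩ := Nat.exists_eq_add_of_le' hr
    rw [show 2 * (k + 5) - 3 = (k + 5) + (k + 2) by lia, pow_add 2 (k + 5)] at h
    have hdvd : 2 ^ k ∣ s := by
      refine two_pow_dvd_of_two_pow_dvd_ninetySeven_pow_sub_one k s ⟨2 ^ (k + 2) - 1, ?_⟩
      have hz : (2 : ℤ) ^ (k + 5) * 2 ^ (k + 2) + 1 = 97 ^ s + 2 ^ (k + 5) := mod_cast h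
      linear_combination -hz
    have hle : 2 ^ k ≤ s := Nat.le_of_dvd hs hdvd
    have hlt : 2 ^ (6 * s) < 2 ^ (2 * k + 7) := by
      calc 2 ^ (6 * s) = 64 ^ s := by rw [pow_mul]; norm_num
        _ ≤ 97 ^ s := Nat.pow_le_pow_left (by norm_num) s
        _ < 2 ^ (k + 5) * 2 ^ (k + 2) := by
          have := Nat.one_lt_two_pow (n := k + 5) (by lia)
          lia
        _ = 2 ^ (2 * k + 7) := by ring
    have hexp : 6 * s < 2 * k + 7 := (Nat.pow_lt_pow_iff_right one_lt_two).mp hlt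
    have hk : k < 2 ^ k := Nat.lt_two_pow_self
    obtain rfl : k = 0 := by lia
    obtain rfl : s = 1 := by lia
    rfl
  · rintro ⟨⟩
    norm_num
end

section
/- The equation 7·x² + 25^(2y) = 2^(z+2) has no solution in positive integers x, y, z. Equivalently, 7·x² + 5^(4y) = 2^(z+2) has no solution in positive integers. -/
/-- Multiplication by `ω = (1 + √-7) / 2` on `R[ω]`, in coordinates `(p, q) ↦ p + q ω`. -/
def omegaMul {R : Type*} [CommRing R] (a : R × R) : R × R := (-2 * a.2, a.1 + a.2)

theorem map_omegaMul_iterate {R S : Type*} [CommRing R] [CommRing S] (f : R →+* S) (n : ℕ)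
    (a : R × R) :
    Prod.map f f (omegaMul^[n] a) = omegaMul^[n] (Prod.map f f a) := by
  have h : Function.Semiconj (Prod.map f f) (omegaMul (R := R)) (omegaMul (R := S)) := by
    intro a
    simp [omegaMul, map_ofNat]
  exact h.iterate_right n a

theorem omegaMul_iterate_parity (n : ℕ) :
    Even (omegaMul^[n + 1] ((1, 0) : ℤ × ℤ)).1 ∧ Odd (omegaMul^[n + 1] ((1, 0) : ℤ × ℤ)).2 := by
  induction n with
  | zero => simp [omegaMul]
  | succ n ih =>
    rw [Function.iterate_succ_apply']
    refine ⟨?_, ih.1.add_odd ih.2⟩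
    simp [omegaMul]

/-- Every primitive representation of `2 ^ (n + 3)` by `b² + 7 x²` comes from a power of `ω`. -/
theorem eq_omegaMul_iterate_of_sq_add_seven_mul_sq (n : ℕ) (b x : ℤ) (hb : Odd b) (hx : Odd x)
    (h : b ^ 2 + 7 * x ^ 2 = 2 ^ (n + 3)) :
    let a := omegaMul^[n + 1] ((1, 0) : ℤ × ℤ)
    (b = 2 * a.1 + a.2 ∨ b = -(2 * a.1 + a.2)) ∧ (x = a.2 ∨ x = -a.2) := by
  induction n generalizing b x with
  | zero =>
    norm_num at h
    have hb1 : b ≤ 2 := by nlinarith [sq_nonneg x]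
    have hb2 : -2 ≤ b := by nlinarith [sq_nonneg x]
    have hx1 : x ≤ 1 := by nlinarith [sq_nonneg b]
    have hx2 : -1 ≤ x := by nlinarith [sq_nonneg b]
    interval_cases b <;> interval_cases x <;> simp_all [omegaMul]
  | succ n ih =>
    have key : ∀ y : ℤ, Odd y → b ^ 2 + 7 * y ^ 2 = 2 ^ (n + 1 + 3) → 4 ∣ y - b →
        let a := omegaMul^[n + 1 + 1] ((1, 0) : ℤ × ℤ)
        (b = 2 * a.1 + a.2 ∨ b = -(2 * a.1 + a.2)) ∧ (y = a.2 ∨ y = -a.2) := by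
      rintro y hy h ⟨c, hc⟩
      obtain rfl : y = b + 4 * c := by linarith
      have h' : (2 * b + 7 * c) ^ 2 + 7 * c ^ 2 = 2 ^ (n + 3) := by
        rw [show n + 1 + 3 = n + 3 + 1 by ring, pow_succ 2 (n + 3)] at h
        linarith
      have hc : Odd c := by
        by_contra hc
        obtain ⟨d, rfl⟩ := Int.not_odd_iff_even.mp hc
        have hodd : Odd (b ^ 2 + 2 * (7 * b * d + 28 * d ^ 2)) := hb.pow.add_even (even_two_mul _)
        have heq : b ^ 2 + 2 * (7 * b * d + 28 * d ^ 2) = 2 * 2 ^ n := by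
          have h2 : (2 : ℤ) ^ (n + 3) = 8 * 2 ^ n := by ring
          linarith
        rw [heq] at hodd
        exact Int.not_even_iff_odd.mpr hodd (even_two_mul _)
      have hbc : Odd (2 * b + 7 * c) := by
        rcases hc with ⟨d, rfl⟩
        exact ⟨b + 7 * d + 3, by ring⟩
      have := ih _ _ hbc hc h'
      obtain ⟨hp, hq⟩ := omegaMul_iterate_parity n
      rw [Function.iterate_succ_apply']
      generalize omegaMul^[n + 1] ((1, 0) : ℤ × ℤ) = a at *
      obtain ⟨p, q⟩ := a
      simp only [omegaMul] at *
      grind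
    have hdvd : 4 ∣ x - b ∨ 4 ∣ -x - b := by
      rcases hb with ⟨d, rfl⟩
      rcases hx with ⟨e, rfl⟩
      omega
    rcases hdvd with hd | hd
    · exact key x hx h hd
    · have := key (-x) hx.neg (by rw [neg_sq]; exact h) hd
      grind

theorem omegaMul_iterate_zmod (n : ℕ) :
    let a := omegaMul^[n] ((1, 0) : ZMod 275 × ZMod 275)
    11 * (2 * a.1 + a.2) = 0 → 25 * (2 * a.1 + a.2) = 0 := by
  have hper : Function.IsPeriodicPt omegaMul 120 ((1, 0) : ZMod 275 × ZMod 275) := by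
    unfold Function.IsPeriodicPt Function.IsFixedPt
    decide +kernel
  rw [← hper.iterate_mod_apply n]
  have hlt : n % 120 < 120 := Nat.mod_lt _ (by norm_num)
  generalize n % 120 = k at hlt
  revert k
  decide +kernel

/-- The trace of `ω ^ n` is divisible by `11` as soon as it is divisible by `25`. -/
theorem eleven_dvd_omega_trace (n : ℕ)
    (h : 25 ∣ 2 * (omegaMul^[n] ((1, 0) : ℤ × ℤ)).1 + (omegaMul^[n] ((1, 0) : ℤ × ℤ)).2) :
    11 ∣ 2 * (omegaMul^[n] ((1, 0) : ℤ × ℤ)).1 + (omegaMul^[n] ((1, 0) : ℤ × ℤ)).2 := by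
  have hz := omegaMul_iterate_zmod n
  have hm := map_omegaMul_iterate (Int.castRingHom (ZMod 275)) n (1, 0)
  simp only [Prod.map_apply, map_one, map_zero] at hm
  rw [← hm] at hz
  generalize omegaMul^[n] ((1, 0) : ℤ × ℤ) = a at *
  simp only [Prod.map_fst, Prod.map_snd, eq_intCast] at hz
  have h1 := (ZMod.intCast_zmod_eq_zero_iff_dvd (11 * (2 * a.1 + a.2)) 275)
  have h2 := (ZMod.intCast_zmod_eq_zero_iff_dvd (25 * (2 * a.1 + a.2)) 275)
  push_cast at h1 h2
  rw [h1, h2] at hz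
  omega

/-- The equation `7·x² + 25^(2y) = 2^(z+2)` has no solution in positive
integers `x, y, z`. -/
theorem stmt_12 :
    ¬ ∃ x y z : ℕ, 0 < x ∧ 0 < y ∧ 0 < z ∧
      7 * x ^ 2 + 25 ^ (2 * y) = 2 ^ (z + 2) := by
  rintro ⟨x, y, z, -, hy, hz, h⟩
  obtain ⟨n, rfl⟩ := Nat.exists_eq_succ_of_ne_zero hz.ne'
  have hZ : ((25 : ℤ) ^ y) ^ 2 + 7 * (x : ℤ) ^ 2 = 2 ^ (n + 3) := by
    rw [← pow_mul, mul_comm y 2, add_comm]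
    exact_mod_cast h
  have hb : Odd ((25 : ℤ) ^ y) := Odd.pow (by decide)
  have hx : Odd (x : ℤ) := by
    by_contra hx
    have heven : Even (7 * (x : ℤ) ^ 2) :=
      ((Int.not_odd_iff_even.mp hx).pow_of_ne_zero two_ne_zero).mul_left 7
    have hodd := hb.pow (n := 2) |>.add_even heven
    rw [hZ] at hodd
    exact Int.not_even_iff_odd.mpr hodd ((by decide : Even (2 : ℤ)).pow_of_ne_zero (by omega))
  have hdvd : (25 : ℤ) ∣ 25 ^ y := dvd_pow_self _ hy.ne'
  have h11 : (11 : ℤ) ∣ 25 ^ y := by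
    have htrace := eleven_dvd_omega_trace (n + 1)
    rcases (eq_omegaMul_iterate_of_sq_add_seven_mul_sq n _ _ hb hx hZ).1 with h1 | h1
    · rw [h1] at hdvd ⊢
      exact htrace hdvd
    · rw [h1, dvd_neg] at hdvd ⊢
      exact htrace hdvd
  have hp : Prime (11 : ℤ) := by norm_num
  have := hp.dvd_of_dvd_pow h11
  omega
end

section
/- The equation 15·x² + 49^(2y) = 2^(z+2) has no solution in positive integers x, y, z. Equivalently, 15·x² + 7^(4y) = 2^(z+2) has no solution in positive integers. -/
/-- If `A` and `B` are coprime, `A * B = 15 * x ^ 2`, and `3 ∣ A`, then `B` is a square or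
five times a square. -/
theorem Nat.Coprime.exists_sq_or_five_mul_sq {A B x : ℕ} (hAB : A.Coprime B)
    (h : A * B = 15 * x ^ 2) (h3 : 3 ∣ A) : ∃ v, B = v ^ 2 ∨ B = 5 * v ^ 2 := by
  obtain ⟨a, rfl⟩ := h3
  have haB : a.Coprime B := hAB.coprime_mul_left
  have h' : a * B = 5 * x ^ 2 := by linarith
  have h5 : 5 ∣ a * B := ⟨_, h'⟩
  rcases (Nat.Prime.dvd_mul Nat.prime_five).1 h5 with ⟨c, rfl⟩ | ⟨c, rfl⟩
  · have hc : B * c = x ^ 2 := by linarith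
    obtain ⟨v, hv⟩ := exists_eq_pow_of_mul_eq_pow
      (Nat.isUnit_iff.2 haB.coprime_mul_left.symm) hc
    exact ⟨v, Or.inl hv⟩
  · have hc : c * a = x ^ 2 := by linarith
    obtain ⟨v, hv⟩ := exists_eq_pow_of_mul_eq_pow
      (Nat.isUnit_iff.2 haB.coprime_mul_left_right.symm) hc
    exact ⟨v, Or.inr (by rw [hv])⟩

/-- If `15 * x ^ 2 + 49 ^ (2 * y) = 2 ^ n`, then `4 ∣ n`. -/
theorem four_dvd_of_fifteen_mul_sq_add_eq_two_pow {x y n : ℕ}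
    (h : 15 * x ^ 2 + 49 ^ (2 * y) = 2 ^ n) : 4 ∣ n := by
  have h49 : 49 ^ (2 * y) % 5 = 1 := by
    rw [pow_mul, Nat.pow_mod]; simp
  have h2 : 2 ^ n % 5 = 1 := by omega
  have hn : 2 ^ n % 5 = 2 ^ (n % 4) % 5 := by
    conv_lhs => rw [← Nat.div_add_mod n 4, pow_add, pow_mul, Nat.mul_mod, Nat.pow_mod]
    simp
  have hlt : n % 4 < 4 := Nat.mod_lt _ (by norm_num)
  rw [hn] at h2
  apply Nat.dvd_of_mod_eq_zero
  generalize n % 4 = r at h2 hlt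
  interval_cases r <;> simp_all

/-- The equation `15·x² + 49^(2y) = 2^(z+2)` has no solution in positive
integers `x, y, z`. -/
theorem stmt_13 :
    ¬ ∃ x y z : ℕ, 0 < x ∧ 0 < y ∧ 0 < z ∧
      15 * x ^ 2 + 49 ^ (2 * y) = 2 ^ (z + 2) := by
  rintro ⟨x, y, z, hx, hy, -, h⟩
  obtain ⟨m, hm⟩ := four_dvd_of_fifteen_mul_sq_add_eq_two_pow h
  have hP : 2 ^ (z + 2) = (4 ^ m) ^ 2 := by
    rw [hm, ← pow_mul, show 4 * m = 2 * (m * 2) by ring, pow_mul]; norm_num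
  rw [hP, mul_comm 2 y, pow_mul] at h
  have hQ : 49 ≤ 49 ^ y := Nat.le_self_pow hy.ne' 49
  have hlt : 49 ^ y < 4 ^ m := lt_of_pow_lt_pow_left₀ 2 (by positivity) (by
    have : 0 < x ^ 2 := by positivity
    omega)
  have hm2 : 2 ≤ m := by
    by_contra! hm'
    interval_cases m <;> omega
  have hP8 : 4 ^ m % 8 = 0 := by
    obtain ⟨k, rfl⟩ := Nat.exists_eq_add_of_le hm2
    rw [pow_add]; omega
  have hP3 : 4 ^ m % 3 = 1 := by rw [Nat.pow_mod]; simp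
  have hQ3 : 49 ^ y % 3 = 1 := by rw [Nat.pow_mod]; simp
  have hQ8 : 49 ^ y % 8 = 1 := by rw [Nat.pow_mod]; simp
  have hPQ : (4 ^ m).Coprime (49 ^ y) := Nat.Coprime.pow _ _ (by norm_num)
  obtain ⟨A, hA⟩ := Nat.exists_eq_add_of_le' hlt.le
  generalize 49 ^ y = Q at *
  generalize 4 ^ m = P at *
  subst hA
  have hcop : A.Coprime (2 * Q + A) := by
    rw [Nat.coprime_add_self_right]
    refine Nat.Coprime.mul_right ?_ (by simpa using hPQ)
    rw [Nat.coprime_two_right, Nat.odd_iff]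
    omega
  obtain ⟨v, hv | hv⟩ := hcop.exists_sq_or_five_mul_sq (x := x) (by linarith) (by omega)
  · have : v ^ 2 % 3 = 2 := by omega
    have hv3 : v % 3 < 3 := Nat.mod_lt _ (by norm_num)
    rw [Nat.pow_mod] at this
    generalize v % 3 = r at *
    interval_cases r <;> omega
  · have : v ^ 2 % 8 = 5 := by omega
    have hv8 : v % 8 < 8 := Nat.mod_lt _ (by norm_num)
    rw [Nat.pow_mod] at this
    generalize v % 8 = r at *
    interval_cases r <;> omega
end
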